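/- arXiv:2406.13000 — 3 statements merged into one kernel-verified Lean document; each statement's English description precedes it below -/
import Mathlib

section
/- For every constant ε ∈ (0,1) and every constant M > 1 there is a constant γ = γ(ε,M) > 0 such that for all sufficiently large n and all Δ > n/M the following holds: for every (possibly adaptive) Builder strategy in the online edge coloring game Φ(n,Δ,ε), the randomized greedy algorithm 𝒜 colors every presented edge (i.e., produces a proper edge coloring of the resulting graph using at most ⌈(1+ε)Δ⌉ colors) with probability at least 1 − 2^{−γ·Δ}. -/
open scoped Classical

namespace RandomGreedyEC

/-- The state of the online edge-coloring game on vertex set `Fin n` with color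
set `Fin K`: the list of presented edges (`none` = null edge), each together
with the color it was assigned (`none` = left uncolored). -/
abbrev State (n K : ℕ) := List (Option (Sym2 (Fin n)) × Option (Fin K))

/-- The set of colors that are free (not yet used on an incident edge) at every
endpoint of the edge `e` in the state `s`. -/
noncomputable def freeEdge (n K : ℕ) (s : State n K) (e : Sym2 (Fin n)) :
    Finset (Fin K) :=
  Finset.univ.filter fun c =>
    ∀ v ∈ e, ∀ p ∈ s, (∃ e', p.1 = some e' ∧ v ∈ e') → p.2 ≠ some c

/-- One step of the randomized greedy algorithm `𝒜`: a non-null edge receives a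
uniformly random legal color (and no color if there is none); a null edge
receives no color. -/
noncomputable def greedyStep (n K : ℕ) (s : State n K) :
    Option (Sym2 (Fin n)) → PMF (Option (Fin K))
  | none => PMF.pure none
  | some e =>
      if h : (freeEdge n K s e).Nonempty then (PMF.uniformOfFinset _ h).map some
      else PMF.pure none

/-- The distribution of the state of the game after a given number of steps,
when the randomized greedy algorithm plays against the Builder strategy `B`. -/
noncomputable def run (n K : ℕ) (B : State n K → Option (Sym2 (Fin n))) :
    ℕ → PMF (State n K)
  | 0 => PMF.pure []
  | i + 1 =>
      (run n K B i).bind fun s =>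
        (greedyStep n K s (B s)).map fun c => s ++ [(B s, c)]

/-- Number of presented (non-null) edges incident to `v` in the state `s`. -/
noncomputable def degreeIn (n K : ℕ) (s : State n K) (v : Fin n) : ℕ :=
  (s.filter fun p => decide (∃ e, p.1 = some e ∧ v ∈ e)).length

/-- A Builder move is legal if the new edge is not a loop, has not been
presented before, and keeps all vertex degrees at most `Δ`. -/
def LegalMove (n K Δ : ℕ) (s : State n K) (e : Sym2 (Fin n)) : Prop :=
  ¬ e.IsDiag ∧ (∀ p ∈ s, p.1 ≠ some e) ∧ ∀ v ∈ e, degreeIn n K s v < Δ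

/-- The game replaces an illegal Builder move by a null edge; this way an
arbitrary function `B` encodes an arbitrary (adaptive) legal Builder
strategy. -/
noncomputable def enforce (n K Δ : ℕ) (B : State n K → Option (Sym2 (Fin n)))
    (s : State n K) : Option (Sym2 (Fin n)) :=
  match B s with
  | none => none
  | some e => if LegalMove n K Δ s e then some e else none

/-- Every presented (non-null) edge has received a color. -/
def Success (n K : ℕ) (s : State n K) : Prop :=
  ∀ p ∈ s, p.1 ≠ none → p.2 ≠ none

/-- The partial edge coloring recorded in `s` is proper: two distinct presented
edges sharing a vertex never receive the same color. -/
def Proper (n K : ℕ) (s : State n K) : Prop :=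
  ∀ i j : Fin s.length, i ≠ j → ∀ e₁ e₂ : Sym2 (Fin n),
    (s.get i).1 = some e₁ → (s.get j).1 = some e₂ → e₁ ≠ e₂ →
    (∃ v, v ∈ e₁ ∧ v ∈ e₂) →
    ∀ c : Fin K, (s.get i).2 = some c → (s.get j).2 ≠ some c

section Expectation

variable {n K : ℕ}

lemma tsum_bind_mul {α β : Type*} (p : PMF α) (f : α → PMF β) (Φ : β → ENNReal) :
    ∑' b, (p.bind f) b * Φ b = ∑' a, p a * ∑' b, f a b * Φ b := by
  simp only [PMF.bind_apply, ← ENNReal.tsum_mul_right, ← ENNReal.tsum_mul_left]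
  rw [ENNReal.tsum_comm]
  simp only [mul_assoc]

lemma tsum_map_mul {α β : Type*} (p : PMF α) (g : α → β) (Φ : β → ENNReal) :
    ∑' b, (p.map g) b * Φ b = ∑' a, p a * Φ (g a) := by
  rw [← PMF.bind_pure_comp, tsum_bind_mul]
  refine tsum_congr fun a => ?_
  congr 1
  rw [tsum_eq_single (g a)]
  · simp
  · intro b hb
    simp [hb]

/-- A function of the state that does not increase in expectation in any step has expectation at
most its initial value. -/
lemma tsum_run_mul_le (B : State n K → Option (Sym2 (Fin n))) (Φ : State n K → ENNReal)
    (h : ∀ s, ∑' c, greedyStep n K s (B s) c * Φ (s ++ [(B s, c)]) ≤ Φ s) (T : ℕ) :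
    ∑' s, run n K B T s * Φ s ≤ Φ [] := by
  induction T with
  | zero =>
    rw [tsum_eq_single []]
    · simp [run]
    · intro b hb
      simp [run, hb]
  | succ T ih =>
    refine le_trans ?_ ih
    simp only [run]
    rw [tsum_bind_mul]
    refine ENNReal.tsum_le_tsum fun s => ?_
    rw [tsum_map_mul]
    exact mul_le_mul_right (h s) _

/-- Conditional expectation, given the state `s` and the presented edge `e`, of a function of the
color of `e`. -/
noncomputable def stepExp (s : State n K) (e : Option (Sym2 (Fin n)))
    (f : Option (Fin K) → ℝ) : ℝ :=
  ∑ c, (greedyStep n K s e c).toReal * f c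

lemma sum_greedyStep (s : State n K) (e : Option (Sym2 (Fin n))) :
    ∑ c, (greedyStep n K s e c).toReal = 1 := by
  have h := (greedyStep n K s e).tsum_coe
  rw [tsum_fintype] at h
  rw [← ENNReal.toReal_sum (fun c _ => (greedyStep n K s e).apply_ne_top c), h]
  simp

lemma stepExp_const (s : State n K) (e : Option (Sym2 (Fin n))) (a : ℝ) :
    stepExp s e (fun _ => a) = a := by
  rw [stepExp, ← Finset.sum_mul, sum_greedyStep, one_mul]

lemma stepExp_mono (s : State n K) (e : Option (Sym2 (Fin n))) {f g : Option (Fin K) → ℝ}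
    (h : ∀ c, f c ≤ g c) : stepExp s e f ≤ stepExp s e g :=
  Finset.sum_le_sum fun c _ => mul_le_mul_of_nonneg_left (h c) ENNReal.toReal_nonneg

lemma stepExp_add (s : State n K) (e : Option (Sym2 (Fin n))) (f g : Option (Fin K) → ℝ) :
    stepExp s e (fun c => f c + g c) = stepExp s e f + stepExp s e g := by
  simp [stepExp, mul_add, Finset.sum_add_distrib]

lemma stepExp_mul_left (s : State n K) (e : Option (Sym2 (Fin n))) (a : ℝ)
    (f : Option (Fin K) → ℝ) :
    stepExp s e (fun c => a * f c) = a * stepExp s e f := by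
  simp only [stepExp, Finset.mul_sum]
  exact Finset.sum_congr rfl fun c _ => by ring

lemma stepExp_sub (s : State n K) (e : Option (Sym2 (Fin n))) (f g : Option (Fin K) → ℝ) :
    stepExp s e (fun c => f c - g c) = stepExp s e f - stepExp s e g := by
  simp [stepExp, mul_sub, Finset.sum_sub_distrib]

lemma stepExp_sum {ι : Type*} (t : Finset ι) (s : State n K) (e : Option (Sym2 (Fin n)))
    (f : ι → Option (Fin K) → ℝ) :
    stepExp s e (fun c => ∑ i ∈ t, f i c) = ∑ i ∈ t, stepExp s e (f i) := by
  simp only [stepExp, Finset.mul_sum]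
  exact Finset.sum_comm

lemma abs_stepExp_le (s : State n K) (e : Option (Sym2 (Fin n))) {f : Option (Fin K) → ℝ}
    {b : ℝ} (h : ∀ c, |f c| ≤ b) : |stepExp s e f| ≤ b := by
  rw [abs_le]
  constructor
  · rw [← stepExp_const s e (-b)]
    exact stepExp_mono s e fun c => (abs_le.1 (h c)).1
  · rw [← stepExp_const s e b]
    exact stepExp_mono s e fun c => (abs_le.1 (h c)).2

/-- Sum of the increments `G` along the history recorded in `s`. -/
noncomputable def pathSum
    (G : State n K → Option (Sym2 (Fin n)) × Option (Fin K) → ℝ) (s : State n K) : ℝ :=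
  ∑ i ∈ Finset.range s.length, G (s.take i) (s.getD i (none, none))

lemma pathSum_append (G : State n K → Option (Sym2 (Fin n)) × Option (Fin K) → ℝ)
    (s : State n K) (p : Option (Sym2 (Fin n)) × Option (Fin K)) :
    pathSum G (s ++ [p]) = pathSum G s + G s p := by
  unfold pathSum
  rw [List.length_append, List.length_singleton, Finset.sum_range_succ]
  congr 1
  · refine Finset.sum_congr rfl fun i hi => ?_
    rw [Finset.mem_range] at hi
    rw [List.take_append_of_le_length hi.le, List.getD_append _ _ _ _ hi]
  · simp

lemma stepExp_exp_le (s : State n K) (e : Option (Sym2 (Fin n))) {g : Option (Fin K) → ℝ}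
    {b l : ℝ} (hl : 0 ≤ l) (hlb : l * b ≤ 1) (hg : stepExp s e g = 0) (hb : ∀ c, |g c| ≤ b) :
    stepExp s e (fun c => Real.exp (l * g c)) ≤ Real.exp (l ^ 2 * b ^ 2) := by
  calc stepExp s e (fun c => Real.exp (l * g c))
      ≤ stepExp s e (fun c => (1 + l ^ 2 * b ^ 2) + l * g c) := by
        refine stepExp_mono s e fun c => ?_
        have h1 : |l * g c| ≤ l * b := by
          rw [abs_mul, abs_of_nonneg hl]
          exact mul_le_mul_of_nonneg_left (hb c) hl
        have h2 := Real.abs_exp_sub_one_sub_id_le (h1.trans hlb)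
        have h3 : (l * g c) ^ 2 ≤ (l * b) ^ 2 := sq_le_sq' (abs_le.1 h1).1 (abs_le.1 h1).2
        have h4 := (abs_le.1 h2).2
        nlinarith
    _ = 1 + l ^ 2 * b ^ 2 := by
        rw [stepExp_add, stepExp_const, stepExp_mul_left, hg]; ring
    _ ≤ Real.exp (l ^ 2 * b ^ 2) := by
        rw [add_comm]; exact Real.add_one_le_exp _

/-- Exponential tail bound for sums of bounded, conditionally centered increments, on the event
that at most `V` increments are active. -/
lemma pathSum_tail (B : State n K → Option (Sym2 (Fin n)))
    (G : State n K → Option (Sym2 (Fin n)) × Option (Fin K) → ℝ)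
    (I : Option (Sym2 (Fin n)) → Prop) {b l a V : ℝ} (hl : 0 ≤ l) (hlb : l * b ≤ 1)
    (hmean : ∀ s, stepExp s (B s) (fun c => G s (B s, c)) = 0)
    (hbound : ∀ s c, |G s (B s, c)| ≤ if I (B s) then b else 0) (T : ℕ) :
    (run n K B T).toOuterMeasure
      {s | a ≤ pathSum G s ∧ pathSum (fun _ p => if I p.1 then (1 : ℝ) else 0) s ≤ V} ≤
      ENNReal.ofReal (Real.exp (-(l * a) + l ^ 2 * b ^ 2 * V)) := by
  set cnt : State n K → ℝ := pathSum (fun _ p => if I p.1 then (1 : ℝ) else 0) with hcnt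
  set Φ : State n K → ENNReal := fun s =>
    ENNReal.ofReal (Real.exp (l * pathSum G s - l ^ 2 * b ^ 2 * cnt s)) with hΦ
  have hstep : ∀ s, ∑' c, greedyStep n K s (B s) c * Φ (s ++ [(B s, c)]) ≤ Φ s := by
    intro s
    have key : stepExp s (B s) (fun c => Real.exp (l * G s (B s, c))) ≤
        Real.exp (l ^ 2 * b ^ 2 * if I (B s) then 1 else 0) := by
      have hb := hbound s
      by_cases hI : I (B s)
      · simp only [hI, if_true, mul_one] at hb ⊢
        exact stepExp_exp_le s _ hl hlb (hmean s) hb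
      · simp only [hI, if_false] at hb ⊢
        have h0 : ∀ c, G s (B s, c) = 0 := fun c => abs_nonpos_iff.1 (hb c)
        simp [h0, stepExp_const]
    rw [tsum_fintype]
    have h1 : ∀ c, greedyStep n K s (B s) c * Φ (s ++ [(B s, c)]) =
        ENNReal.ofReal ((greedyStep n K s (B s) c).toReal *
          (Real.exp (l * pathSum G s - l ^ 2 * b ^ 2 * cnt s -
            l ^ 2 * b ^ 2 * if I (B s) then 1 else 0) * Real.exp (l * G s (B s, c)))) := by
      intro c
      rw [ENNReal.ofReal_mul ENNReal.toReal_nonneg,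
        ENNReal.ofReal_toReal ((greedyStep n K s (B s)).apply_ne_top c), ← Real.exp_add]
      simp only [hΦ, hcnt, pathSum_append]
      congr 3
      ring
    rw [Finset.sum_congr rfl fun c _ => h1 c, ← ENNReal.ofReal_sum_of_nonneg
      (fun c _ => by positivity)]
    refine ENNReal.ofReal_le_ofReal ?_
    have h2 := stepExp_mul_left s (B s) (Real.exp (l * pathSum G s - l ^ 2 * b ^ 2 * cnt s -
            l ^ 2 * b ^ 2 * if I (B s) then 1 else 0)) (fun c => Real.exp (l * G s (B s, c)))
    rw [stepExp] at h2
    rw [h2]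
    refine (mul_le_mul_of_nonneg_left key (Real.exp_nonneg _)).trans ?_
    rw [← Real.exp_add]
    exact le_of_eq (by congr 1; ring)
  have hE := tsum_run_mul_le B Φ hstep T
  have h0 : Φ [] = 1 := by simp [hΦ, hcnt, pathSum]
  rw [h0] at hE
  set x := l * a - l ^ 2 * b ^ 2 * V with hx
  have hM : ENNReal.ofReal (Real.exp x) * (run n K B T).toOuterMeasure
      {s | a ≤ pathSum G s ∧ cnt s ≤ V} ≤ 1 := by
    refine le_trans ?_ hE
    rw [PMF.toOuterMeasure_apply, ← ENNReal.tsum_mul_left]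
    refine ENNReal.tsum_le_tsum fun s => ?_
    by_cases hs : s ∈ {s | a ≤ pathSum G s ∧ cnt s ≤ V}
    · rw [Set.indicator_of_mem hs, mul_comm]
      refine mul_le_mul_right (ENNReal.ofReal_le_ofReal (Real.exp_le_exp.2 ?_)) _
      have h1 := mul_le_mul_of_nonneg_left hs.1 hl
      have h2 := mul_le_mul_of_nonneg_left hs.2 (by positivity : 0 ≤ l ^ 2 * b ^ 2)
      linarith
    · rw [Set.indicator_of_notMem hs]
      simp
  have h3 : -(l * a) + l ^ 2 * b ^ 2 * V = -x := by rw [hx]; ring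
  rw [h3, Real.exp_neg, ENNReal.ofReal_inv_of_pos (Real.exp_pos x), ← one_div,
    ENNReal.le_div_iff_mul_le (by simp [Real.exp_pos]) (by simp), mul_comm]
  exact hM

end Expectation

section Discrepancy

variable {n K : ℕ}

/-- The set of colors that are free at the vertex `v`. -/
noncomputable def freeAt (s : State n K) (v : Fin n) : Finset (Fin K) :=
  Finset.univ.filter fun c => ∀ p ∈ s, (∃ e', p.1 = some e' ∧ v ∈ e') → p.2 ≠ some c

lemma mem_freeAt {s : State n K} {v : Fin n} {c : Fin K} :
    c ∈ freeAt s v ↔ ∀ p ∈ s, (∃ e', p.1 = some e' ∧ v ∈ e') → p.2 ≠ some c := by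
  simp [freeAt]

lemma freeEdge_mk (s : State n K) (u w : Fin n) :
    freeEdge n K s s(u, w) = freeAt s u ∩ freeAt s w := by
  ext c
  simp only [freeEdge, Finset.mem_filter, Finset.mem_univ, true_and, Finset.mem_inter, mem_freeAt,
    Sym2.mem_iff]
  constructor
  · intro h
    exact ⟨h u (Or.inl rfl), h w (Or.inr rfl)⟩
  · rintro ⟨h1, h2⟩ v (rfl | rfl)
    · exact h1
    · exact h2

lemma freeAt_append_of_notMem (s : State n K) (p : Option (Sym2 (Fin n)) × Option (Fin K))
    (v : Fin n) (h : ∀ e, p.1 = some e → v ∉ e) : freeAt (s ++ [p]) v = freeAt s v := by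
  ext c
  simp only [mem_freeAt, List.mem_append, List.mem_singleton]
  constructor
  · intro H q hq
    exact H q (Or.inl hq)
  · rintro H q (hq | rfl)
    · exact H q hq
    · rintro ⟨e, he, hv⟩
      exact absurd hv (h e he)

lemma freeAt_append_none (s : State n K) (e : Option (Sym2 (Fin n))) (v : Fin n) :
    freeAt (s ++ [(e, none)]) v = freeAt s v := by
  ext c
  simp only [mem_freeAt, List.mem_append, List.mem_singleton]
  constructor
  · intro H q hq
    exact H q (Or.inl hq)
  · rintro H q (hq | rfl)
    · exact H q hq
    · simp

lemma freeAt_append_some (s : State n K) (e : Sym2 (Fin n)) (c : Fin K) (v : Fin n)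
    (h : v ∈ e) : freeAt (s ++ [(some e, some c)]) v = (freeAt s v).erase c := by
  ext c'
  simp only [mem_freeAt, List.mem_append, List.mem_singleton, Finset.mem_erase]
  constructor
  · intro H
    refine ⟨?_, fun q hq => H q (Or.inl hq)⟩
    rintro rfl
    exact H _ (Or.inr rfl) ⟨e, rfl, h⟩ rfl
  · rintro ⟨h1, H⟩ q (hq | rfl)
    · exact H q hq
    · intro _ h2
      exact h1 (Option.some.inj h2).symm

lemma freeAt_append_subset (s t : State n K) (v : Fin n) :
    freeAt (s ++ t) v ⊆ freeAt s v := by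
  intro c hc
  rw [mem_freeAt] at hc ⊢
  exact fun p hp => hc p (List.mem_append_left _ hp)

lemma le_card_freeAt (s : State n K) (v : Fin n) :
    K ≤ (freeAt s v).card + degreeIn n K s v := by
  have h1 : (freeAt s v)ᶜ.card ≤ degreeIn n K s v := by
    have hsub : (freeAt s v)ᶜ ⊆
        ((s.filter fun p => decide (∃ e, p.1 = some e ∧ v ∈ e)).filterMap Prod.snd).toFinset := by
      intro c hc
      rw [Finset.mem_compl, mem_freeAt] at hc
      push Not at hc
      obtain ⟨p, hp, he, hpc⟩ := hc
      rw [List.mem_toFinset, List.mem_filterMap]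
      refine ⟨p, ?_, hpc⟩
      rw [List.mem_filter]
      exact ⟨hp, by simpa using he⟩
    exact (Finset.card_le_card hsub).trans
      ((List.toFinset_card_le _).trans (List.length_filterMap_le _ _))
  rw [Finset.card_compl, Fintype.card_fin] at h1
  omega

/-- The discrepancy of the free colors at `v` on the color set `A`, normalized so that it vanishes
when the free colors have the same density in `A` as in the whole color set. -/
noncomputable def disc (A : Finset (Fin K)) (s : State n K) (v : Fin n) : ℝ :=
  K * (freeAt s v ∩ A).card / (freeAt s v).card - A.card

noncomputable def discInc (A : Finset (Fin K)) (v : Fin n) (s : State n K)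
    (p : Option (Sym2 (Fin n)) × Option (Fin K)) : ℝ :=
  disc A (s ++ [p]) v - disc A s v

noncomputable def discDrift (A : Finset (Fin K)) (v : Fin n) (s : State n K)
    (e : Option (Sym2 (Fin n))) : ℝ :=
  stepExp s e fun c => discInc A v s (e, c)

noncomputable def discFluct (A : Finset (Fin K)) (v : Fin n) (s : State n K)
    (p : Option (Sym2 (Fin n)) × Option (Fin K)) : ℝ :=
  discInc A v s p - discDrift A v s p.1

lemma stepExp_discFluct (A : Finset (Fin K)) (v : Fin n) (s : State n K)
    (e : Option (Sym2 (Fin n))) : stepExp s e (fun c => discFluct A v s (e, c)) = 0 := by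
  simp only [discFluct]
  rw [stepExp_sub, stepExp_const, discDrift, sub_self]

lemma discInc_of_notMem (A : Finset (Fin K)) (v : Fin n) (s : State n K)
    (p : Option (Sym2 (Fin n)) × Option (Fin K)) (h : ∀ e, p.1 = some e → v ∉ e) :
    discInc A v s p = 0 := by
  simp [discInc, disc, freeAt_append_of_notMem s p v h]

lemma discDrift_of_notMem (A : Finset (Fin K)) (v : Fin n) (s : State n K)
    (e : Option (Sym2 (Fin n))) (h : ∀ e', e = some e' → v ∉ e') : discDrift A v s e = 0 := by
  rw [discDrift]
  simp only [fun c => discInc_of_notMem A v s (e, c) h]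
  exact stepExp_const s e 0

lemma discFluct_of_notMem (A : Finset (Fin K)) (v : Fin n) (s : State n K)
    (p : Option (Sym2 (Fin n)) × Option (Fin K)) (h : ∀ e, p.1 = some e → v ∉ e) :
    discFluct A v s p = 0 := by
  rw [discFluct, discInc_of_notMem A v s p h, discDrift_of_notMem A v s p.1 h, sub_self]

lemma disc_nil (A : Finset (Fin K)) (v : Fin n) (hK : 0 < K) :
    disc A ([] : State n K) v = 0 := by
  have : freeAt ([] : State n K) v = Finset.univ := by simp [freeAt]
  have hK' : (K : ℝ) ≠ 0 := by positivity
  simp [disc, hK', this]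

/-- The change of the discrepancy when the color `c` becomes used at `v`. -/
lemma discInc_some (A : Finset (Fin K)) (v : Fin n) (s : State n K) (e : Sym2 (Fin n))
    (c : Fin K) (hv : v ∈ e) (hc : c ∈ freeAt s v) (hk : 1 < (freeAt s v).card) :
    discInc A v s (some e, some c) =
      K * ((freeAt s v ∩ A).card / ((freeAt s v).card * ((freeAt s v).card - 1)) -
        (if c ∈ A then 1 else 0) / ((freeAt s v).card - 1)) := by
  have hk1 : (1 : ℝ) < (freeAt s v).card := by exact_mod_cast hk
  have h1 : (((freeAt s v).erase c).card : ℝ) = (freeAt s v).card - 1 := by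
    rw [Finset.card_erase_of_mem hc, Nat.cast_sub (by omega), Nat.cast_one]
  have h2 : ((((freeAt s v).erase c) ∩ A).card : ℝ) =
      (freeAt s v ∩ A).card - (if c ∈ A then 1 else 0) := by
    rw [Finset.erase_inter]
    split_ifs with hA
    · have hm : c ∈ freeAt s v ∩ A := Finset.mem_inter.2 ⟨hc, hA⟩
      have := Finset.card_pos.2 ⟨c, hm⟩
      rw [Finset.card_erase_of_mem hm, Nat.cast_sub (by omega), Nat.cast_one]
    · rw [Finset.erase_eq_of_notMem (fun h => hA (Finset.mem_inter.1 h).2), sub_zero]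
  rw [discInc, disc, disc, freeAt_append_some s e c v hv, h1, h2]
  have h3 : ((freeAt s v).card : ℝ) - 1 ≠ 0 := by linarith
  have h4 : ((freeAt s v).card : ℝ) ≠ 0 := by linarith
  field_simp
  ring

lemma abs_discInc_le (A : Finset (Fin K)) (v : Fin n) (s : State n K) (e : Sym2 (Fin n))
    (c : Option (Fin K)) (hv : v ∈ e) (hk : 1 < (freeAt s v).card) :
    |discInc A v s (some e, c)| ≤ K / ((freeAt s v).card - 1) := by
  have hk1 : (1 : ℝ) < (freeAt s v).card := by exact_mod_cast hk
  have hnn : (0 : ℝ) ≤ K / ((freeAt s v).card - 1) :=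
    div_nonneg (Nat.cast_nonneg _) (by linarith)
  rcases c with _ | c
  · simpa [discInc, disc, freeAt_append_none] using hnn
  by_cases hc : c ∈ freeAt s v
  · rw [discInc_some A v s e c hv hc hk, abs_mul, abs_of_nonneg (Nat.cast_nonneg K),
      div_eq_mul_inv (K : ℝ)]
    refine mul_le_mul_of_nonneg_left ?_ (Nat.cast_nonneg K)
    have hle : ((freeAt s v ∩ A).card : ℝ) ≤ (freeAt s v).card := by
      exact_mod_cast Finset.card_le_card Finset.inter_subset_left
    have h1 : ((freeAt s v ∩ A).card : ℝ) / ((freeAt s v).card * ((freeAt s v).card - 1)) ≤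
        ((freeAt s v).card - 1 : ℝ)⁻¹ := by
      rw [div_mul_eq_div_div, div_le_iff₀ (by linarith), inv_mul_cancel₀ (by linarith)]
      exact div_le_one_of_le₀ hle (by linarith)
    have h0 : 0 ≤ ((freeAt s v ∩ A).card : ℝ) / ((freeAt s v).card * ((freeAt s v).card - 1)) :=
      div_nonneg (Nat.cast_nonneg _) (mul_nonneg (by linarith) (by linarith))
    have h2 : 0 ≤ ((freeAt s v).card - 1 : ℝ)⁻¹ := inv_nonneg.2 (by linarith)
    rw [abs_le]
    split_ifs
    · rw [one_div]; constructor <;> linarith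
    · rw [zero_div]; constructor <;> linarith
  · rw [discInc, disc, disc, freeAt_append_some s e c v hv, Finset.erase_eq_of_notMem hc,
      sub_self, abs_zero]
    exact hnn

lemma abs_discFluct_le (A : Finset (Fin K)) (v : Fin n) (s : State n K) (e : Sym2 (Fin n))
    (c : Option (Fin K)) {b : ℝ} (hv : v ∈ e) (hk : 1 < (freeAt s v).card)
    (hb : K / ((freeAt s v).card - 1) ≤ b) :
    |discFluct A v s (some e, c)| ≤ 2 * b := by
  have h1 : ∀ c, |discInc A v s (some e, c)| ≤ b := fun c =>
    (abs_discInc_le A v s e c hv hk).trans hb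
  have h2 : |discDrift A v s (some e)| ≤ b := abs_stepExp_le s (some e) h1
  have h3 := abs_sub (discInc A v s (some e, c)) (discDrift A v s (some e))
  rw [discFluct]
  linarith [h1 c]

lemma stepExp_some (s : State n K) (e : Sym2 (Fin n)) (h : (freeEdge n K s e).Nonempty)
    (f : Option (Fin K) → ℝ) :
    stepExp s (some e) f =
      (∑ c ∈ freeEdge n K s e, f (some c)) / (freeEdge n K s e).card := by
  have hcard : (freeEdge n K s e).card ≠ 0 := Finset.card_ne_zero.2 h
  have hs : ∀ c, greedyStep n K s (some e) (some c) =
      if c ∈ freeEdge n K s e then ((freeEdge n K s e).card : ENNReal)⁻¹ else 0 := by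
    intro c
    simp only [greedyStep, h, dif_pos]
    rw [PMF.map_apply, tsum_eq_single c]
    · simp [PMF.uniformOfFinset_apply]
    · intro b hb
      simp [Ne.symm hb]
  have hn : greedyStep n K s (some e) none = 0 := by
    simp only [greedyStep, h, dif_pos]
    rw [PMF.map_apply]
    simp
  rw [stepExp, Fintype.sum_option, hn]
  simp only [hs, ENNReal.toReal_zero, zero_mul, zero_add]
  have hf : ∀ c, (if c ∈ freeEdge n K s e then ((freeEdge n K s e).card : ENNReal)⁻¹ else
      0).toReal * f (some c) =
      if c ∈ freeEdge n K s e then f (some c) / (freeEdge n K s e).card else 0 := by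
    intro c
    split_ifs
    · simp [div_eq_inv_mul]
    · simp
  rw [Finset.sum_congr rfl fun c _ => hf c, Finset.sum_ite_mem, Finset.univ_inter,
    Finset.sum_div]

lemma discDrift_mk (A : Finset (Fin K)) (u w : Fin n) (s : State n K)
    (hk : 1 < (freeAt s u).card) (hC : 0 < (freeAt s u ∩ freeAt s w).card) (hK : 0 < K) :
    discDrift A u s (some s(u, w)) =
      (freeAt s w).card / ((freeAt s u).card * ((freeAt s u).card - 1) *
        (freeAt s u ∩ freeAt s w).card) *
      ((freeAt s u ∩ A).card * disc (freeAt s u) s w -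
        (freeAt s u).card * disc (freeAt s u ∩ A) s w) := by
  have hne : (freeEdge n K s s(u, w)).Nonempty := by
    rw [freeEdge_mk]; exact Finset.card_pos.1 hC
  rw [discDrift, stepExp_some s _ hne, freeEdge_mk]
  have h1 : ∑ c ∈ freeAt s u ∩ freeAt s w, discInc A u s (some s(u, w), some c) =
      ∑ c ∈ freeAt s u ∩ freeAt s w,
        (K * ((freeAt s u ∩ A).card / ((freeAt s u).card * ((freeAt s u).card - 1)) -
        (if c ∈ A then 1 else 0) / ((freeAt s u).card - 1)) : ℝ) :=
    Finset.sum_congr rfl fun c hc =>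
      discInc_some A u s _ c (Sym2.mem_mk_left u w) (Finset.mem_inter.1 hc).1 hk
  have h2 : ∑ c ∈ freeAt s u ∩ freeAt s w, (if c ∈ A then (1 : ℝ) else 0) =
      (freeAt s w ∩ (freeAt s u ∩ A)).card := by
    rw [Finset.sum_boole, Finset.filter_mem_eq_inter]
    congr 2
    ext c
    simp only [Finset.mem_inter]
    tauto
  rw [h1, ← Finset.mul_sum, Finset.sum_sub_distrib, Finset.sum_const, nsmul_eq_mul,
    ← Finset.sum_div _ (fun c => if c ∈ A then (1 : ℝ) else 0), h2, disc, disc,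
    Finset.inter_comm (freeAt s w) (freeAt s u)]
  have hw : 0 < (freeAt s w).card :=
    hC.trans_le (Finset.card_le_card Finset.inter_subset_right)
  have hk1 : (1 : ℝ) < (freeAt s u).card := by exact_mod_cast hk
  have e1 : ((freeAt s u).card : ℝ) - 1 ≠ 0 := by linarith
  have e2 : ((freeAt s u).card : ℝ) ≠ 0 := by linarith
  have e3 : ((freeAt s w).card : ℝ) ≠ 0 := Nat.cast_ne_zero.2 hw.ne'
  have e4 : ((freeAt s u ∩ freeAt s w).card : ℝ) ≠ 0 := Nat.cast_ne_zero.2 hC.ne'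
  have e5 : (K : ℝ) ≠ 0 := Nat.cast_ne_zero.2 hK.ne'
  generalize ((freeAt s u).card : ℝ) = a at *
  generalize ((freeAt s w).card : ℝ) = b at *
  generalize ((freeAt s u ∩ freeAt s w).card : ℝ) = d at *
  generalize ((freeAt s u ∩ A).card : ℝ) = f at *
  generalize ((freeAt s u ∩ freeAt s w ∩ A).card : ℝ) = g at *
  clear h1 h2 hk1
  field_simp
  ring

lemma abs_discDrift_le (A : Finset (Fin K)) (u w : Fin n) (s : State n K) {D : ℝ}
    (hk : 1 < (freeAt s u).card) (hC : 0 < (freeAt s u ∩ freeAt s w).card) (hK : 0 < K)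
    (hD : (K : ℝ) / (((freeAt s u).card - 1) * (freeAt s u ∩ freeAt s w).card) ≤ D) :
    |discDrift A u s (some s(u, w))| ≤
      D * (|disc (freeAt s u) s w| + |disc (freeAt s u ∩ A) s w|) := by
  have hk1 : (1 : ℝ) < (freeAt s u).card := by exact_mod_cast hk
  have hC' : (0 : ℝ) < (freeAt s u ∩ freeAt s w).card := by exact_mod_cast hC
  have hwK : ((freeAt s w).card : ℝ) ≤ K := by
    exact_mod_cast (Finset.card_le_univ _).trans_eq (Fintype.card_fin K)
  have hle : ((freeAt s u ∩ A).card : ℝ) ≤ (freeAt s u).card := by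
    exact_mod_cast Finset.card_le_card Finset.inter_subset_left
  set x := |disc (freeAt s u) s w|
  set y := |disc (freeAt s u ∩ A) s w|
  have hb : |((freeAt s u ∩ A).card * disc (freeAt s u) s w -
        (freeAt s u).card * disc (freeAt s u ∩ A) s w)| ≤ (freeAt s u).card * (x + y) := by
    refine (abs_sub _ _).trans ?_
    rw [abs_mul, abs_mul, Nat.abs_cast, Nat.abs_cast]
    have : 0 ≤ x := abs_nonneg _
    nlinarith
  have hden : (0 : ℝ) < ((freeAt s u).card - 1) * (freeAt s u ∩ freeAt s w).card :=
    mul_pos (by linarith) hC'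
  rw [discDrift_mk A u w s hk hC hK, abs_mul, abs_of_nonneg (div_nonneg (Nat.cast_nonneg _)
    (mul_nonneg (mul_nonneg (by linarith) (by linarith)) hC'.le))]
  calc _ ≤ (freeAt s w).card / ((freeAt s u).card * ((freeAt s u).card - 1) *
        (freeAt s u ∩ freeAt s w).card) * ((freeAt s u).card * (x + y)) :=
        mul_le_mul_of_nonneg_left hb (div_nonneg (Nat.cast_nonneg _)
          (mul_nonneg (mul_nonneg (by linarith) (by linarith)) hC'.le))
    _ = (freeAt s w).card / (((freeAt s u).card - 1) * (freeAt s u ∩ freeAt s w).card) *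
        (x + y) := by
        have e1 : ((freeAt s u).card : ℝ) - 1 ≠ 0 := by linarith
        have e2 : ((freeAt s u).card : ℝ) ≠ 0 := by linarith
        field_simp
    _ ≤ D * (x + y) := by
        refine mul_le_mul_of_nonneg_right ?_ (by positivity)
        refine le_trans ?_ hD
        exact div_le_div_of_nonneg_right hwK hden.le

end Discrepancy

section Propagation

variable {n K : ℕ}

/-- The sum of `f i x` over the edges `s(v, x)` presented at a time `i < t`. -/
noncomputable def nbrSum (e : ℕ → Option (Sym2 (Fin n))) (v : Fin n) (t : ℕ)
    (f : ℕ → Fin n → ℝ) : ℝ :=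
  ∑ i ∈ Finset.range t, ∑ x, if e i = some s(v, x) then f i x else 0

lemma nbrSum_succ (e : ℕ → Option (Sym2 (Fin n))) (v : Fin n) (t : ℕ) (f : ℕ → Fin n → ℝ) :
    nbrSum e v (t + 1) f =
      nbrSum e v t f + ∑ x, if e t = some s(v, x) then f t x else 0 := by
  rw [nbrSum, Finset.sum_range_succ, nbrSum]

lemma nbrSum_mono (e : ℕ → Option (Sym2 (Fin n))) (v : Fin n) (t : ℕ) {f g : ℕ → Fin n → ℝ}
    (h : ∀ i < t, ∀ x, f i x ≤ g i x) : nbrSum e v t f ≤ nbrSum e v t g := by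
  refine Finset.sum_le_sum fun i hi => Finset.sum_le_sum fun x _ => ?_
  split_ifs
  · exact h i (Finset.mem_range.1 hi) x
  · exact le_rfl

lemma nbrSum_add (e : ℕ → Option (Sym2 (Fin n))) (v : Fin n) (t : ℕ) (f g : ℕ → Fin n → ℝ) :
    nbrSum e v t (fun i x => f i x + g i x) = nbrSum e v t f + nbrSum e v t g := by
  simp only [nbrSum, ← Finset.sum_add_distrib]
  refine Finset.sum_congr rfl fun i _ => Finset.sum_congr rfl fun x _ => ?_
  split_ifs <;> simp

/-- Since no edge is presented twice, a sum over the edges at `v` is at most a sum over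
vertices. -/
lemma exists_nbrSum_le (e : ℕ → Option (Sym2 (Fin n)))
    (he : ∀ i j z, e i = some z → e j = some z → i = j) (v : Fin n) (t : ℕ) (ht : 0 < t) :
    ∃ r : Fin n → ℕ, (∀ x, r x < t) ∧ ∀ f : ℕ → Fin n → ℝ, (∀ i x, 0 ≤ f i x) →
      nbrSum e v t f ≤ ∑ x, f (r x) x := by
  refine ⟨fun x => if h : ∃ i, i < t ∧ e i = some s(v, x) then h.choose else 0, ?_, ?_⟩
  · intro x
    dsimp only
    split_ifs with h
    · exact h.choose_spec.1
    · exact ht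
  · intro f hf
    rw [nbrSum, Finset.sum_comm]
    refine Finset.sum_le_sum fun x _ => ?_
    by_cases h : ∃ i, i < t ∧ e i = some s(v, x)
    · dsimp only
      rw [dif_pos h, Finset.sum_eq_single h.choose]
      · rw [if_pos h.choose_spec.2]
      · intro j _ hj
        rw [if_neg fun hj' => hj (he _ _ _ hj' h.choose_spec.2)]
      · intro hn
        exact absurd (Finset.mem_range.2 h.choose_spec.1) hn
    · rw [Finset.sum_eq_zero]
      · exact hf _ _
      · intro i hi
        rw [if_neg fun hz => h ⟨i, Finset.mem_range.1 hi, hz⟩]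

/-- A decreasing sequence of sets is given by thresholds. -/
lemma exists_threshold {α : Type*} (A : ℕ → Finset α) (hA : Antitone A) (T : ℕ) :
    ∃ τ : α → ℕ, (∀ c, τ c ≤ T) ∧ ∀ i < T, ∀ c, c ∈ A i ↔ i < τ c := by
  refine ⟨fun c => ((Finset.range T).filter fun i => c ∈ A i).card, fun c => ?_, ?_⟩
  · exact (Finset.card_filter_le _ _).trans_eq (Finset.card_range T)
  · intro i hi c
    constructor
    · intro hc
      have : Finset.range (i + 1) ⊆ (Finset.range T).filter fun i => c ∈ A i := by
        intro j hj
        rw [Finset.mem_range] at hj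
        exact Finset.mem_filter.2 ⟨Finset.mem_range.2 (by omega), hA (by omega : j ≤ i) hc⟩
      simpa using Finset.card_le_card this
    · intro hc
      by_contra hn
      have : ((Finset.range T).filter fun i => c ∈ A i) ⊆ Finset.range i := by
        intro j hj
        rw [Finset.mem_filter] at hj
        rw [Finset.mem_range]
        by_contra hij
        exact hn (hA (not_lt.1 hij) hj.2)
      have := Finset.card_le_card this
      dsimp only at hc
      rw [Finset.card_range] at this
      omega

lemma sum_sum_edge_le (z : Option (Sym2 (Fin n))) {b : ℝ} (hb : 0 ≤ b) (f : Fin n → ℝ)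
    (hf : ∀ x, f x ≤ b) :
    ∑ v, ∑ x, (if z = some s(v, x) then f x else 0) ≤ 2 * b := by
  rcases z with _ | z
  · simp only [reduceCtorEq, if_false, Finset.sum_const_zero]; positivity
  induction z using Sym2.ind with
  | _ p q =>
    calc ∑ v, ∑ x, (if some s(p, q) = some s(v, x) then f x else 0)
        ≤ ∑ v, ∑ x, ((if v = p ∧ x = q then b else 0) + if v = q ∧ x = p then b else 0) := by
          refine Finset.sum_le_sum fun v _ => Finset.sum_le_sum fun x _ => ?_
          have hx := hf x
          by_cases h : some s(p, q) = some s(v, x)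
          · rw [if_pos h]
            rw [Option.some_inj, Sym2.eq_iff] at h
            rcases h with ⟨rfl, rfl⟩ | ⟨rfl, rfl⟩
            · rw [if_pos ⟨rfl, rfl⟩]
              split_ifs <;> linarith
            · rw [if_pos (c := q = q ∧ p = p) ⟨rfl, rfl⟩]
              split_ifs <;> linarith
          · rw [if_neg h]
            split_ifs <;> linarith
      _ = 2 * b := by
          simp only [Finset.sum_add_distrib, ite_and]
          simp
          ring

/-- Upper bounds on the accumulated drift, propagated along the presented edges. -/
noncomputable def driftBound (e : ℕ → Option (Sym2 (Fin n))) (α β : ℝ) : ℕ → Fin n → ℝ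
  | 0, _ => α
  | t + 1, v => driftBound e α β t v +
      β * ∑ x, if e t = some s(v, x) then driftBound e α β t x else 0

lemma driftBound_eq (e : ℕ → Option (Sym2 (Fin n))) (α β : ℝ) (t : ℕ) (v : Fin n) :
    driftBound e α β t v = α + β * nbrSum e v t (driftBound e α β) := by
  induction t with
  | zero => simp [driftBound, nbrSum]
  | succ t ih => rw [driftBound, nbrSum_succ, ih]; ring

lemma driftBound_nonneg (e : ℕ → Option (Sym2 (Fin n))) {α β : ℝ} (hα : 0 ≤ α) (hβ : 0 ≤ β)
    (t : ℕ) (v : Fin n) : 0 ≤ driftBound e α β t v := by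
  induction t generalizing v with
  | zero => exact hα
  | succ t ih =>
    rw [driftBound]
    refine add_nonneg (ih v) (mul_nonneg hβ (Finset.sum_nonneg fun x _ => ?_))
    split_ifs
    · exact ih x
    · exact le_rfl

lemma driftBound_mono (e : ℕ → Option (Sym2 (Fin n))) {α β : ℝ} (hα : 0 ≤ α) (hβ : 0 ≤ β)
    (v : Fin n) : Monotone fun t => driftBound e α β t v := by
  refine monotone_nat_of_le_succ fun t => ?_
  rw [driftBound]
  refine le_add_of_nonneg_right (mul_nonneg hβ (Finset.sum_nonneg fun x _ => ?_))
  split_ifs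
  · exact driftBound_nonneg e hα hβ t x
  · exact le_rfl

lemma driftBound_le_sum (e : ℕ → Option (Sym2 (Fin n)))
    (he : ∀ i j z, e i = some z → e j = some z → i = j) {α β : ℝ} (hα : 0 ≤ α) (hβ : 0 ≤ β)
    (t : ℕ) (v : Fin n) :
    driftBound e α β t v ≤ α + β * ∑ x, driftBound e α β t x := by
  rcases Nat.eq_zero_or_pos t with rfl | ht
  · exact le_add_of_nonneg_right (mul_nonneg hβ
      (Finset.sum_nonneg fun x _ => driftBound_nonneg e hα hβ 0 x))
  rw [driftBound_eq]
  obtain ⟨r, hr, H⟩ := exists_nbrSum_le e he v t ht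
  have h1 := H (driftBound e α β) fun i x => driftBound_nonneg e hα hβ i x
  have h2 : ∑ x, driftBound e α β (r x) x ≤ ∑ x, driftBound e α β t x :=
    Finset.sum_le_sum fun x _ => driftBound_mono e hα hβ x (hr x).le
  have := mul_le_mul_of_nonneg_left (h1.trans h2) hβ
  linarith

lemma driftBound_le (e : ℕ → Option (Sym2 (Fin n)))
    (he : ∀ i j z, e i = some z → e j = some z → i = j) {α β : ℝ} (hα : 0 ≤ α) (hβ : 0 ≤ β)
    (t : ℕ) (v : Fin n) :
    driftBound e α β t v ≤ α * (1 + β * n) * Real.exp (2 * β ^ 2 * t) := by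
  refine (driftBound_le_sum e he hα hβ t v).trans ?_
  induction t with
  | zero => simp [driftBound]; linarith
  | succ t ih =>
    set ρ := α + β * ∑ x, driftBound e α β t x with hρ
    have hρ0 : 0 ≤ ρ := add_nonneg hα (mul_nonneg hβ
      (Finset.sum_nonneg fun x _ => driftBound_nonneg e hα hβ t x))
    have h1 : ∑ x, driftBound e α β (t + 1) x ≤ ∑ x, driftBound e α β t x + β * (2 * ρ) := by
      simp only [driftBound]
      rw [Finset.sum_add_distrib, ← Finset.mul_sum]
      have := mul_le_mul_of_nonneg_left (sum_sum_edge_le (e t) hρ0 _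
        fun x => driftBound_le_sum e he hα hβ t x) hβ
      linarith
    have h2 : α + β * ∑ x, driftBound e α β (t + 1) x ≤ ρ * (1 + 2 * β ^ 2) := by
      have := mul_le_mul_of_nonneg_left h1 hβ
      nlinarith
    have h3 : 1 + 2 * β ^ 2 ≤ Real.exp (2 * β ^ 2) := by
      rw [add_comm]; exact Real.add_one_le_exp _
    calc _ ≤ ρ * (1 + 2 * β ^ 2) := h2
      _ ≤ (α * (1 + β * n) * Real.exp (2 * β ^ 2 * t)) * Real.exp (2 * β ^ 2) := by
          gcongr
      _ = _ := by
          rw [mul_assoc, ← Real.exp_add]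
          push_cast
          ring_nf

/-- If aggregated fluctuations are small and drifts are controlled by the discrepancies at the
neighbors, then the aggregated discrepancies at the neighbors of any vertex are small. -/
lemma nbrSum_abs_le (e : ℕ → Option (Sym2 (Fin n)))
    (he : ∀ i j z, e i = some z → e j = some z → i = j) (F : ℕ → Fin n → Finset (Fin K))
    (hF : ∀ v, Antitone fun t => F t v) (Z X Y : ℕ → Fin n → Finset (Fin K) → ℝ)
    {T t₀ : ℕ} (ht₀ : t₀ ≤ T) {D δ M : ℝ} (hK : 0 < K) (hD : 0 ≤ D) (hδ : 0 ≤ δ)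
    (hn : (n : ℝ) ≤ M * K) (hT : (T : ℝ) ≤ M * K ^ 2)
    (hZ : ∀ t ≤ t₀, ∀ v A, Z t v A = X t v A + Y t v A)
    (hY : ∀ t ≤ t₀, ∀ v A, |Y t v A| ≤
      D / K * nbrSum e v t fun i x => |Z i x (F i v)| + |Z i x (F i v ∩ A)|)
    (hX : ∀ (r : Fin n → ℕ) (τ : Fin K → ℕ), (∀ x, r x ≤ T) → (∀ c, τ c ≤ T) →
      ∑ x, |X (r x) x (Finset.univ.filter fun c => r x < τ c)| ≤ δ * K ^ 2)
    {t : ℕ} (ht : t ≤ t₀) (v : Fin n) (A : ℕ → Finset (Fin K)) (hA : Antitone A) :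
    nbrSum e v t (fun i x => |Z i x (A i)|) ≤
      δ * K ^ 2 * (1 + 2 * M * D * (1 + 2 * D * M) * Real.exp (8 * D ^ 2 * M)) := by
  have hK' : (0 : ℝ) < K := by exact_mod_cast hK
  have hM : 0 ≤ M := by
    by_contra h
    have : (0 : ℝ) ≤ n := Nat.cast_nonneg n
    nlinarith
  set α := 2 * D * δ * K with hα
  set β := 2 * D / K with hβ
  have hα0 : 0 ≤ α := by positivity
  have hβ0 : 0 ≤ β := by positivity
  have hXsum : ∀ t ≤ t₀, ∀ v, ∀ A : ℕ → Finset (Fin K), Antitone A →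
      nbrSum e v t (fun i x => |X i x (A i)|) ≤ δ * K ^ 2 := by
    intro t ht v A hA
    rcases Nat.eq_zero_or_pos t with rfl | htp
    · simp only [nbrSum, Finset.range_zero, Finset.sum_empty]; positivity
    obtain ⟨r, hr, H⟩ := exists_nbrSum_le e he v t htp
    obtain ⟨τ, hτ, hτA⟩ := exists_threshold A hA T
    refine (H (fun i x => |X i x (A i)|) fun _ _ => abs_nonneg _).trans ?_
    refine le_trans (le_of_eq ?_) (hX r τ (fun x => by have := hr x; omega) hτ)
    refine Finset.sum_congr rfl fun x _ => ?_
    congr 2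
    ext c
    simp only [Finset.mem_filter, Finset.mem_univ, true_and]
    exact hτA _ (by have := hr x; omega) c
  have hYa : ∀ t ≤ t₀, ∀ v A, |Y t v A| ≤ driftBound e α β t v := by
    intro t
    induction t using Nat.strong_induction_on with
    | _ t ih =>
      intro ht v A
      have h1 : nbrSum e v t (fun i x => |Z i x (F i v)| + |Z i x (F i v ∩ A)|) ≤
          nbrSum e v t (fun i x => (|X i x (F i v)| + |X i x (F i v ∩ A)|) +
            (driftBound e α β i x + driftBound e α β i x)) := by
        refine nbrSum_mono e v t fun i hi x => ?_
        rw [hZ i (by omega), hZ i (by omega)]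
        have a1 := abs_add_le (X i x (F i v)) (Y i x (F i v))
        have a2 := abs_add_le (X i x (F i v ∩ A)) (Y i x (F i v ∩ A))
        have a3 := ih i hi (by omega) x (F i v)
        have a4 := ih i hi (by omega) x (F i v ∩ A)
        linarith
      simp only [nbrSum_add] at h1
      have h2 := hXsum t ht v (fun i => F i v) (hF v)
      have h3 := hXsum t ht v (fun i => F i v ∩ A)
        fun i j hij => Finset.inter_subset_inter_right (hF v hij)
      have h4 := hY t ht v A
      have h5 : D / K * nbrSum e v t (fun i x => |Z i x (F i v)| + |Z i x (F i v ∩ A)|) ≤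
          D / K * (2 * (δ * K ^ 2) + 2 * nbrSum e v t (driftBound e α β)) :=
        mul_le_mul_of_nonneg_left (by
          rw [nbrSum_add]
          have : nbrSum e v t (fun i x => driftBound e α β i x) =
            nbrSum e v t (driftBound e α β) := rfl
          linarith) (by positivity)
      refine h4.trans (h5.trans (le_of_eq ?_))
      rw [driftBound_eq e α β t v, hα, hβ]
      field_simp
  set R := α * (1 + 2 * D * M) * Real.exp (8 * D ^ 2 * M) with hR
  have hbound : ∀ i ≤ t₀, ∀ x, driftBound e α β i x ≤ R := by
    intro i hi x
    refine (driftBound_le e he hα0 hβ0 i x).trans ?_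
    have h1 : β * n ≤ 2 * D * M := by
      rw [hβ, div_mul_eq_mul_div, div_le_iff₀ hK']
      nlinarith
    have h2 : 2 * β ^ 2 * i ≤ 8 * D ^ 2 * M := by
      have hi' : (i : ℝ) ≤ M * K ^ 2 := le_trans (by exact_mod_cast hi.trans ht₀) hT
      calc 2 * β ^ 2 * i ≤ 2 * β ^ 2 * (M * K ^ 2) := by gcongr
        _ = 8 * D ^ 2 * M := by rw [hβ]; field_simp; ring
    rw [hR]
    gcongr
  have hR0 : 0 ≤ R := by positivity
  rcases Nat.eq_zero_or_pos t with rfl | htp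
  · simp only [nbrSum, Finset.range_zero, Finset.sum_empty]; positivity
  have h1 : nbrSum e v t (fun i x => |Z i x (A i)|) ≤
      nbrSum e v t (fun i x => |X i x (A i)| + R) := by
    refine nbrSum_mono e v t fun i hi x => ?_
    rw [hZ i (by omega)]
    have a1 := abs_add_le (X i x (A i)) (Y i x (A i))
    have a2 := hYa i (by omega) x (A i)
    have a3 := hbound i (by omega) x
    linarith
  rw [nbrSum_add] at h1
  obtain ⟨r, -, H⟩ := exists_nbrSum_le e he v t htp
  have h2 := H (fun _ _ => R) fun _ _ => hR0
  rw [Finset.sum_const, Finset.card_univ, Fintype.card_fin, nsmul_eq_mul] at h2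
  have h3 : n * R ≤ M * K * R := mul_le_mul_of_nonneg_right hn hR0
  have h4 := hXsum t ht v A hA
  have h5 : M * K * R = δ * K ^ 2 * (2 * M * D * (1 + 2 * D * M) * Real.exp (8 * D ^ 2 * M)) := by
    rw [hR, hα]; ring
  linarith

end Propagation

section Path

variable {n K : ℕ}

/-- Every entry of the history `s` is a move of the strategy `B` together with a possible answer of
the randomized greedy algorithm. -/
def IsPlay (B : State n K → Option (Sym2 (Fin n))) (s : State n K) : Prop :=
  ∀ i < s.length, (s.getD i (none, none)).1 = B (s.take i) ∧
    (s.getD i (none, none)).2 ∈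
      (greedyStep n K (s.take i) (s.getD i (none, none)).1).support

lemma isPlay_of_mem_support (B : State n K → Option (Sym2 (Fin n))) (T : ℕ) (s : State n K)
    (hs : s ∈ (run n K B T).support) : s.length = T ∧ IsPlay B s := by
  induction T generalizing s with
  | zero =>
    simp only [run, PMF.support_pure, Set.mem_singleton_iff] at hs
    subst hs
    exact ⟨rfl, fun i hi => absurd hi (Nat.not_lt_zero i)⟩
  | succ T ih =>
    simp only [run, PMF.mem_support_bind_iff, PMF.mem_support_map_iff] at hs
    obtain ⟨s', hs', c, hc, rfl⟩ := hs
    obtain ⟨hl, hP⟩ := ih s' hs'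
    refine ⟨by simp [hl], fun i hi => ?_⟩
    rw [List.length_append, List.length_singleton] at hi
    rcases Nat.lt_succ_iff_lt_or_eq.1 hi with h | rfl
    · rw [List.take_append_of_le_length h.le, List.getD_append _ _ _ _ h]
      exact hP i h
    · simpa using hc

lemma legalMove_of_enforce (Δ : ℕ) (B : State n K → Option (Sym2 (Fin n))) (s : State n K)
    (e : Sym2 (Fin n)) (h : enforce n K Δ B s = some e) : LegalMove n K Δ s e := by
  unfold enforce at h
  split at h
  · cases h
  · split_ifs at h with h2
    cases h
    exact h2

lemma take_succ_eq (s : State n K) {i : ℕ} (hi : i < s.length) :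
    s.take (i + 1) = s.take i ++ [s.getD i (none, none)] := by
  rw [List.take_succ_eq_append_getElem hi, List.getD_eq_getElem _ _ hi]

lemma getD_mem_take (s : State n K) {i j : ℕ} (hij : i < j) (hi : i < s.length) :
    s.getD i (none, none) ∈ s.take j := by
  rw [List.getD_eq_getElem _ _ hi, List.mem_take_iff_getElem]
  exact ⟨i, by omega, rfl⟩

lemma lt_length_of_getD (s : State n K) {i : ℕ} {z : Sym2 (Fin n)}
    (h : (s.getD i (none, none)).1 = some z) : i < s.length := by
  by_contra hn
  rw [List.getD_eq_default _ _ (not_lt.1 hn)] at h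
  cases h

lemma legalMove_of_isPlay {Δ : ℕ} {B : State n K → Option (Sym2 (Fin n))} {s : State n K}
    (hs : IsPlay (enforce n K Δ B) s) {i : ℕ} {z : Sym2 (Fin n)}
    (h : (s.getD i (none, none)).1 = some z) : LegalMove n K Δ (s.take i) z := by
  apply legalMove_of_enforce Δ B
  rw [← (hs i (lt_length_of_getD s h)).1, h]

lemma index_unique_of_isPlay {Δ : ℕ} {B : State n K → Option (Sym2 (Fin n))} {s : State n K}
    (hs : IsPlay (enforce n K Δ B) s) (i j : ℕ) (z : Sym2 (Fin n))
    (hi : (s.getD i (none, none)).1 = some z) (hj : (s.getD j (none, none)).1 = some z) :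
    i = j := by
  rcases lt_trichotomy i j with h | h | h
  · exact absurd hi ((legalMove_of_isPlay hs hj).2.1 _
      (getD_mem_take s h (lt_length_of_getD s hi)))
  · exact h
  · exact absurd hj ((legalMove_of_isPlay hs hi).2.1 _
      (getD_mem_take s h (lt_length_of_getD s hj)))

lemma degreeIn_append (s : State n K) (p : Option (Sym2 (Fin n)) × Option (Fin K))
    (v : Fin n) : degreeIn n K (s ++ [p]) v =
      degreeIn n K s v + if ∃ e, p.1 = some e ∧ v ∈ e then 1 else 0 := by
  unfold degreeIn
  rw [List.filter_append, List.length_append]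
  congr 1
  split_ifs with h
  · rw [List.filter_cons_of_pos (by simpa using h)]; rfl
  · rw [List.filter_cons_of_neg (by simpa using h)]; rfl

lemma degreeIn_le_of_isPlay {Δ : ℕ} {B : State n K → Option (Sym2 (Fin n))} {s : State n K}
    (hs : IsPlay (enforce n K Δ B) s) (v : Fin n) : degreeIn n K s v ≤ Δ := by
  have H : ∀ t ≤ s.length, degreeIn n K (s.take t) v ≤ Δ := by
    intro t
    induction t with
    | zero => intro _; simp [degreeIn]
    | succ t ih =>
      intro ht
      rw [take_succ_eq s (by omega), degreeIn_append]
      split_ifs with h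
      · obtain ⟨z, hz, hv⟩ := h
        exact (legalMove_of_isPlay hs hz).2.2 v hv
      · exact ih (by omega)
  simpa using H s.length le_rfl

lemma pathSum_incident_le (s : State n K) (u v : Fin n) :
    pathSum (fun _ p => if ∃ e, p.1 = some e ∧ (u ∈ e ∨ v ∈ e) then (1 : ℝ) else 0) s ≤
      degreeIn n K s u + degreeIn n K s v := by
  induction s using List.reverseRecOn with
  | nil => simp [pathSum, degreeIn]
  | append_singleton s p ih =>
    rw [pathSum_append, degreeIn_append, degreeIn_append]
    push_cast
    have : (if ∃ e, p.1 = some e ∧ (u ∈ e ∨ v ∈ e) then (1 : ℝ) else 0) ≤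
        (if ∃ e, p.1 = some e ∧ u ∈ e then 1 else 0) +
          if ∃ e, p.1 = some e ∧ v ∈ e then 1 else 0 := by
      by_cases h : ∃ e, p.1 = some e ∧ (u ∈ e ∨ v ∈ e)
      · rw [if_pos h]
        obtain ⟨e, he, h | h⟩ := h
        · rw [if_pos ⟨e, he, h⟩]
          split_ifs <;> norm_num
        · rw [if_pos (c := ∃ e, p.1 = some e ∧ v ∈ e) ⟨e, he, h⟩]
          split_ifs <;> norm_num
      · rw [if_neg h]
        split_ifs <;> norm_num
    linarith

/-- A legal edge has enough free colors at each endpoint. -/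
lemma card_freeAt_of_legalMove {Δ : ℕ} {s : State n K} {e : Sym2 (Fin n)}
    (h : LegalMove n K Δ s e) {v : Fin n} (hv : v ∈ e) :
    (K : ℝ) - Δ ≤ (freeAt s v).card - 1 := by
  have h1 := le_card_freeAt s v
  have h2 := h.2.2 v hv
  have h3 : (K : ℝ) + 1 ≤ (freeAt s v).card + Δ := by exact_mod_cast (by omega)
  linarith

/-- The truncated inverse density of the free colors at `v`. -/
noncomputable def invDensity (b : ℝ) (s : State n K) (v : Fin n) : ℝ :=
  if (K : ℝ) ≤ b * (freeAt s v).card then K / (freeAt s v).card else 0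

lemma invDensity_nonneg (b : ℝ) (s : State n K) (v : Fin n) : 0 ≤ invDensity b s v := by
  unfold invDensity
  split_ifs <;> positivity

lemma invDensity_le {b : ℝ} (hb : 0 ≤ b) (s : State n K) (v : Fin n) :
    invDensity b s v ≤ b := by
  unfold invDensity
  split_ifs with h
  · exact div_le_of_le_mul₀ (Nat.cast_nonneg _) hb h
  · exact hb

/-- Fluctuation of the number of common free colors of `u` and `v` (suitably normalized). -/
noncomputable def pairFluct (b : ℝ) (u v : Fin n) (s : State n K)
    (p : Option (Sym2 (Fin n)) × Option (Fin K)) : ℝ :=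
  (invDensity b s v * if ∀ e, p.1 = some e → v ∉ e then 1 else 0) *
      discFluct (freeAt s v) u s p +
    (invDensity b s u * if ∀ e, p.1 = some e → u ∉ e then 1 else 0) *
      discFluct (freeAt s u) v s p

noncomputable def pairDensity (u v : Fin n) (s : State n K) : ℝ :=
  K ^ 2 * (freeAt s u ∩ freeAt s v).card / ((freeAt s u).card * (freeAt s v).card)

lemma pairDensity_comm (u v : Fin n) (s : State n K) :
    pairDensity u v s = pairDensity v u s := by
  rw [pairDensity, pairDensity, Finset.inter_comm, mul_comm ((freeAt s u).card : ℝ)]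

lemma pairDensity_append_of_notMem {b : ℝ} (u v : Fin n) (s : State n K)
    (p : Option (Sym2 (Fin n)) × Option (Fin K)) (h : ∀ e, p.1 = some e → v ∉ e)
    (hv : (K : ℝ) ≤ b * (freeAt s v).card) :
    pairDensity u v (s ++ [p]) =
      pairDensity u v s + invDensity b s v * discInc (freeAt s v) u s p := by
  rw [pairDensity, pairDensity, freeAt_append_of_notMem s p v h, discInc, disc, disc, invDensity,
    if_pos hv, sub_sub_sub_cancel_right]
  simp only [div_eq_mul_inv, mul_inv]
  ring

lemma pairDensity_append {b : ℝ} (u v : Fin n) (s : State n K)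
    (p : Option (Sym2 (Fin n)) × Option (Fin K)) (huv : u ≠ v) (hp : p.1 ≠ some s(u, v))
    (hu : (K : ℝ) ≤ b * (freeAt s u).card) (hv : (K : ℝ) ≤ b * (freeAt s v).card) :
    pairDensity u v (s ++ [p]) = pairDensity u v s + pairFluct b u v s p +
      ((invDensity b s v * if ∀ e, p.1 = some e → v ∉ e then 1 else 0) *
        discDrift (freeAt s v) u s p.1 +
      (invDensity b s u * if ∀ e, p.1 = some e → u ∉ e then 1 else 0) *
        discDrift (freeAt s u) v s p.1) := by
  by_cases h : ∀ e, p.1 = some e → v ∉ e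
  · rw [pairDensity_append_of_notMem u v s p h hv, pairFluct, discFluct_of_notMem _ v s p h,
      discDrift_of_notMem _ v s p.1 h, if_pos h, discFluct]
    ring
  · have h' : ∀ e, p.1 = some e → u ∉ e := by
      push Not at h
      obtain ⟨e, he, hve⟩ := h
      intro e' he' hue
      rw [he, Option.some_inj] at he'
      subst he'
      exact hp (by rw [he, (Sym2.mem_and_mem_iff huv).1 ⟨hue, hve⟩])
    rw [pairDensity_comm, pairDensity_append_of_notMem v u s p h' hu, pairDensity_comm, pairFluct,
      if_neg h, if_pos h']
    simp only [discFluct]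
    ring

/-- If all aggregated fluctuations along a play are small, then every presented edge had many
available colors. -/
lemma le_card_freeEdge_of_isPlay {Δ : ℕ} {B : State n K → Option (Sym2 (Fin n))}
    {s : State n K} (hs : IsPlay (enforce n K Δ B) s) {b δ M : ℝ} (hΔ : Δ < K)
    (hb : 1 ≤ b) (hKb : (K : ℝ) ≤ b * (K - Δ)) (hn : (n : ℝ) ≤ M * K)
    (hT : (s.length : ℝ) ≤ M * K ^ 2) (hδ : 0 ≤ δ)
    (hδb : δ * (1 + 2 * M * (2 * b ^ 3) * (1 + 2 * (2 * b ^ 3) * M) *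
      Real.exp (8 * (2 * b ^ 3) ^ 2 * M)) * (32 * b ^ 4) ≤ 1)
    (h₁ : ∀ (r : Fin n → ℕ) (τ : Fin K → ℕ), (∀ x, r x ≤ s.length) → (∀ c, τ c ≤ s.length) →
      ∑ x, |∑ i ∈ Finset.range (r x), discFluct (Finset.univ.filter fun c => r x < τ c) x
        (s.take i) (s.getD i (none, none))| ≤ δ * K ^ 2)
    (h₂ : ∀ u v, ∀ t < s.length, -((K : ℝ) / 4) ≤
      ∑ i ∈ Finset.range t, pairFluct b u v (s.take i) (s.getD i (none, none)))
    (t : ℕ) (z : Sym2 (Fin n)) (hz : (s.getD t (none, none)).1 = some z) :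
    (K : ℝ) / (2 * b ^ 2) ≤ (freeEdge n K (s.take t) z).card := by
  have hK : 0 < K := by omega
  have hK' : (0 : ℝ) < K := by exact_mod_cast hK
  have hΔ' : (Δ : ℝ) < K := by exact_mod_cast hΔ
  have hb0 : 0 < b := by linarith
  set C := 1 + 2 * M * (2 * b ^ 3) * (1 + 2 * (2 * b ^ 3) * M) *
      Real.exp (8 * (2 * b ^ 3) ^ 2 * M) with hC
  induction t using Nat.strong_induction_on generalizing z with
  | _ t ih =>
  set e : ℕ → Option (Sym2 (Fin n)) := fun i => (s.getD i (none, none)).1 with he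
  set F : ℕ → Fin n → Finset (Fin K) := fun i v => freeAt (s.take i) v with hF
  set Z : ℕ → Fin n → Finset (Fin K) → ℝ := fun i v A => disc A (s.take i) v with hZ
  set X : ℕ → Fin n → Finset (Fin K) → ℝ := fun t v A =>
    ∑ i ∈ Finset.range t, discFluct A v (s.take i) (s.getD i (none, none)) with hX
  set Y : ℕ → Fin n → Finset (Fin K) → ℝ := fun t v A =>
    ∑ i ∈ Finset.range t, discDrift A v (s.take i) (e i) with hY
  have htl : t < s.length := lt_length_of_getD s hz
  have hFanti : ∀ v, Antitone fun i => F i v := by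
    intro v i j hij
    have : s.take j = s.take i ++ (s.take j).drop i := by
      conv_lhs => rw [← List.take_append_drop i (s.take j)]
      rw [List.take_take, min_eq_left hij]
    simp only [hF]
    rw [this]
    exact freeAt_append_subset _ _ _
  have hdrift : ∀ i < t, ∀ v A, |discDrift A v (s.take i) (e i)| ≤
      ∑ x, if e i = some s(v, x) then
        2 * b ^ 3 / K * (|Z i x (F i v)| + |Z i x (F i v ∩ A)|) else 0 := by
    intro i hi v A
    have hnn : ∀ x, 0 ≤ if e i = some s(v, x) then
        2 * b ^ 3 / K * (|Z i x (F i v)| + |Z i x (F i v ∩ A)|) else 0 := by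
      intro x
      split_ifs <;> positivity
    by_cases hv : ∀ z', e i = some z' → v ∉ z'
    · rw [discDrift_of_notMem A v _ _ hv, abs_zero]
      exact Finset.sum_nonneg fun x _ => hnn x
    · push Not at hv
      obtain ⟨z', hz', hvz⟩ := hv
      have hleg := legalMove_of_isPlay hs hz'
      have hav := ih i hi z' hz'
      obtain ⟨w, rfl⟩ := hvz
      refine le_trans ?_ (Finset.single_le_sum (fun x _ => hnn x) (Finset.mem_univ w))
      rw [if_pos hz', hz']
      have hk := card_freeAt_of_legalMove hleg (Sym2.mem_mk_left v w)
      rw [freeEdge_mk] at hav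
      have hpos : (0 : ℝ) < (freeAt (s.take i) v ∩ freeAt (s.take i) w).card :=
        lt_of_lt_of_le (by positivity) hav
      refine abs_discDrift_le A v w (s.take i) ?_ (by exact_mod_cast hpos) hK ?_
      · have : (1 : ℝ) < (freeAt (s.take i) v).card := by linarith
        exact_mod_cast this
      · have h1 : (K : ℝ) / b ≤ (freeAt (s.take i) v).card - 1 := by
          rw [div_le_iff₀ hb0]
          nlinarith
        calc (K : ℝ) / (((freeAt (s.take i) v).card - 1) *
              (freeAt (s.take i) v ∩ freeAt (s.take i) w).card)
            ≤ K / (K / b * (K / (2 * b ^ 2))) := by gcongr; linarith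
          _ = 2 * b ^ 3 / K := by field_simp
  have hstep : ∀ i < t, ∀ p, s.getD i (none, none) = p →
      s.take (i + 1) = s.take i ++ [p] := by
    rintro i hi p rfl
    exact take_succ_eq s (by omega)
  have hZXY : ∀ i ≤ t, ∀ v A, Z i v A = X i v A + Y i v A := by
    intro i
    induction i with
    | zero => intro _ v A; simp [hZ, hX, hY, disc_nil A v hK]
    | succ i ihi =>
      intro hi v A
      have h1 := ihi (by omega) v A
      simp only [hX, hY, hZ] at h1 ⊢
      rw [Finset.sum_range_succ, Finset.sum_range_succ, hstep i (by omega) _ rfl]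
      have h2 : discFluct A v (s.take i) (s.getD i (none, none)) =
        disc A (s.take i ++ [s.getD i (none, none)]) v - disc A (s.take i) v -
          discDrift A v (s.take i) (e i) := rfl
      linarith
  have hYle : ∀ i ≤ t, ∀ v A, |Y i v A| ≤
      2 * b ^ 3 / K * nbrSum e v i fun j x => |Z j x (F j v)| + |Z j x (F j v ∩ A)| := by
    intro i hi v A
    simp only [hY]
    refine (Finset.abs_sum_le_sum_abs _ _).trans ?_
    rw [nbrSum, Finset.mul_sum]
    refine Finset.sum_le_sum fun j hj => ?_
    rw [Finset.mem_range] at hj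
    refine (hdrift j (by omega) v A).trans (le_of_eq ?_)
    rw [Finset.mul_sum]
    exact Finset.sum_congr rfl fun x _ => by split_ifs <;> simp
  have hmain : ∀ v (A : ℕ → Finset (Fin K)), Antitone A →
      nbrSum e v t (fun i x => |Z i x (A i)|) ≤ δ * K ^ 2 * C := fun v A hA =>
    nbrSum_abs_le e (index_unique_of_isPlay hs) F hFanti Z X Y htl.le hK (by positivity) hδ hn hT
      hZXY hYle h₁ le_rfl v A hA
  obtain ⟨u, v⟩ := z
  change (s.getD t (none, none)).1 = some s(u, v) at hz
  have hleg := legalMove_of_isPlay hs hz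
  have huv : u ≠ v := fun h => hleg.1 (by simpa using h)
  have hku := card_freeAt_of_legalMove hleg (Sym2.mem_mk_left u v)
  have hkv := card_freeAt_of_legalMove hleg (Sym2.mem_mk_right u v)
  have hlarge : ∀ w, (K : ℝ) - Δ ≤ (F t w).card - 1 → ∀ i ≤ t, (K : ℝ) ≤ b * (F i w).card := by
    intro w hw i hi
    have h1 : ((F t w).card : ℝ) ≤ (F i w).card := by
      exact_mod_cast Finset.card_le_card (hFanti w hi)
    nlinarith
  have hdriftsum : ∀ u v, |∑ i ∈ Finset.range t, (invDensity b (s.take i) v *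
      if ∀ e', e i = some e' → v ∉ e' then 1 else 0) *
        discDrift (F i v) u (s.take i) (e i)| ≤ K / 8 := by
    intro u v
    have h1 : nbrSum e u t (fun j x => |Z j x (F j u)| + |Z j x (F j u ∩ F j v)|) ≤
        2 * (δ * K ^ 2 * C) := by
      rw [nbrSum_add]
      have a1 := hmain u (fun j => F j u) (hFanti u)
      have a2 := hmain u (fun j => F j u ∩ F j v)
        fun i j hij => Finset.inter_subset_inter (hFanti u hij) (hFanti v hij)
      linarith
    calc _ ≤ ∑ i ∈ Finset.range t, b * (2 * b ^ 3 / K *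
          ∑ x, if e i = some s(u, x) then |Z i x (F i u)| + |Z i x (F i u ∩ F i v)| else 0) := by
          refine (Finset.abs_sum_le_sum_abs _ _).trans (Finset.sum_le_sum fun i hi => ?_)
          rw [Finset.mem_range] at hi
          rw [abs_mul]
          refine mul_le_mul ?_ ?_ (abs_nonneg _) hb0.le
          · have a1 := invDensity_nonneg b (s.take i) v
            have a2 := invDensity_le hb0.le (s.take i) v
            rw [abs_of_nonneg (mul_nonneg a1 (by split_ifs <;> norm_num))]
            split_ifs <;> linarith
          · refine (hdrift i hi u (F i v)).trans (le_of_eq ?_)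
            rw [Finset.mul_sum]
            exact Finset.sum_congr rfl fun x _ => by split_ifs <;> simp
      _ = b * (2 * b ^ 3 / K) * nbrSum e u t
          (fun j x => |Z j x (F j u)| + |Z j x (F j u ∩ F j v)|) := by
          rw [nbrSum, Finset.mul_sum]
          exact Finset.sum_congr rfl fun i _ => by ring
      _ ≤ b * (2 * b ^ 3 / K) * (2 * (δ * K ^ 2 * C)) := by gcongr
      _ = (δ * C * (32 * b ^ 4)) * (K / 8) := by field_simp; ring
      _ ≤ 1 * (K / 8) := by gcongr
      _ = K / 8 := one_mul _
  have hdens : ∀ i ≤ t, pairDensity u v (s.take i) = K +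
      ∑ j ∈ Finset.range i, pairFluct b u v (s.take j) (s.getD j (none, none)) +
      (∑ j ∈ Finset.range i, (invDensity b (s.take j) v *
        if ∀ e', e j = some e' → v ∉ e' then 1 else 0) *
          discDrift (F j v) u (s.take j) (e j) +
      ∑ j ∈ Finset.range i, (invDensity b (s.take j) u *
        if ∀ e', e j = some e' → u ∉ e' then 1 else 0) *
          discDrift (F j u) v (s.take j) (e j)) := by
    intro i
    induction i with
    | zero =>
      intro _
      have : ∀ w, freeAt ([] : State n K) w = Finset.univ := fun w => by simp [freeAt]
      simp [pairDensity, this]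
      field_simp
    | succ i ihi =>
      intro hi
      rw [hstep i (by omega) _ rfl, pairDensity_append u v _ _ huv ?_
        (hlarge u hku i (by omega)) (hlarge v hkv i (by omega)), ihi (by omega),
        Finset.sum_range_succ, Finset.sum_range_succ, Finset.sum_range_succ]
      · ring
      · intro h
        have := index_unique_of_isPlay hs _ _ _ h hz
        omega
  have hfin : (K : ℝ) / 2 ≤ pairDensity u v (s.take t) := by
    rw [hdens t le_rfl]
    have a1 := (abs_le.1 (hdriftsum u v)).1
    have a2 := (abs_le.1 (hdriftsum v u)).1
    have a3 := h₂ u v t htl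
    linarith
  have hu0 : (0 : ℝ) < (freeAt (s.take t) u).card := by linarith
  have hv0 : (0 : ℝ) < (freeAt (s.take t) v).card := by linarith
  have hu1 : (K : ℝ) / b ≤ (freeAt (s.take t) u).card := by
    rw [div_le_iff₀ hb0, mul_comm]; exact hlarge u hku t le_rfl
  have hv1 : (K : ℝ) / b ≤ (freeAt (s.take t) v).card := by
    rw [div_le_iff₀ hb0, mul_comm]; exact hlarge v hkv t le_rfl
  change _ ≤ ((freeEdge n K (s.take t) s(u, v)).card : ℝ)
  rw [freeEdge_mk]
  rw [pairDensity, le_div_iff₀ (by positivity)] at hfin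
  have h3 : (K : ℝ) / b * (K / b) ≤ (freeAt (s.take t) u).card * (freeAt (s.take t) v).card := by
    gcongr
  have h4 : K ^ 2 * ((K : ℝ) / (2 * b ^ 2)) ≤
      K ^ 2 * (freeAt (s.take t) u ∩ freeAt (s.take t) v).card := by
    refine le_trans (le_trans (le_of_eq ?_)
      (mul_le_mul_of_nonneg_left h3 (by positivity : (0 : ℝ) ≤ K / 2))) hfin
    field_simp
  exact le_of_mul_le_mul_left h4 (by positivity)

lemma success_and_proper_of_isPlay {B : State n K → Option (Sym2 (Fin n))}
    {s : State n K} (hs : IsPlay B s)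
    (h : ∀ t z, (s.getD t (none, none)).1 = some z → (freeEdge n K (s.take t) z).Nonempty) :
    Success n K s ∧ Proper n K s := by
  have hcol : ∀ t z, (s.getD t (none, none)).1 = some z →
      ∃ c ∈ freeEdge n K (s.take t) z, (s.getD t (none, none)).2 = some c := by
    intro t z hz
    have h1 := (hs t (lt_length_of_getD s hz)).2
    have hne := h t z hz
    rw [hz] at h1
    simp only [greedyStep, hne, dif_pos, PMF.mem_support_map_iff,
      PMF.mem_support_uniformOfFinset_iff] at h1
    obtain ⟨c, hc, hc'⟩ := h1
    exact ⟨c, hc, hc'.symm⟩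
  have hlt : ∀ i j, i < j → ∀ e₁ e₂ v c, (s.getD i (none, none)).1 = some e₁ →
      (s.getD j (none, none)).1 = some e₂ → v ∈ e₁ → v ∈ e₂ →
      (s.getD i (none, none)).2 = some c → (s.getD j (none, none)).2 ≠ some c := by
    intro i j hij e₁ e₂ v c h1 h2 hv1 hv2 hc hc'
    obtain ⟨c', hc1, hc2⟩ := hcol j e₂ h2
    rw [hc', Option.some_inj] at hc2
    subst hc2
    simp only [freeEdge, Finset.mem_filter, Finset.mem_univ, true_and] at hc1
    exact hc1 v hv2 _ (getD_mem_take s hij (lt_length_of_getD s h1)) ⟨e₁, h1, hv1⟩ hc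
  refine ⟨?_, ?_⟩
  · intro p hp hne
    obtain ⟨i, hi, rfl⟩ := List.getElem_of_mem hp
    obtain ⟨z, hz⟩ := Option.ne_none_iff_exists'.1 hne
    rw [← List.getD_eq_getElem s (none, none) hi] at hz ⊢
    obtain ⟨c, -, hc⟩ := hcol i z hz
    rw [hc]
    exact Option.some_ne_none c
  · intro i j hij e₁ e₂ h1 h2 _ ⟨v, hv1, hv2⟩ c hc hc'
    rw [List.get_eq_getElem, ← List.getD_eq_getElem s (none, none)] at h1 h2 hc hc'
    rcases lt_or_gt_of_ne (fun h => hij (Fin.ext h) : (i : ℕ) ≠ j) with h | h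
    · exact hlt i j h e₁ e₂ v c h1 h2 hv1 hv2 hc hc'
    · exact hlt j i h e₂ e₁ v c h2 h1 hv2 hv1 hc' hc

end Path

section Tests

variable {n K : ℕ}

lemma abs_discFluct_enforce_le {Δ : ℕ} (B : State n K → Option (Sym2 (Fin n))) {b : ℝ}
    (hb : 0 ≤ b) (hΔ : Δ < K) (hKb : (K : ℝ) ≤ b * (K - Δ)) (A : Finset (Fin K)) (v : Fin n)
    (s : State n K) (c : Option (Fin K)) :
    |discFluct A v s (enforce n K Δ B s, c)| ≤
      if ∃ e, enforce n K Δ B s = some e ∧ v ∈ e then 2 * b else 0 := by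
  by_cases h : ∃ e, enforce n K Δ B s = some e ∧ v ∈ e
  · rw [if_pos h]
    obtain ⟨e, he, hv⟩ := h
    have hk := card_freeAt_of_legalMove (legalMove_of_enforce Δ B s e he) hv
    have hΔ' : (Δ : ℝ) < K := by exact_mod_cast hΔ
    have h1 : (1 : ℝ) < (freeAt s v).card := by linarith
    rw [he]
    refine abs_discFluct_le A v s e c hv (by exact_mod_cast h1) ?_
    rw [div_le_iff₀ (by linarith)]
    exact hKb.trans (mul_le_mul_of_nonneg_left hk hb)
  · rw [if_neg h, discFluct_of_notMem, abs_zero]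
    exact fun e he hv => h ⟨e, he, hv⟩

/-- Signed sum over all vertices of the fluctuations, stopped at individual times. -/
noncomputable def testFluct (ν : Fin n → Bool) (r : Fin n → ℕ) (τ : Fin K → ℕ) (s : State n K)
    (p : Option (Sym2 (Fin n)) × Option (Fin K)) : ℝ :=
  ∑ v, (if ν v then 1 else -1) *
    if s.length < r v then discFluct (Finset.univ.filter fun c => r v < τ c) v s p else 0

lemma stepExp_testFluct (ν : Fin n → Bool) (r : Fin n → ℕ) (τ : Fin K → ℕ) (s : State n K)
    (e : Option (Sym2 (Fin n))) : stepExp s e (fun c => testFluct ν r τ s (e, c)) = 0 := by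
  simp only [testFluct]
  rw [stepExp_sum]
  refine Finset.sum_eq_zero fun v _ => ?_
  rw [stepExp_mul_left]
  by_cases h : s.length < r v
  · simp only [h, if_true]
    rw [stepExp_discFluct, mul_zero]
  · simp only [h, if_false]
    rw [stepExp_const, mul_zero]

lemma abs_testFluct_le {Δ : ℕ} (B : State n K → Option (Sym2 (Fin n))) {b : ℝ}
    (hb : 0 ≤ b) (hΔ : Δ < K) (hKb : (K : ℝ) ≤ b * (K - Δ)) (ν : Fin n → Bool) (r : Fin n → ℕ)
    (τ : Fin K → ℕ) (s : State n K) (c : Option (Fin K)) :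
    |testFluct ν r τ s (enforce n K Δ B s, c)| ≤ 4 * b := by
  have h1 : |testFluct ν r τ s (enforce n K Δ B s, c)| ≤
      ∑ v, if ∃ e, enforce n K Δ B s = some e ∧ v ∈ e then 2 * b else 0 := by
    refine (Finset.abs_sum_le_sum_abs _ _).trans (Finset.sum_le_sum fun v _ => ?_)
    rw [abs_mul]
    have h2 : |(if ν v then 1 else -1 : ℝ)| = 1 := by split_ifs <;> simp
    rw [h2, one_mul]
    by_cases h : s.length < r v
    · rw [if_pos h]
      exact abs_discFluct_enforce_le B hb hΔ hKb _ v s c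
    · rw [if_neg h, abs_zero]
      split_ifs <;> positivity
  refine h1.trans ?_
  cases hE : enforce n K Δ B s with
  | none => simpa using hb
  | some e =>
    obtain ⟨u, w⟩ := e
    calc ∑ v, (if ∃ e, some s(u, w) = some e ∧ v ∈ e then 2 * b else 0)
        ≤ ∑ v, ((if v = u then 2 * b else 0) + if v = w then 2 * b else 0) := by
          refine Finset.sum_le_sum fun v _ => ?_
          by_cases h : v = u ∨ v = w
          · rw [if_pos ⟨_, rfl, by simpa using h⟩]
            rcases h with h | h
            · rw [if_pos h]; split_ifs <;> linarith
            · rw [if_pos (c := v = w) h]; split_ifs <;> linarith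
          · rw [if_neg]
            · split_ifs <;> linarith
            · rintro ⟨e, he, hv⟩
              rw [Option.some_inj] at he
              subst he
              exact h (by simpa using hv)
      _ = 4 * b := by
          rw [Finset.sum_add_distrib]
          simp
          ring

lemma sum_range_stopped (s : State n K) {r : ℕ} (hr : r ≤ s.length) (f : ℕ → ℝ) :
    ∑ i ∈ Finset.range s.length, (if (s.take i).length < r then f i else 0) =
      ∑ i ∈ Finset.range r, f i := by
  have h1 : ∀ i ∈ Finset.range s.length,
      (if (s.take i).length < r then f i else 0) = if i ∈ Finset.range r then f i else 0 := by
    intro i hi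
    rw [Finset.mem_range] at hi
    rw [List.length_take, min_eq_left hi.le]
    simp
  rw [Finset.sum_congr rfl h1, Finset.sum_ite_mem,
    Finset.inter_eq_right.2 (Finset.range_subset_range.2 hr)]

lemma pathSum_testFluct (ν : Fin n → Bool) (r : Fin n → ℕ) (τ : Fin K → ℕ) (s : State n K)
    (hr : ∀ v, r v ≤ s.length) :
    pathSum (testFluct ν r τ) s = ∑ v, (if ν v then 1 else -1) *
      ∑ i ∈ Finset.range (r v), discFluct (Finset.univ.filter fun c => r v < τ c) v
        (s.take i) (s.getD i (none, none)) := by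
  simp only [pathSum, testFluct]
  rw [Finset.sum_comm]
  refine Finset.sum_congr rfl fun v _ => ?_
  rw [← Finset.mul_sum, sum_range_stopped s (hr v)]

lemma testFluct_tail {Δ : ℕ} (B : State n K → Option (Sym2 (Fin n))) {b l a : ℝ}
    (hb : 0 ≤ b) (hΔ : Δ < K) (hKb : (K : ℝ) ≤ b * (K - Δ)) (hl : 0 ≤ l) (hlb : l * (4 * b) ≤ 1)
    (ν : Fin n → Bool) (r : Fin n → ℕ) (τ : Fin K → ℕ) (T : ℕ) :
    (run n K (enforce n K Δ B) T).toOuterMeasure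
      {s | s.length = T ∧ a ≤ pathSum (testFluct ν r τ) s} ≤
      ENNReal.ofReal (Real.exp (-(l * a) + l ^ 2 * (4 * b) ^ 2 * T)) := by
  refine le_trans ?_ (pathSum_tail (enforce n K Δ B) (testFluct ν r τ) (fun _ => True) hl hlb
    (fun s => stepExp_testFluct ν r τ s _) (fun s c => ?_) T)
  · refine MeasureTheory.measure_mono ?_
    rintro s ⟨hs, ha⟩
    exact ⟨ha, by simp [pathSum, hs]⟩
  · rw [if_pos trivial]
    exact abs_testFluct_le B hb hΔ hKb ν r τ s c

/-- The negated pair fluctuation, stopped at a given time. -/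
noncomputable def pairTest (b : ℝ) (u v : Fin n) (r : ℕ) (s : State n K)
    (p : Option (Sym2 (Fin n)) × Option (Fin K)) : ℝ :=
  -if s.length < r then pairFluct b u v s p else 0

lemma stepExp_pairFluct (b : ℝ) (u v : Fin n) (s : State n K) (e : Option (Sym2 (Fin n))) :
    stepExp s e (fun c => pairFluct b u v s (e, c)) = 0 := by
  have h1 : ∀ (a : ℝ) A x, stepExp s e (fun c => a * discFluct A x s (e, c)) = 0 := by
    intro a A x
    rw [stepExp_mul_left, stepExp_discFluct, mul_zero]
  have h2 := stepExp_add s e (fun c => (invDensity b s v *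
    if ∀ e', e = some e' → v ∉ e' then 1 else 0) * discFluct (freeAt s v) u s (e, c))
    (fun c => (invDensity b s u * if ∀ e', e = some e' → u ∉ e' then 1 else 0) *
      discFluct (freeAt s u) v s (e, c))
  rw [h1, h1, add_zero] at h2
  exact h2

lemma stepExp_pairTest (b : ℝ) (u v : Fin n) (r : ℕ) (s : State n K)
    (e : Option (Sym2 (Fin n))) : stepExp s e (fun c => pairTest b u v r s (e, c)) = 0 := by
  simp only [pairTest]
  by_cases h : s.length < r
  · have h2 := stepExp_mul_left s e (-1) fun c => pairFluct b u v s (e, c)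
    rw [stepExp_pairFluct] at h2
    simpa [h] using h2
  · simp only [h, if_false]
    rw [stepExp_const, neg_zero]

lemma abs_pairTest_le {Δ : ℕ} (B : State n K → Option (Sym2 (Fin n))) {b : ℝ}
    (hb : 0 ≤ b) (hΔ : Δ < K) (hKb : (K : ℝ) ≤ b * (K - Δ)) (u v : Fin n) (r : ℕ)
    (s : State n K) (c : Option (Fin K)) :
    |pairTest b u v r s (enforce n K Δ B s, c)| ≤
      if ∃ e, enforce n K Δ B s = some e ∧ (u ∈ e ∨ v ∈ e) then 4 * b ^ 2 else 0 := by
  have hterm : ∀ x y, |(invDensity b s x *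
      if ∀ e, enforce n K Δ B s = some e → x ∉ e then 1 else 0) *
        discFluct (freeAt s x) y s (enforce n K Δ B s, c)| ≤
      b * if ∃ e, enforce n K Δ B s = some e ∧ y ∈ e then 2 * b else 0 := by
    intro x y
    rw [abs_mul]
    refine mul_le_mul ?_ (abs_discFluct_enforce_le B hb hΔ hKb _ y s c) (abs_nonneg _) hb
    have a1 := invDensity_nonneg b s x
    have a2 := invDensity_le hb s x
    rw [abs_of_nonneg (mul_nonneg a1 (by split_ifs <;> norm_num))]
    split_ifs <;> linarith
  have h0 : |pairTest b u v r s (enforce n K Δ B s, c)| ≤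
      |pairFluct b u v s (enforce n K Δ B s, c)| := by
    rw [pairTest, abs_neg]
    split_ifs
    · exact le_rfl
    · rw [abs_zero]; exact abs_nonneg _
  refine (h0.trans (abs_add_le _ _)).trans ((add_le_add (hterm v u) (hterm u v)).trans ?_)
  by_cases h : ∃ e, enforce n K Δ B s = some e ∧ (u ∈ e ∨ v ∈ e)
  · rw [if_pos h]
    split_ifs <;> nlinarith
  · rw [if_neg h, if_neg (fun ⟨e, he, hu⟩ => h ⟨e, he, Or.inl hu⟩),
      if_neg (fun ⟨e, he, hv⟩ => h ⟨e, he, Or.inr hv⟩)]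
    simp

lemma pathSum_pairTest (b : ℝ) (u v : Fin n) (r : ℕ) (s : State n K) (hr : r ≤ s.length) :
    pathSum (pairTest b u v r) s =
      -∑ i ∈ Finset.range r, pairFluct b u v (s.take i) (s.getD i (none, none)) := by
  simp only [pathSum, pairTest]
  rw [Finset.sum_neg_distrib, sum_range_stopped s hr]

lemma pairTest_tail {Δ : ℕ} (B : State n K → Option (Sym2 (Fin n))) {b l a : ℝ}
    (hb : 0 ≤ b) (hΔ : Δ < K) (hKb : (K : ℝ) ≤ b * (K - Δ)) (hl : 0 ≤ l)
    (hlb : l * (4 * b ^ 2) ≤ 1) (u v : Fin n) (r T : ℕ) :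
    (run n K (enforce n K Δ B) T).toOuterMeasure
      {s | IsPlay (enforce n K Δ B) s ∧ a ≤ pathSum (pairTest b u v r) s} ≤
      ENNReal.ofReal (Real.exp (-(l * a) + l ^ 2 * (4 * b ^ 2) ^ 2 * (2 * K))) := by
  refine le_trans ?_ (pathSum_tail (enforce n K Δ B) (pairTest b u v r)
    (fun e => ∃ z, e = some z ∧ (u ∈ z ∨ v ∈ z)) hl hlb
    (fun s => stepExp_pairTest b u v r s _)
    (fun s c => by convert abs_pairTest_le B hb hΔ hKb u v r s c) T)
  refine MeasureTheory.measure_mono ?_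
  rintro s ⟨hs, ha⟩
  have h0 := pathSum_incident_le s u v
  have h1 : (degreeIn n K s u : ℝ) ≤ Δ := by exact_mod_cast degreeIn_le_of_isPlay hs u
  have h2 : (degreeIn n K s v : ℝ) ≤ Δ := by exact_mod_cast degreeIn_le_of_isPlay hs v
  have h3 : (Δ : ℝ) ≤ K := by exact_mod_cast hΔ.le
  have h4 := h0.trans (by linarith : _ ≤ (2 : ℝ) * K)
  exact ⟨ha, le_of_eq_of_le (by congr!) h4⟩

/-- Non-asymptotic form of the success probability bound. -/
lemma le_toOuterMeasure_success {Δ T : ℕ} (B : State n K → Option (Sym2 (Fin n)))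
    {b δ M l₁ l₂ : ℝ} (hΔ : Δ < K) (hb : 1 ≤ b) (hKb : (K : ℝ) ≤ b * (K - Δ))
    (hn : (n : ℝ) ≤ M * K) (hT : (T : ℝ) ≤ M * K ^ 2) (hδ : 0 ≤ δ)
    (hδb : δ * (1 + 2 * M * (2 * b ^ 3) * (1 + 2 * (2 * b ^ 3) * M) *
      Real.exp (8 * (2 * b ^ 3) ^ 2 * M)) * (32 * b ^ 4) ≤ 1)
    (hl₁ : 0 ≤ l₁) (hlb₁ : l₁ * (4 * b) ≤ 1) (hl₂ : 0 ≤ l₂) (hlb₂ : l₂ * (4 * b ^ 2) ≤ 1) :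
    1 - ENNReal.ofReal (2 ^ n * ((T + 1) ^ n * (T + 1) ^ K) *
          Real.exp (-(l₁ * (δ * K ^ 2)) + l₁ ^ 2 * (4 * b) ^ 2 * T) +
        n * (n * (T + 1)) *
          Real.exp (-(l₂ * (K / 4)) + l₂ ^ 2 * (4 * b ^ 2) ^ 2 * (2 * K))) ≤
      (run n K (enforce n K Δ B) T).toOuterMeasure {s | Success n K s ∧ Proper n K s} := by
  have hb0 : 0 < b := by linarith
  have hK' : (0 : ℝ) < K := by exact_mod_cast (by omega : 0 < K)
  set μ := (run n K (enforce n K Δ B) T).toOuterMeasure with hμ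
  set S : Set (State n K) := {s | Success n K s ∧ Proper n K s} with hS
  set U : (Fin n → Bool) × (Fin n → Fin (T + 1)) × (Fin K → Fin (T + 1)) → Set (State n K) :=
    fun q => {s | s.length = T ∧ δ * K ^ 2 ≤
      pathSum (testFluct q.1 (fun x => q.2.1 x) fun c => q.2.2 c) s} with hU
  set W : Fin n × Fin n × Fin (T + 1) → Set (State n K) :=
    fun q => {s | IsPlay (enforce n K Δ B) s ∧ (K : ℝ) / 4 ≤
      pathSum (pairTest b q.1 q.2.1 q.2.2) s} with hW
  have hcover : (run n K (enforce n K Δ B) T).support ⊆ S ∪ ((⋃ q, U q) ∪ ⋃ q, W q) := by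
    intro s hs
    obtain ⟨hlen, hplay⟩ := isPlay_of_mem_support _ T s hs
    by_contra hnot
    simp only [Set.mem_union, Set.mem_iUnion, not_or, not_exists] at hnot
    obtain ⟨hnS, hnU, hnW⟩ := hnot
    refine hnS (success_and_proper_of_isPlay hplay fun t z hz => ?_)
    have hcard := le_card_freeEdge_of_isPlay hplay hΔ hb hKb hn (by rw [hlen]; exact hT) hδ hδb
      ?_ ?_ t z hz
    · rw [← Finset.card_pos]
      have : (0 : ℝ) < (freeEdge n K (s.take t) z).card := lt_of_lt_of_le (by positivity) hcard
      exact_mod_cast this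
    · intro r τ hr hτ
      set x : Fin n → ℝ := fun v => ∑ i ∈ Finset.range (r v),
        discFluct (Finset.univ.filter fun c => r v < τ c) v (s.take i) (s.getD i (none, none))
      have h1 := hnU (fun v => decide (0 ≤ x v), fun v => ⟨r v, by have := hr v; omega⟩,
        fun c => ⟨τ c, by have := hτ c; omega⟩)
      simp only [hU, Set.mem_ofPred_eq, not_and, not_le] at h1
      have h2 := h1 hlen
      rw [pathSum_testFluct _ _ _ _ hr] at h2
      refine le_trans (le_of_eq (Finset.sum_congr rfl fun v _ => ?_)) h2.le
      change |x v| = (if decide (0 ≤ x v) = true then 1 else -1) * x v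
      by_cases h : 0 ≤ x v
      · simp [h, abs_of_nonneg h]
      · simp [h, abs_of_neg (not_le.1 h)]
    · intro u v t' ht
      have h1 := hnW (u, v, ⟨t', by omega⟩)
      simp only [hW, Set.mem_ofPred_eq, not_and, not_le] at h1
      have h2 := h1 hplay
      rw [pathSum_pairTest _ _ _ _ _ ht.le] at h2
      linarith
  set x := Real.exp (-(l₁ * (δ * K ^ 2)) + l₁ ^ 2 * (4 * b) ^ 2 * T)
  set y := Real.exp (-(l₂ * (K / 4)) + l₂ ^ 2 * (4 * b ^ 2) ^ 2 * (2 * K))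
  have h1 : μ (⋃ q, U q) ≤ ENNReal.ofReal (2 ^ n * ((T + 1) ^ n * (T + 1) ^ K) * x) := by
    refine (MeasureTheory.measure_iUnion_fintype_le μ U).trans
      ((Finset.sum_le_sum fun q _ => testFluct_tail B hb0.le hΔ hKb hl₁ hlb₁ _ _ _ T).trans ?_)
    rw [Finset.sum_const, nsmul_eq_mul, ENNReal.ofReal_mul (by positivity),
      ← ENNReal.ofReal_natCast]
    simp [x]
  have h2 : μ (⋃ q, W q) ≤ ENNReal.ofReal (n * (n * (T + 1)) * y) := by
    refine (MeasureTheory.measure_iUnion_fintype_le μ W).trans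
      ((Finset.sum_le_sum fun q _ => pairTest_tail B hb0.le hΔ hKb hl₂ hlb₂ _ _ _ T).trans ?_)
    rw [Finset.sum_const, nsmul_eq_mul, ENNReal.ofReal_mul (by positivity),
      ← ENNReal.ofReal_natCast]
    simp [y]
  rw [tsub_le_iff_right, ENNReal.ofReal_add (by positivity) (by positivity)]
  calc (1 : ENNReal) = μ (S ∪ ((⋃ q, U q) ∪ ⋃ q, W q)) :=
        ((PMF.toOuterMeasure_apply_eq_one_iff _ _).2 hcover).symm
    _ ≤ μ S + (μ (⋃ q, U q) + μ (⋃ q, W q)) :=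
        (MeasureTheory.measure_union_le _ _).trans
          (add_le_add le_rfl (MeasureTheory.measure_union_le _ _))
    _ ≤ _ := add_le_add le_rfl (add_le_add h1 h2)

end Tests

section Asymptotics

lemma eventually_log_le {c : ℝ} (hc : 0 < c) : ∀ᶠ K : ℕ in Filter.atTop,
    Real.log K ≤ c * K := by
  have h := (Real.isLittleO_log_id_atTop.bound hc).natCast_atTop
  filter_upwards [h] with K hK
  simp only [id, Real.norm_eq_abs, Nat.abs_cast] at hK
  exact (le_abs_self _).trans hK

lemma eventually_error_le {M c₁ c₂ : ℝ} (hM : 1 < M) (h₁ : 0 < c₁) (h₂ : 0 < c₂) :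
    ∀ᶠ K : ℕ in Filter.atTop, ∀ n T : ℕ, (n : ℝ) ≤ M * K → (T : ℝ) ≤ M * K ^ 2 →
      2 ^ n * (((T : ℝ) + 1) ^ n * (T + 1) ^ K) * Real.exp (-(c₁ * K ^ 2)) +
        n * (n * (T + 1)) * Real.exp (-(c₂ * K)) ≤ Real.exp (-(c₂ / 2 * K)) := by
  have hbig : ∀ x : ℝ, ∀ᶠ K : ℕ in Filter.atTop, x ≤ K := fun x =>
    tendsto_natCast_atTop_atTop.eventually_ge_atTop x
  filter_upwards [eventually_log_le (c := c₁ / (8 * (M + 1))) (by positivity),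
    eventually_log_le (c := c₂ / 16) (by positivity), hbig 2, hbig (M + 1), hbig (2 * c₂ / c₁)]
    with K hlog₁ hlog₂ hK2 hKM hKc n T hn hT
  have hK0 : (0 : ℝ) < K := by linarith
  set L := Real.log K with hL
  have hL0 : 0 ≤ L := Real.log_nonneg (by linarith)
  have hpow : ∀ k : ℕ, Real.exp (k * L) = (K : ℝ) ^ k := fun k => by
    rw [Real.exp_nat_mul, hL, Real.exp_log hK0]
  have hT1 : (T : ℝ) + 1 ≤ K ^ 3 := by nlinarith [sq_nonneg (K : ℝ)]
  have hn2 : (n : ℝ) ≤ K ^ 2 := by nlinarith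
  have hA : 2 ^ n * (((T : ℝ) + 1) ^ n * (T + 1) ^ K) ≤ Real.exp (4 * (M + 1) * K * L) := by
    calc 2 ^ n * (((T : ℝ) + 1) ^ n * (T + 1) ^ K)
        ≤ (K : ℝ) ^ n * (((K : ℝ) ^ 3) ^ n * ((K : ℝ) ^ 3) ^ K) := by gcongr
      _ = (K : ℝ) ^ (4 * n + 3 * K) := by ring
      _ = Real.exp (((4 * n + 3 * K : ℕ) : ℝ) * L) := (hpow _).symm
      _ ≤ Real.exp (4 * (M + 1) * K * L) := by
          refine Real.exp_le_exp.2 (mul_le_mul_of_nonneg_right ?_ hL0)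
          push_cast
          linarith
  have hB : (n : ℝ) * (n * (T + 1)) ≤ K ^ 7 := by
    calc (n : ℝ) * (n * (T + 1)) ≤ K ^ 2 * (K ^ 2 * K ^ 3) := by gcongr
      _ = (K : ℝ) ^ 7 := by ring
  have hA' : 2 ^ n * (((T : ℝ) + 1) ^ n * (T + 1) ^ K) * Real.exp (-(c₁ * K ^ 2)) ≤
      1 * Real.exp (-(c₂ * K)) := by
    rw [one_mul]
    refine (mul_le_mul_of_nonneg_right hA (Real.exp_nonneg _)).trans ?_
    rw [← Real.exp_add]
    refine Real.exp_le_exp.2 ?_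
    rw [div_le_iff₀ h₁] at hKc
    rw [div_mul_eq_mul_div, le_div_iff₀ (by linarith)] at hlog₁
    nlinarith
  have h7 : (1 : ℝ) ≤ K ^ 7 := one_le_pow₀ (by linarith)
  calc _ ≤ 1 * Real.exp (-(c₂ * K)) + K ^ 7 * Real.exp (-(c₂ * K)) :=
        add_le_add hA' (mul_le_mul_of_nonneg_right hB (Real.exp_nonneg _))
    _ = (1 + K ^ 7) * Real.exp (-(c₂ * K)) := by ring
    _ ≤ K ^ 8 * Real.exp (-(c₂ * K)) := by
        refine mul_le_mul_of_nonneg_right ?_ (Real.exp_nonneg _)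
        have : (K : ℝ) ^ 8 = K ^ 7 * K := by ring
        nlinarith
    _ = Real.exp ((8 : ℕ) * L + -(c₂ * K)) := by rw [Real.exp_add, hpow]
    _ ≤ Real.exp (-(c₂ / 2 * K)) := by
        refine Real.exp_le_exp.2 ?_
        push_cast
        linarith

end Asymptotics

/-- **Dense case, adaptive adversary.** For every `ε ∈ (0,1)` and `M > 1`
there is `γ > 0` such that for all sufficiently large `n` and all `Δ > n/M`,
against every (possibly adaptive) Builder strategy in the game `Φ(n,Δ,ε)`
(with `⌈(1+ε)Δ⌉` colors and `⌊nΔ/2⌋` steps), the randomized greedy algorithm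
properly colors every presented edge with probability at least `1 − 2^{−γΔ}`. -/
theorem dense_adaptive (ε : ℝ) (hε0 : 0 < ε) (hε1 : ε < 1) (M : ℝ) (hM : 1 < M) :
    ∃ γ : ℝ, 0 < γ ∧ ∃ n₀ : ℕ, ∀ n : ℕ, n₀ ≤ n → ∀ Δ : ℕ, (n : ℝ) / M < (Δ : ℝ) →
      ∀ B : State n ⌈(1 + ε) * (Δ : ℝ)⌉₊ → Option (Sym2 (Fin n)),
        1 - ENNReal.ofReal ((2 : ℝ) ^ (-(γ * (Δ : ℝ)))) ≤
          (run n ⌈(1 + ε) * (Δ : ℝ)⌉₊ (enforce n ⌈(1 + ε) * (Δ : ℝ)⌉₊ Δ B)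
              (n * Δ / 2)).toOuterMeasure
            {s | Success n ⌈(1 + ε) * (Δ : ℝ)⌉₊ s ∧
                 Proper n ⌈(1 + ε) * (Δ : ℝ)⌉₊ s} := by
  set b : ℝ := 3 / ε with hbdef
  have hb : 1 ≤ b := by rw [hbdef, le_div_iff₀ hε0]; linarith
  have hb0 : 0 < b := by linarith
  set C : ℝ := 1 + 2 * M * (2 * b ^ 3) * (1 + 2 * (2 * b ^ 3) * M) *
    Real.exp (8 * (2 * b ^ 3) ^ 2 * M) with hC
  have hC1 : 1 ≤ C := by
    have : 0 ≤ 2 * M * (2 * b ^ 3) * (1 + 2 * (2 * b ^ 3) * M) *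
      Real.exp (8 * (2 * b ^ 3) ^ 2 * M) := by positivity
    linarith
  have hC0 : 0 < C := by linarith
  set δ : ℝ := 1 / (C * (32 * b ^ 4)) with hδ
  have hδ0 : 0 < δ := by positivity
  have hb4 : 1 ≤ b ^ 4 := one_le_pow₀ hb
  have hδ1 : δ ≤ 1 := by
    rw [hδ, div_le_one (by positivity)]
    nlinarith
  have hc₁ : 0 < δ ^ 2 / (64 * b ^ 2 * M) := by positivity
  have hc₂ : 0 < 1 / (2048 * b ^ 4) := by positivity
  obtain ⟨K₀, hK₀⟩ := Filter.eventually_atTop.1 (eventually_error_le hM hc₁ hc₂)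
  refine ⟨1 / (2048 * b ^ 4) / 2, by positivity, ⌈M * (K₀ + 1)⌉₊, fun n hn Δ hΔ B => ?_⟩
  have hn' : M * (K₀ + 1) ≤ n := (Nat.le_ceil _).trans (by exact_mod_cast hn)
  have hΔK₀ : (K₀ : ℝ) + 1 < Δ := by
    refine lt_of_le_of_lt ?_ hΔ
    rw [le_div_iff₀ (by linarith)]
    linarith
  have hΔ1 : (1 : ℝ) < Δ := by
    have : (0 : ℝ) ≤ K₀ := Nat.cast_nonneg _
    linarith
  rw [div_lt_iff₀ (by linarith)] at hΔ
  have hK1 : (1 + ε) * (Δ : ℝ) ≤ ⌈(1 + ε) * (Δ : ℝ)⌉₊ := Nat.le_ceil _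
  have hK2 : (⌈(1 + ε) * (Δ : ℝ)⌉₊ : ℝ) < (1 + ε) * (Δ : ℝ) + 1 :=
    Nat.ceil_lt_add_one (by positivity)
  generalize ⌈(1 + ε) * (Δ : ℝ)⌉₊ = K at B hK1 hK2 ⊢
  have hεΔ : 0 < ε * Δ := by positivity
  have hΔK : (Δ : ℝ) < K := by linarith
  have hK3 : (K : ℝ) ≤ 3 * Δ := by nlinarith
  have hKb : (K : ℝ) ≤ b * (K - Δ) := by
    have h1 : b * (ε * Δ) ≤ b * (K - Δ) := by
      refine mul_le_mul_of_nonneg_left ?_ hb0.le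
      linarith
    have h2 : b * (ε * Δ) = 3 * Δ := by rw [hbdef]; field_simp
    linarith
  have hnK : (n : ℝ) ≤ M * K := by nlinarith
  have hTK : ((n * Δ / 2 : ℕ) : ℝ) ≤ M * K ^ 2 := by
    calc ((n * Δ / 2 : ℕ) : ℝ) ≤ ((n * Δ : ℕ) : ℝ) := by exact_mod_cast Nat.div_le_self _ _
      _ = n * Δ := by push_cast; ring
      _ ≤ (M * K) * K := by gcongr
      _ = M * K ^ 2 := by ring
  generalize n * Δ / 2 = T at hTK ⊢
  have hΔK' : Δ < K := by exact_mod_cast hΔK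
  have hK₀K : K₀ ≤ K := by exact_mod_cast (by linarith : (K₀ : ℝ) ≤ K)
  refine le_trans (tsub_le_tsub_left (ENNReal.ofReal_le_ofReal ?_) _)
    (le_toOuterMeasure_success B (M := M) (δ := δ) (l₁ := δ / (32 * b ^ 2 * M))
      (l₂ := 1 / (256 * b ^ 4)) hΔK' hb hKb hnK hTK hδ0.le ?_ (by positivity) ?_
      (by positivity) ?_)
  · have e₁ : -(δ / (32 * b ^ 2 * M) * (δ * K ^ 2)) +
        (δ / (32 * b ^ 2 * M)) ^ 2 * (4 * b) ^ 2 * T ≤ -(δ ^ 2 / (64 * b ^ 2 * M) * K ^ 2) := by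
      calc _ ≤ -(δ / (32 * b ^ 2 * M) * (δ * K ^ 2)) +
          (δ / (32 * b ^ 2 * M)) ^ 2 * (4 * b) ^ 2 * (M * K ^ 2) := by gcongr
        _ = -(δ ^ 2 / (64 * b ^ 2 * M) * K ^ 2) := by field_simp; ring
    have e₂ : -(1 / (256 * b ^ 4) * ((K : ℝ) / 4)) +
        (1 / (256 * b ^ 4)) ^ 2 * (4 * b ^ 2) ^ 2 * (2 * K) = -(1 / (2048 * b ^ 4) * K) := by
      field_simp; ring
    rw [e₂]
    refine le_trans (add_le_add (mul_le_mul_of_nonneg_left (Real.exp_le_exp.2 e₁)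
      (by positivity)) le_rfl) ((hK₀ K hK₀K n T hnK hTK).trans ?_)
    rw [Real.rpow_def_of_pos two_pos]
    refine Real.exp_le_exp.2 ?_
    have hlog : Real.log 2 ≤ 1 := by linarith [Real.log_two_lt_d9]
    have h1 : Real.log 2 * Δ ≤ K := by nlinarith [Real.log_nonneg (one_le_two : (1 : ℝ) ≤ 2)]
    have h2 := mul_le_mul_of_nonneg_left h1 (half_pos hc₂).le
    linarith
  · rw [← hC, mul_assoc, hδ, one_div_mul_cancel (by positivity)]
  · rw [div_mul_eq_mul_div, div_le_one (by positivity)]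
    have h1 : b ≤ b ^ 2 := le_self_pow₀ hb two_ne_zero
    have h2 : b ^ 2 ≤ b ^ 2 * M := le_mul_of_one_le_right (sq_nonneg b) hM.le
    have h3 : δ * (4 * b) ≤ 4 * b := mul_le_of_le_one_left (by positivity) hδ1
    linarith
  · rw [div_mul_eq_mul_div, div_le_one (by positivity)]
    have h1 : b ^ 2 ≤ b ^ 4 := pow_le_pow_right₀ hb (by norm_num)
    linarith

end RandomGreedyEC
end

section
/- For every constant ε ∈ (0,1) and every constant M > 1, for all sufficiently large Δ and every n ≤ M·Δ, there exists a deterministic Colorer strategy for the online edge coloring game Φ(n,Δ,ε) that, against every (possibly adaptive) Builder strategy, colors every presented edge; that is, it produces online a proper edge coloring of any adaptively chosen simple graph on n vertices with maximum degree at most Δ, using at most ⌈(1+ε)Δ⌉ colors. -/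
open scoped Classical

namespace RandomGreedyEC

/-- The (deterministic) run of the game: Builder `B` (with illegal moves
nullified) against the deterministic Colorer strategy `Col`, which assigns to
each state and newly arrived edge a color or no color. -/
noncomputable def runDet (n K Δ : ℕ) (B : State n K → Option (Sym2 (Fin n)))
    (Col : State n K → Sym2 (Fin n) → Option (Fin K)) : ℕ → State n K
  | 0 => []
  | i + 1 =>
      let s := runDet n K Δ B Col i
      match enforce n K Δ B s with
      | none => s ++ [(none, none)]
      | some e => s ++ [(some e, Col s e)]

section Resampling

variable {Γ : Type*} [Fintype Γ]

/-- The weights at a vertex after an edge whose color is drawn from `p` received the color `c`.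
Each weight is a martingale under this update. -/
noncomputable def reweight (y p : Γ → ℝ) (c : Γ) : Γ → ℝ :=
  fun d => if d = c then 0 else y d / (1 - p d)

/-- The change of the pairing of a test vector `τ` with the weights `y` when `c` is drawn. -/
noncomputable def increment (τ y p : Γ → ℝ) (c : Γ) : ℝ :=
  ∑ d, τ d * (reweight y p c d - y d)

theorem sum_mul_increment_eq_zero (τ y p : Γ → ℝ) (hp : ∀ c, p c ≤ 1 / 2)
    (hsum : ∑ c, p c = 1) : ∑ c, p c * increment τ y p c = 0 := by
  simp only [increment, Finset.mul_sum]
  rw [Finset.sum_comm]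
  refine Finset.sum_eq_zero fun d _ => ?_
  have hd : 1 - p d ≠ 0 := by linarith [hp d]
  have h : ∀ c, p c * (τ d * (reweight y p c d - y d)) =
      p c * (τ d * (y d / (1 - p d) - y d)) - if d = c then p c * (τ d * (y d / (1 - p d))) else 0 := by
    intro c
    unfold reweight
    split_ifs <;> ring
  simp only [h, Finset.sum_sub_distrib, ← Finset.sum_mul, hsum, Finset.sum_ite_eq,
    Finset.mem_univ, if_true]
  field_simp
  ring

theorem abs_increment_le {τ y p : Γ → ℝ} {T Y : ℝ} (hp0 : ∀ c, 0 ≤ p c) (hp : ∀ c, p c ≤ 1 / 2)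
    (hsum : ∑ c, p c = 1) (hτ : ∀ c, |τ c| ≤ T) (hy0 : ∀ c, 0 ≤ y c) (hy : ∀ c, y c ≤ Y) (c : Γ) :
    |increment τ y p c| ≤ 3 * T * Y := by
  have hT : 0 ≤ T := (abs_nonneg _).trans (hτ c)
  have hY : 0 ≤ Y := (hy0 c).trans (hy c)
  have h : ∀ d, |τ d * (reweight y p c d - y d)| ≤ (if d = c then T * Y else 0) + T * Y * 2 * p d := by
    intro d
    rw [abs_mul]
    have hd : 0 < 1 - p d := by linarith [hp d]
    have h2 : y d * p d ≤ Y * p d := mul_le_mul_of_nonneg_right (hy d) (hp0 d)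
    have h3 : 0 ≤ Y * p d := mul_nonneg hY (hp0 d)
    unfold reweight
    split_ifs with hdc
    · have h1 : |0 - y d| ≤ Y := by rw [zero_sub, abs_neg, abs_of_nonneg (hy0 d)]; exact hy d
      have := mul_le_mul (hτ d) h1 (abs_nonneg _) hT
      nlinarith
    · have h1 : |y d / (1 - p d) - y d| ≤ Y * 2 * p d := by
        have he : y d / (1 - p d) - y d = y d * p d / (1 - p d) := by field_simp; ring
        rw [he, abs_of_nonneg (div_nonneg (mul_nonneg (hy0 d) (hp0 d)) hd.le), div_le_iff₀ hd]
        nlinarith [hp d]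
      have := mul_le_mul (hτ d) h1 (abs_nonneg _) hT
      linarith
  calc |increment τ y p c| ≤ ∑ d, |τ d * (reweight y p c d - y d)| :=
        Finset.abs_sum_le_sum_abs _ _
    _ ≤ ∑ d, ((if d = c then T * Y else 0) + T * Y * 2 * p d) :=
        Finset.sum_le_sum fun d _ => h d
    _ = 3 * T * Y := by
        rw [Finset.sum_add_distrib, ← Finset.mul_sum, hsum]
        simp
        ring

theorem sum_mul_exp_le {p x : Γ → ℝ} {B lam : ℝ} (hp0 : ∀ c, 0 ≤ p c) (hsum : ∑ c, p c = 1)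
    (hmean : ∑ c, p c * x c = 0) (hx : ∀ c, |x c| ≤ B) (hB : |lam| * B ≤ 1) :
    ∑ c, p c * Real.exp (lam * x c) ≤ Real.exp (lam ^ 2 * B ^ 2) := by
  have h : ∀ c, p c * Real.exp (lam * x c) ≤ p c * (1 + lam ^ 2 * B ^ 2) + lam * (p c * x c) := by
    intro c
    have h1 : |lam * x c| ≤ 1 := by
      rw [abs_mul]
      exact (mul_le_mul_of_nonneg_left (hx c) (abs_nonneg _)).trans hB
    have h2 := (abs_le.1 (Real.abs_exp_sub_one_sub_id_le h1)).2
    have h3 : x c ^ 2 ≤ B ^ 2 := sq_le_sq' (abs_le.1 (hx c)).1 (abs_le.1 (hx c)).2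
    have h4 : (lam * x c) ^ 2 ≤ lam ^ 2 * B ^ 2 := by
      rw [mul_pow]; exact mul_le_mul_of_nonneg_left h3 (sq_nonneg _)
    have := mul_le_mul_of_nonneg_left (show Real.exp (lam * x c) ≤ 1 + lam ^ 2 * B ^ 2 + lam * x c by
      linarith) (hp0 c)
    linarith
  calc _ ≤ ∑ c, (p c * (1 + lam ^ 2 * B ^ 2) + lam * (p c * x c)) := Finset.sum_le_sum fun c _ => h c
    _ = lam ^ 2 * B ^ 2 + 1 := by
        rw [Finset.sum_add_distrib, ← Finset.sum_mul, ← Finset.mul_sum, hsum, hmean]; ring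
    _ ≤ _ := Real.add_one_le_exp _

theorem sum_mul_exp_increment_le {τ y p : Γ → ℝ} {T Y B lam : ℝ} (hp0 : ∀ c, 0 ≤ p c)
    (hp : ∀ c, p c ≤ 1 / 2) (hsum : ∑ c, p c = 1) (hτ : ∀ c, |τ c| ≤ T) (hy0 : ∀ c, 0 ≤ y c)
    (hy : ∀ c, y c ≤ Y) (hTY : 3 * T * Y ≤ B) (hB : |lam| * B ≤ 1) :
    ∑ c, p c * Real.exp (lam * increment τ y p c) ≤ Real.exp (lam ^ 2 * B ^ 2) :=
  sum_mul_exp_le hp0 hsum (sum_mul_increment_eq_zero τ y p hp hsum)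
    (fun c => (abs_increment_le hp0 hp hsum hτ hy0 hy c).trans hTY) hB

theorem sum_mul_le_of_le {p F : Γ → ℝ} {f : ℝ} (hp0 : ∀ c, 0 ≤ p c) (hsum : ∑ c, p c = 1)
    (hF : ∀ c, F c ≤ f) : ∑ c, p c * F c ≤ f :=
  calc ∑ c, p c * F c ≤ ∑ c, p c * f :=
        Finset.sum_le_sum fun c _ => mul_le_mul_of_nonneg_left (hF c) (hp0 c)
    _ = f := by rw [← Finset.sum_mul, hsum, one_mul]

theorem sum_mul_le_of_le_mul_exp_increment {τ y p F : Γ → ℝ} {T Y B lam f : ℝ}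
    (hp0 : ∀ c, 0 ≤ p c) (hp : ∀ c, p c ≤ 1 / 2) (hsum : ∑ c, p c = 1) (hτ : ∀ c, |τ c| ≤ T)
    (hy0 : ∀ c, 0 ≤ y c) (hy : ∀ c, y c ≤ Y) (hTY : 3 * T * Y ≤ B) (hB : |lam| * B ≤ 1)
    (hf : 0 ≤ f)
    (hF : ∀ c, F c ≤ f * Real.exp (-(lam ^ 2 * B ^ 2)) * Real.exp (lam * increment τ y p c)) :
    ∑ c, p c * F c ≤ f :=
  calc ∑ c, p c * F c
      ≤ ∑ c, p c * (f * Real.exp (-(lam ^ 2 * B ^ 2)) * Real.exp (lam * increment τ y p c)) :=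
        Finset.sum_le_sum fun c _ => mul_le_mul_of_nonneg_left (hF c) (hp0 c)
    _ = f * Real.exp (-(lam ^ 2 * B ^ 2)) * ∑ c, p c * Real.exp (lam * increment τ y p c) := by
        rw [Finset.mul_sum]
        exact Finset.sum_congr rfl fun c _ => by ring
    _ ≤ f * Real.exp (-(lam ^ 2 * B ^ 2)) * Real.exp (lam ^ 2 * B ^ 2) :=
        mul_le_mul_of_nonneg_left
          (sum_mul_exp_increment_le hp0 hp hsum hτ hy0 hy hTY hB) (mul_nonneg hf (Real.exp_nonneg _))
    _ = f := by rw [mul_assoc, ← Real.exp_add]; simp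

end Resampling

/-- The data steering the coloring: the weight of each color at each vertex, the accumulated
centered weights of the neighbors at the time they were joined, the degrees and the adjacency. -/
structure Board (V Γ : Type*) where
  y : V → Γ → ℝ
  q : V → Γ → ℝ
  deg : V → ℝ
  adj : V → V → Prop

namespace Board

variable {V Γ : Type*} [Fintype Γ]

/-- The board after the edge `uw` received the color `c` drawn from the distribution `p`. -/
noncomputable def next (S : Board V Γ) (u w : V) (p : Γ → ℝ) (c : Γ) : Board V Γ where
  y a := if a = u ∨ a = w then reweight (S.y a) p c else S.y a
  q a := if a = u ∨ a = w then fun d => S.q a d + (S.y (if a = u then w else u) d - 1) else S.q a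
  deg a := if a = u ∨ a = w then S.deg a + 1 else S.deg a
  adj a b := S.adj a b ∨ a ≠ b ∧ (a = u ∨ a = w) ∧ (b = u ∨ b = w)

/-- Deviation of the total weight at a vertex from its mean. -/
noncomputable def massDev (S : Board V Γ) (a : V) : ℝ := ∑ c, (S.y a c - 1)

/-- Correlation of the centered weights at two vertices. -/
noncomputable def corr (S : Board V Γ) (a b : V) : ℝ := ∑ c, (S.y a c - 1) * (S.y b c - 1)

/-- Correlation of the accumulated neighborhood weights of `a` with the weights at `b`. -/
noncomputable def nbrCorr (S : Board V Γ) (a b : V) : ℝ := ∑ c, S.q a c * (S.y b c - 1)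

noncomputable def massTerm (S : Board V Γ) (B lam : ℝ) (a : V) : ℝ :=
  Real.exp (lam * S.massDev a - lam ^ 2 * B ^ 2 * S.deg a)

noncomputable def corrTerm (S : Board V Γ) (B lam : ℝ) (a b : V) : ℝ :=
  if a = b then 0 else
    Real.exp (lam * S.corr a b - lam ^ 2 * B ^ 2 * (S.deg a + S.deg b) -
      if S.adj a b then 3 * |lam| * B else 0)

noncomputable def nbrTerm (S : Board V Γ) (B δ D lam : ℝ) (a b : V) : ℝ :=
  if a = b ∨ S.adj a b then 0 else
    Real.exp (lam * (S.nbrCorr a b / D) - |lam| * δ * S.deg a - lam ^ 2 * B ^ 2 * S.deg b)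

/-- The exponential potential, a supermartingale of the randomized strategy. -/
noncomputable def potential [Fintype V] (S : Board V Γ) (B δ D lam : ℝ) : ℝ :=
  ∑ a, (S.massTerm B lam a + ∑ b, (S.corrTerm B lam a b + S.nbrTerm B δ D lam a b))

/-- The deterministic part of the invariant. -/
structure Sound (S : Board V Γ) (b N D κ : ℝ) : Prop where
  y_nonneg : ∀ a c, 0 ≤ S.y a c
  y_le : ∀ a c, S.y a c ≤ 2 * b
  y_mul_le : ∀ a c, S.y a c * (1 - (S.deg a + S.q a c) / N) ≤ 1
  q_abs : ∀ a c, |S.q a c| ≤ 2 * b * S.deg a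
  q_sq : ∀ a, ∑ c, S.q a c ^ 2 ≤ κ * D ^ 2 * S.deg a
  deg_nonneg : ∀ a, 0 ≤ S.deg a
  deg_le : ∀ a, S.deg a ≤ D

section Supermartingale

variable {S : Board V Γ} {u w : V} {p : Γ → ℝ} {b N D κ B δ lam : ℝ}

theorem Sound.abs_centered_le (hS : S.Sound b N D κ) (hb : 1 ≤ b) (a : V) (c : Γ) :
    |S.y a c - 1| ≤ 2 * b := by
  rw [abs_le]
  constructor <;> linarith [hS.y_nonneg a c, hS.y_le a c]

theorem sum_mul_massTerm_next_le (hS : S.Sound b N D κ) (hb : 1 ≤ b) (hp0 : ∀ c, 0 ≤ p c)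
    (hp : ∀ c, p c ≤ 1 / 2) (hsum : ∑ c, p c = 1) (hbB : 12 * b ^ 2 ≤ B) (hB : |lam| * B ≤ 1)
    (a : V) : ∑ c, p c * (S.next u w p c).massTerm B lam a ≤ S.massTerm B lam a := by
  by_cases ha : a = u ∨ a = w
  · refine sum_mul_le_of_le_mul_exp_increment (τ := fun _ => (1 : ℝ)) (T := 2 * b) (Y := 2 * b)
      hp0 hp hsum (fun _ => by rw [abs_one]; linarith) (hS.y_nonneg a) (hS.y_le a)
      (by nlinarith) hB (Real.exp_nonneg _) fun c => le_of_eq ?_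
    rw [massTerm, massTerm, ← Real.exp_add, ← Real.exp_add]
    congr 1
    have : (S.next u w p c).massDev a = S.massDev a + increment (fun _ => 1) (S.y a) p c := by
      simp only [massDev, next, increment, if_pos ha, ← Finset.sum_add_distrib]
      exact Finset.sum_congr rfl fun d _ => by ring
    rw [this]
    simp only [next, if_pos ha]
    ring
  · refine sum_mul_le_of_le hp0 hsum fun c => le_of_eq ?_
    simp only [massTerm, massDev, next, if_neg ha]

theorem sum_mul_corrTerm_next_le (hS : S.Sound b N D κ) (hb : 1 ≤ b) (huw : ¬ S.adj u w)
    (hwu : ¬ S.adj w u) (hp0 : ∀ c, 0 ≤ p c)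
    (hp : ∀ c, p c ≤ 1 / 2) (hsum : ∑ c, p c = 1) (hbB : 12 * b ^ 2 ≤ B) (hB : |lam| * B ≤ 1)
    (a a' : V) : ∑ c, p c * (S.next u w p c).corrTerm B lam a a' ≤ S.corrTerm B lam a a' := by
  by_cases haa : a = a'
  · simp [corrTerm, haa]
  have hcent := fun v => hS.abs_centered_le hb v
  by_cases ha : a = u ∨ a = w <;> by_cases ha' : a' = u ∨ a' = w
  · have hadj : ¬ S.adj a a' := by
      rcases ha with rfl | rfl <;> rcases ha' with rfl | rfl <;> simp_all
    refine sum_mul_le_of_le hp0 hsum fun c => ?_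
    have h1 := abs_increment_le (y := S.y a) (τ := fun d => S.y a' d - 1) hp0 hp hsum (hcent a')
      (hS.y_nonneg a) (hS.y_le a) c
    have h2 := abs_increment_le (y := S.y a') (τ := fun d => reweight (S.y a) p c d - 1)
      (T := 4 * b) hp0 hp hsum ?_ (hS.y_nonneg a') (hS.y_le a') c
    · have h : (S.next u w p c).corr a a' = S.corr a a' +
          increment (fun d => S.y a' d - 1) (S.y a) p c +
          increment (fun d => reweight (S.y a) p c d - 1) (S.y a') p c := by
        simp only [corr, next, increment, if_pos ha, if_pos ha', ← Finset.sum_add_distrib]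
        exact Finset.sum_congr rfl fun d _ => by ring
      have hadj' : (S.next u w p c).adj a a' := Or.inr ⟨haa, ha, ha'⟩
      rw [corrTerm, corrTerm, if_neg haa, if_neg haa, h, if_neg hadj, if_pos hadj']
      apply Real.exp_le_exp.2
      simp only [next, if_pos ha, if_pos ha']
      have h3 := (abs_add_le _ _).trans (add_le_add h1 h2)
      have h4 := (le_abs_self _).trans ((abs_mul lam _).le.trans
        (mul_le_mul_of_nonneg_left h3 (abs_nonneg lam)))
      have h5 : |lam| * (3 * (2 * b) * (2 * b) + 3 * (4 * b) * (2 * b)) ≤ |lam| * (3 * B) :=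
        mul_le_mul_of_nonneg_left (by nlinarith) (abs_nonneg lam)
      nlinarith [mul_nonneg (sq_nonneg lam) (sq_nonneg B)]
    · intro d
      have hd : 1 / 2 ≤ 1 - p d := by linarith [hp d]
      have hle : reweight (S.y a) p c d ≤ 4 * b := by
        unfold reweight
        split_ifs
        · linarith
        · rw [div_le_iff₀ (by linarith)]
          nlinarith [hS.y_le a d]
      have hge : 0 ≤ reweight (S.y a) p c d := by
        unfold reweight
        split_ifs
        · exact le_rfl
        · exact div_nonneg (hS.y_nonneg a d) (by linarith)
      rw [abs_le]
      constructor <;> linarith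
  · refine sum_mul_le_of_le_mul_exp_increment (τ := fun d => S.y a' d - 1)
      hp0 hp hsum (hcent a') (hS.y_nonneg a) (hS.y_le a)
      (by nlinarith) hB ?_ fun c => le_of_eq ?_
    · rw [corrTerm, if_neg haa]; exact Real.exp_nonneg _
    have : (S.next u w p c).corr a a' = S.corr a a' +
        increment (fun d => S.y a' d - 1) (S.y a) p c := by
      simp only [corr, next, increment, if_pos ha, if_neg ha', ← Finset.sum_add_distrib]
      exact Finset.sum_congr rfl fun d _ => by ring
    rw [corrTerm, corrTerm, if_neg haa, if_neg haa, ← Real.exp_add, ← Real.exp_add, this]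
    congr 1
    simp only [next, if_pos ha, ha', if_false, and_false, or_false]
    ring
  · refine sum_mul_le_of_le_mul_exp_increment (τ := fun d => S.y a d - 1)
      hp0 hp hsum (hcent a) (hS.y_nonneg a') (hS.y_le a')
      (by nlinarith) hB ?_ fun c => le_of_eq ?_
    · rw [corrTerm, if_neg haa]; exact Real.exp_nonneg _
    have : (S.next u w p c).corr a a' = S.corr a a' +
        increment (fun d => S.y a d - 1) (S.y a') p c := by
      simp only [corr, next, increment, if_neg ha, if_pos ha', ← Finset.sum_add_distrib]
      exact Finset.sum_congr rfl fun d _ => by ring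
    rw [corrTerm, corrTerm, if_neg haa, if_neg haa, ← Real.exp_add, ← Real.exp_add, this]
    congr 1
    simp only [next, if_pos ha', ha, if_false, false_and, and_false, or_false]
    ring
  · refine sum_mul_le_of_le hp0 hsum fun c => le_of_eq ?_
    simp only [corrTerm, corr, next, ha, ha', if_false, and_false, or_false]

theorem sum_mul_nbrTerm_next_le (hS : S.Sound b N D κ) (hb : 1 ≤ b) (hD : 0 < D)
    (hp0 : ∀ c, 0 ≤ p c) (hp : ∀ c, p c ≤ 1 / 2) (hsum : ∑ c, p c = 1)
    (hbB : 12 * b ^ 2 ≤ B) (hB : |lam| * B ≤ 1)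
    (hcorr : ∀ a a', a ≠ a' → |S.corr a a'| ≤ δ * D) (a a' : V) :
    ∑ c, p c * (S.next u w p c).nbrTerm B δ D lam a a' ≤ S.nbrTerm B δ D lam a a' := by
  by_cases haa : a = a'
  · simp [nbrTerm, haa]
  by_cases hadj : S.adj a a'
  · simp [nbrTerm, hadj, next]
  have hneg : ¬ (a = a' ∨ S.adj a a') := by simp [haa, hadj]
  by_cases ha : a = u ∨ a = w <;> by_cases ha' : a' = u ∨ a' = w
  · have h : ∀ c, (S.next u w p c).nbrTerm B δ D lam a a' = 0 := fun c =>
      if_pos (Or.inr (Or.inr ⟨haa, ha, ha'⟩))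
    simp only [h, mul_zero, Finset.sum_const_zero]
    rw [nbrTerm, if_neg hneg]
    exact Real.exp_nonneg _
  · refine sum_mul_le_of_le hp0 hsum fun c => ?_
    set o := if a = u then w else u with ho
    have hoa' : o ≠ a' := by
      rintro rfl
      apply ha'
      rw [ho]
      split_ifs <;> simp
    have h : (S.next u w p c).nbrCorr a a' = S.nbrCorr a a' + S.corr o a' := by
      simp only [nbrCorr, corr, next, if_pos ha, if_neg ha', ← Finset.sum_add_distrib]
      exact Finset.sum_congr rfl fun d _ => by ring
    have h1 : lam * (S.corr o a' / D) ≤ |lam| * δ := by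
      refine (le_abs_self _).trans ?_
      rw [abs_mul, abs_div, abs_of_pos hD]
      exact mul_le_mul_of_nonneg_left ((div_le_iff₀ hD).2 (hcorr o a' hoa')) (abs_nonneg _)
    rw [nbrTerm, nbrTerm, if_neg hneg, h, if_neg (by simp only [next, ha', haa, hadj]; simp)]
    apply Real.exp_le_exp.2
    simp only [next, if_pos ha, if_neg ha']
    rw [add_div]
    linarith
  · refine sum_mul_le_of_le_mul_exp_increment (τ := fun d => S.q a d / D) (T := 2 * b)
      hp0 hp hsum (fun d => ?_) (hS.y_nonneg a') (hS.y_le a')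
      (by nlinarith) hB ?_ fun c => le_of_eq ?_
    · rw [abs_div, abs_of_pos hD, div_le_iff₀ hD]
      exact (hS.q_abs a d).trans (mul_le_mul_of_nonneg_left (hS.deg_le a) (by linarith))
    · rw [nbrTerm, if_neg hneg]; exact Real.exp_nonneg _
    have : (S.next u w p c).nbrCorr a a' / D = S.nbrCorr a a' / D +
        increment (fun d => S.q a d / D) (S.y a') p c := by
      simp only [nbrCorr, next, increment, if_neg ha, if_pos ha', Finset.sum_div,
        ← Finset.sum_add_distrib]
      exact Finset.sum_congr rfl fun d _ => by ring
    rw [nbrTerm, nbrTerm, if_neg hneg, if_neg (by simp only [next, ha, haa, hadj]; simp), this,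
      ← Real.exp_add, ← Real.exp_add]
    congr 1
    simp only [next, if_neg ha, if_pos ha']
    ring
  · refine sum_mul_le_of_le hp0 hsum fun c => le_of_eq ?_
    simp only [nbrTerm, nbrCorr, next, ha, ha', if_false, and_false, or_false]

theorem sum_mul_potential_next_le [Fintype V] (hS : S.Sound b N D κ) (hb : 1 ≤ b)
    (huw : ¬ S.adj u w) (hwu : ¬ S.adj w u) (hD : 0 < D)
    (hp0 : ∀ c, 0 ≤ p c) (hp : ∀ c, p c ≤ 1 / 2) (hsum : ∑ c, p c = 1)
    (hbB : 12 * b ^ 2 ≤ B) (hB : |lam| * B ≤ 1)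
    (hcorr : ∀ a a', a ≠ a' → |S.corr a a'| ≤ δ * D) :
    ∑ c, p c * (S.next u w p c).potential B δ D lam ≤ S.potential B δ D lam := by
  simp only [potential, Finset.mul_sum, mul_add]
  rw [Finset.sum_comm]
  refine Finset.sum_le_sum fun a _ => ?_
  rw [Finset.sum_add_distrib]
  refine add_le_add (sum_mul_massTerm_next_le hS hb hp0 hp hsum hbB hB a) ?_
  rw [Finset.sum_comm]
  refine Finset.sum_le_sum fun a' _ => ?_
  rw [Finset.sum_add_distrib]
  exact add_le_add (sum_mul_corrTerm_next_le hS hb huw hwu hp0 hp hsum hbB hB a a')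
    (sum_mul_nbrTerm_next_le hS hb hD hp0 hp hsum hbB hB hcorr a a')

end Supermartingale

section Concentration

variable {S : Board V Γ} {b N D κ B δ lam L : ℝ}

theorem massTerm_nonneg (S : Board V Γ) (B lam : ℝ) (a : V) : 0 ≤ S.massTerm B lam a :=
  Real.exp_nonneg _

theorem corrTerm_nonneg (S : Board V Γ) (B lam : ℝ) (a a' : V) : 0 ≤ S.corrTerm B lam a a' := by
  unfold corrTerm
  split_ifs <;> first | exact le_rfl | exact Real.exp_nonneg _

theorem nbrTerm_nonneg (S : Board V Γ) (B δ D lam : ℝ) (a a' : V) :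
    0 ≤ S.nbrTerm B δ D lam a a' := by
  unfold nbrTerm
  split_ifs <;> first | exact le_rfl | exact Real.exp_nonneg _

variable [Fintype V]

theorem massTerm_add_corrTerm_add_nbrTerm_le_potential (S : Board V Γ) (B δ D lam : ℝ) (a a' : V) :
    S.massTerm B lam a + (S.corrTerm B lam a a' + S.nbrTerm B δ D lam a a') ≤
      S.potential B δ D lam := by
  have h1 := Finset.single_le_sum
    (f := fun a' => S.corrTerm B lam a a' + S.nbrTerm B δ D lam a a')
    (fun i _ => add_nonneg (S.corrTerm_nonneg B lam a i) (S.nbrTerm_nonneg B δ D lam a i))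
    (Finset.mem_univ a')
  have h2 := Finset.single_le_sum
    (f := fun a => S.massTerm B lam a +
      ∑ a', (S.corrTerm B lam a a' + S.nbrTerm B δ D lam a a'))
    (fun i _ => add_nonneg (S.massTerm_nonneg B lam i) (Finset.sum_nonneg fun j _ =>
      add_nonneg (S.corrTerm_nonneg B lam i j) (S.nbrTerm_nonneg B δ D lam i j)))
    (Finset.mem_univ a)
  beta_reduce at h1 h2
  unfold potential
  linarith

theorem potential_nonneg (S : Board V Γ) (B δ D lam : ℝ) : 0 ≤ S.potential B δ D lam :=
  Finset.sum_nonneg fun a _ => add_nonneg (S.massTerm_nonneg B lam a) (Finset.sum_nonneg fun b _ =>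
    add_nonneg (S.corrTerm_nonneg B lam a b) (S.nbrTerm_nonneg B δ D lam a b))

/-- The sum of the potentials controlling the upper and the lower deviations. -/
noncomputable def energy (S : Board V Γ) (B δ D lam : ℝ) : ℝ :=
  S.potential B δ D lam + S.potential B δ D (-lam)

theorem abs_le_of_exp_le {x E t : ℝ} (hlam : 0 < lam) (h1 : Real.exp (lam * x - E) ≤ Real.exp L)
    (h2 : Real.exp (-lam * x - E) ≤ Real.exp L) (ht : L + E ≤ lam * t) : |x| ≤ t := by
  rw [Real.exp_le_exp] at h1 h2
  rw [abs_le]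
  constructor <;> refine le_of_mul_le_mul_left ?_ hlam <;> linarith

theorem abs_massDev_le (hS : S.Sound b N D κ) (hlam : 0 < lam) (hB0 : 0 ≤ B)
    (hE : S.energy B δ D lam ≤ Real.exp L)
    (hL : L + 2 * lam ^ 2 * B ^ 2 * D + 3 * lam * B ≤ lam * (δ * D)) (a : V) :
    |S.massDev a| ≤ δ * D := by
  have h : ∀ l, S.massTerm B l a ≤ S.potential B δ D l := fun l => by
    linarith [S.massTerm_add_corrTerm_add_nbrTerm_le_potential B δ D l a a,
      S.corrTerm_nonneg B l a a, S.nbrTerm_nonneg B δ D l a a]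
  have h1 := (h lam).trans ((le_add_of_nonneg_right (S.potential_nonneg B δ D (-lam))).trans hE)
  have h2 := (h (-lam)).trans ((le_add_of_nonneg_left (S.potential_nonneg B δ D lam)).trans hE)
  unfold massTerm at h1 h2
  rw [neg_sq] at h2
  refine abs_le_of_exp_le hlam h1 h2 ?_
  have hD := hS.deg_le a
  have := mul_nonneg (sq_nonneg lam) (sq_nonneg B)
  nlinarith [hS.deg_nonneg a, mul_nonneg hlam.le hB0, mul_le_mul_of_nonneg_left hD this]

theorem abs_corr_le (hS : S.Sound b N D κ) (hlam : 0 < lam) (hB0 : 0 ≤ B)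
    (hE : S.energy B δ D lam ≤ Real.exp L)
    (hL : L + 2 * lam ^ 2 * B ^ 2 * D + 3 * lam * B ≤ lam * (δ * D)) (a a' : V) (haa : a ≠ a') :
    |S.corr a a'| ≤ δ * D := by
  have h : ∀ l, S.corrTerm B l a a' ≤ S.potential B δ D l := fun l => by
    linarith [S.massTerm_add_corrTerm_add_nbrTerm_le_potential B δ D l a a',
      S.massTerm_nonneg B l a, S.nbrTerm_nonneg B δ D l a a']
  have h1 := (h lam).trans ((le_add_of_nonneg_right (S.potential_nonneg B δ D (-lam))).trans hE)
  have h2 := (h (-lam)).trans ((le_add_of_nonneg_left (S.potential_nonneg B δ D lam)).trans hE)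
  unfold corrTerm at h1 h2
  rw [if_neg haa, sub_sub] at h1
  rw [if_neg haa, neg_sq, abs_neg, sub_sub] at h2
  refine abs_le_of_exp_le hlam h1 h2 ?_
  rw [abs_of_pos hlam]
  have h3 : (if S.adj a a' then 3 * lam * B else 0) ≤ 3 * lam * B := by
    split_ifs
    · exact le_rfl
    · positivity
  have := mul_nonneg (sq_nonneg lam) (sq_nonneg B)
  nlinarith [mul_le_mul_of_nonneg_left (hS.deg_le a) this,
    mul_le_mul_of_nonneg_left (hS.deg_le a') this]

theorem abs_nbrCorr_le (hS : S.Sound b N D κ) (hlam : 0 < lam) (hB0 : 0 ≤ B) (hδ : 0 ≤ δ)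
    (hD : 0 < D) (hE : S.energy B δ D lam ≤ Real.exp L)
    (hL : L + 2 * lam ^ 2 * B ^ 2 * D + 3 * lam * B ≤ lam * (δ * D)) (a a' : V) (haa : a ≠ a')
    (hadj : ¬ S.adj a a') : |S.nbrCorr a a'| ≤ 2 * δ * D ^ 2 := by
  have h : ∀ l, S.nbrTerm B δ D l a a' ≤ S.potential B δ D l := fun l => by
    linarith [S.massTerm_add_corrTerm_add_nbrTerm_le_potential B δ D l a a',
      S.massTerm_nonneg B l a, S.corrTerm_nonneg B l a a']
  have h1 := (h lam).trans ((le_add_of_nonneg_right (S.potential_nonneg B δ D (-lam))).trans hE)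
  have h2 := (h (-lam)).trans ((le_add_of_nonneg_left (S.potential_nonneg B δ D lam)).trans hE)
  have hn : ¬ (a = a' ∨ S.adj a a') := by simp [haa, hadj]
  unfold nbrTerm at h1 h2
  rw [if_neg hn, sub_sub] at h1
  rw [if_neg hn, neg_sq, abs_neg, sub_sub] at h2
  have key : |S.nbrCorr a a' / D| ≤ 2 * δ * D := by
    refine abs_le_of_exp_le hlam h1 h2 ?_
    rw [abs_of_pos hlam]
    have := mul_nonneg (sq_nonneg lam) (sq_nonneg B)
    have h3 := mul_nonneg hlam.le hδ
    nlinarith [mul_le_mul_of_nonneg_left (hS.deg_le a') this,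
      mul_le_mul_of_nonneg_left (hS.deg_le a) h3, mul_nonneg hlam.le hB0, hS.deg_nonneg a']
  rw [abs_div, abs_of_pos hD, div_le_iff₀ hD] at key
  linarith

end Concentration

section Coloring

/-- Weights above the threshold `b` are not used. -/
noncomputable def trunc (b x : ℝ) : ℝ := if x ≤ b then x else 0

theorem trunc_nonneg {b x : ℝ} (hx : 0 ≤ x) : 0 ≤ trunc b x := by
  unfold trunc; split_ifs <;> first | exact hx | exact le_rfl

theorem trunc_le_self {b x : ℝ} (hx : 0 ≤ x) : trunc b x ≤ x := by
  unfold trunc; split_ifs <;> first | exact hx | exact le_rfl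

theorem trunc_le {b x : ℝ} (hb : 0 ≤ b) : trunc b x ≤ b := by
  unfold trunc; split_ifs <;> assumption

/-- The unnormalized probability of giving the edge `uw` the color `c`. -/
noncomputable def colorWeight (S : Board V Γ) (b : ℝ) (u w : V) (c : Γ) : ℝ :=
  trunc b (S.y u c) * trunc b (S.y w c)

noncomputable def colorDist (S : Board V Γ) (b : ℝ) (u w : V) (c : Γ) : ℝ :=
  S.colorWeight b u w c / ∑ d, S.colorWeight b u w d

/-- The relations between the parameters of the strategy. -/
structure Admissible (b N D κ B δ η lam L K : ℝ) : Prop where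
  one_le_b : 1 ≤ b
  N_pos : 0 < N
  D_pos : 0 < D
  η_pos : 0 < η
  δ_nonneg : 0 ≤ δ
  lam_pos : 0 < lam
  b_le_B : 12 * b ^ 2 ≤ B
  lam_B : lam * B ≤ 1
  potential : L + 2 * lam ^ 2 * B ^ 2 * D + 3 * lam * B ≤ lam * (δ * D)
  threshold : N ≤ b * (N - (η + 1) * D)
  total : N ≤ K - 3 * δ * D - 8 * b ^ 2 * κ * D / η ^ 2
  half : 2 * b ^ 2 ≤ N
  sq_growth : 4 * δ * D ^ 2 + 4 * b ^ 2 * K ≤ κ * D ^ 2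

variable {S : Board V Γ} {u w : V} {b N D κ B δ η lam L : ℝ}

theorem le_q_of_lt_y (hS : S.Sound b N D κ) (hP : Admissible b N D κ B δ η lam L (Fintype.card Γ))
    {a : V} {c : Γ} (h : b < S.y a c) : η * D ≤ S.q a c := by
  by_contra! hq
  have h1 : (S.deg a + S.q a c) / N < (η + 1) * D / N :=
    div_lt_div_of_pos_right (by linarith [hS.deg_le a]) hP.N_pos
  have h2 : 1 ≤ b * (1 - (η + 1) * D / N) := by
    have : b * (1 - (η + 1) * D / N) = b * (N - (η + 1) * D) / N := by
      field_simp [hP.N_pos.ne']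
    rw [this, le_div_iff₀ hP.N_pos, one_mul]
    exact hP.threshold
  have hb := hP.one_le_b
  have h3 : 0 < 1 - (η + 1) * D / N := by
    by_contra! h3
    nlinarith
  nlinarith [hS.y_mul_le a c]

theorem le_sum_colorWeight [Fintype V] (hS : S.Sound b N D κ)
    (hP : Admissible b N D κ B δ η lam L (Fintype.card Γ))
    (hE : S.energy B δ D lam ≤ Real.exp L) (hne : u ≠ w) :
    N ≤ ∑ c, S.colorWeight b u w c := by
  have hηD : 0 < (η * D) ^ 2 := pow_pos (mul_pos hP.η_pos hP.D_pos) 2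
  have hb := hP.one_le_b
  have hB0 : 0 ≤ B := le_trans (by positivity) hP.b_le_B
  have hpt : ∀ c, S.y u c * S.y w c - 4 * b ^ 2 / (η * D) ^ 2 * (S.q u c ^ 2 + S.q w c ^ 2) ≤
      S.colorWeight b u w c := by
    intro c
    have hyy : S.y u c * S.y w c ≤ 4 * b ^ 2 := by
      nlinarith [mul_le_mul (hS.y_le u c) (hS.y_le w c) (hS.y_nonneg w c) (by linarith)]
    have hbig : ∀ a, b < S.y a c → 4 * b ^ 2 ≤ 4 * b ^ 2 / (η * D) ^ 2 * S.q a c ^ 2 := by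
      intro a ha
      have := pow_le_pow_left₀ (mul_pos hP.η_pos hP.D_pos).le (le_q_of_lt_y hS hP ha) 2
      rw [div_mul_eq_mul_div, le_div_iff₀ hηD]
      exact mul_le_mul_of_nonneg_left this (by positivity)
    have hnn : ∀ a, 0 ≤ 4 * b ^ 2 / (η * D) ^ 2 * S.q a c ^ 2 := fun a => by positivity
    unfold colorWeight trunc
    split_ifs with h1 h2 h2
    · nlinarith [hnn u, hnn w]
    · nlinarith [hbig w (not_le.1 h2), hnn u]
    · nlinarith [hbig u (not_le.1 h1), hnn w]
    · nlinarith [hbig u (not_le.1 h1), hnn w]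
  have hsum := Finset.sum_le_sum fun c (_ : c ∈ Finset.univ) => hpt c
  rw [Finset.sum_sub_distrib, ← Finset.mul_sum, Finset.sum_add_distrib] at hsum
  have hyy : ∑ c, S.y u c * S.y w c =
      Fintype.card Γ + S.corr u w + S.massDev u + S.massDev w := by
    have : (Fintype.card Γ : ℝ) = ∑ _c : Γ, (1 : ℝ) := by simp
    rw [this, corr, massDev, massDev, ← Finset.sum_add_distrib, ← Finset.sum_add_distrib,
      ← Finset.sum_add_distrib]
    exact Finset.sum_congr rfl fun c _ => by ring
  have h1 := (abs_le.1 (abs_corr_le hS hP.lam_pos hB0 hE hP.potential u w hne)).1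
  have h2 := (abs_le.1 (abs_massDev_le hS hP.lam_pos hB0 hE hP.potential u)).1
  have h3 := (abs_le.1 (abs_massDev_le hS hP.lam_pos hB0 hE hP.potential w)).1
  have hκ : 0 ≤ κ * D ^ 2 := le_trans (by have := hP.δ_nonneg; positivity) hP.sq_growth
  have hq : ∀ a, ∑ c, S.q a c ^ 2 ≤ κ * D ^ 2 * D := fun a =>
    (hS.q_sq a).trans (mul_le_mul_of_nonneg_left (hS.deg_le a) hκ)
  have h4 : 4 * b ^ 2 / (η * D) ^ 2 * (∑ c, S.q u c ^ 2 + ∑ c, S.q w c ^ 2) ≤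
      8 * b ^ 2 * κ * D / η ^ 2 := by
    have := mul_le_mul_of_nonneg_left (add_le_add (hq u) (hq w))
      (show 0 ≤ 4 * b ^ 2 / (η * D) ^ 2 by positivity)
    refine this.trans (le_of_eq ?_)
    have := hP.η_pos.ne'
    have := hP.D_pos.ne'
    field_simp
    ring
  linarith [hP.total]

theorem colorWeight_nonneg (hS : S.Sound b N D κ) (c : Γ) : 0 ≤ S.colorWeight b u w c :=
  mul_nonneg (trunc_nonneg (hS.y_nonneg u c)) (trunc_nonneg (hS.y_nonneg w c))

theorem colorWeight_comm (S : Board V Γ) (b : ℝ) (u w : V) :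
    S.colorWeight b u w = S.colorWeight b w u := funext fun _ => mul_comm _ _

theorem colorDist_comm (S : Board V Γ) (b : ℝ) (u w : V) :
    S.colorDist b u w = S.colorDist b w u := by
  unfold colorDist
  rw [colorWeight_comm]

theorem colorDist_nonneg (hS : S.Sound b N D κ) (c : Γ) : 0 ≤ S.colorDist b u w c :=
  div_nonneg (colorWeight_nonneg hS c) (Finset.sum_nonneg fun d _ => colorWeight_nonneg hS d)

theorem colorDist_le_half (hS : S.Sound b N D κ) (hb : 1 ≤ b) (hN : 0 < N) (hbN : 2 * b ^ 2 ≤ N)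
    (htot : N ≤ ∑ c, S.colorWeight b u w c) (c : Γ) : S.colorDist b u w c ≤ 1 / 2 := by
  unfold colorDist
  rw [div_le_iff₀ (hN.trans_le htot)]
  have : S.colorWeight b u w c ≤ b * b :=
    mul_le_mul (trunc_le (by linarith)) (trunc_le (by linarith))
      (trunc_nonneg (hS.y_nonneg w c)) (by linarith)
  nlinarith

theorem sum_colorDist (hN : 0 < N) (htot : N ≤ ∑ c, S.colorWeight b u w c) :
    ∑ c, S.colorDist b u w c = 1 := by
  unfold colorDist
  rw [← Finset.sum_div]
  exact div_self (hN.trans_le htot).ne'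

theorem reweight_colorDist_mul_le (hS : S.Sound b N D κ)
    (hP : Admissible b N D κ B δ η lam L (Fintype.card Γ))
    (htot : N ≤ ∑ c, S.colorWeight b u w c) (c d : Γ) :
    reweight (S.y u) (S.colorDist b u w) c d *
      (1 - (S.deg u + 1 + (S.q u d + (S.y w d - 1))) / N) ≤ 1 := by
  have hN := hP.N_pos
  have hp := colorDist_le_half hS hP.one_le_b hN hP.half htot d
  unfold reweight
  split_ifs with hdc
  · linarith
  rw [div_mul_eq_mul_div, div_le_one (by linarith)]
  have he : (S.deg u + 1 + (S.q u d + (S.y w d - 1))) / N =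
      (S.deg u + S.q u d) / N + S.y w d / N := by rw [← add_div]; congr 1; ring
  rw [he]
  have h1 := hS.y_mul_le u d
  have hy := hS.y_nonneg u d
  have h2 : S.colorDist b u w d ≤ S.y u d * (S.y w d / N) := by
    unfold colorDist colorWeight
    rw [← mul_div_assoc]
    exact div_le_div₀ (mul_nonneg hy (hS.y_nonneg w d))
      (mul_le_mul (trunc_le_self hy) (trunc_le_self (hS.y_nonneg w d))
        (trunc_nonneg (hS.y_nonneg w d)) hy) hN htot
  linarith

theorem reweight_colorDist_le (hS : S.Sound b N D κ)
    (hP : Admissible b N D κ B δ η lam L (Fintype.card Γ))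
    (htot : N ≤ ∑ c, S.colorWeight b u w c) (c d : Γ) :
    reweight (S.y u) (S.colorDist b u w) c d ≤ 2 * b := by
  have hb := hP.one_le_b
  have hp := colorDist_le_half hS hP.one_le_b hP.N_pos hP.half htot d
  unfold reweight
  split_ifs with hdc
  · linarith
  rw [div_le_iff₀ (by linarith)]
  by_cases hy : S.y u d ≤ b
  · nlinarith
  · have : S.colorDist b u w d = 0 := by simp [colorDist, colorWeight, trunc, hy]
    rw [this]
    linarith [hS.y_le u d]

theorem reweight_colorDist_nonneg (hS : S.Sound b N D κ)
    (hP : Admissible b N D κ B δ η lam L (Fintype.card Γ))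
    (htot : N ≤ ∑ c, S.colorWeight b u w c) (c d : Γ) :
    0 ≤ reweight (S.y u) (S.colorDist b u w) c d := by
  have hp := colorDist_le_half hS hP.one_le_b hP.N_pos hP.half htot d
  unfold reweight
  split_ifs
  · exact le_rfl
  · exact div_nonneg (hS.y_nonneg u d) (by linarith)

theorem sum_q_add_sq_le (hS : S.Sound b N D κ)
    (hP : Admissible b N D κ B δ η lam L (Fintype.card Γ))
    (h : |S.nbrCorr u w| ≤ 2 * δ * D ^ 2) :
    ∑ c, (S.q u c + (S.y w c - 1)) ^ 2 ≤ κ * D ^ 2 * (S.deg u + 1) := by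
  have h1 : ∑ c, (S.q u c + (S.y w c - 1)) ^ 2 =
      ∑ c, S.q u c ^ 2 + 2 * S.nbrCorr u w + ∑ c, (S.y w c - 1) ^ 2 := by
    rw [nbrCorr, Finset.mul_sum, ← Finset.sum_add_distrib, ← Finset.sum_add_distrib]
    exact Finset.sum_congr rfl fun c _ => by ring
  have h2 : ∑ c, (S.y w c - 1) ^ 2 ≤ 4 * b ^ 2 * Fintype.card Γ := by
    calc _ ≤ ∑ _c : Γ, 4 * b ^ 2 := Finset.sum_le_sum fun c _ => by
          have := pow_le_pow_left₀ (abs_nonneg _) (hS.abs_centered_le hP.one_le_b w c) 2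
          rw [sq_abs] at this
          linarith
      _ = _ := by simp [mul_comm]
  linarith [hS.q_sq u, hP.sq_growth, (abs_le.1 h).2]

theorem Sound.next_colorDist (hS : S.Sound b N D κ)
    (hP : Admissible b N D κ B δ η lam L (Fintype.card Γ)) (hne : u ≠ w)
    (htot : N ≤ ∑ c, S.colorWeight b u w c)
    (huw : |S.nbrCorr u w| ≤ 2 * δ * D ^ 2) (hwu : |S.nbrCorr w u| ≤ 2 * δ * D ^ 2)
    (hu : S.deg u + 1 ≤ D) (hw : S.deg w + 1 ≤ D) (c : Γ) :
    (S.next u w (S.colorDist b u w) c).Sound b N D κ := by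
  have htot' : N ≤ ∑ c, S.colorWeight b w u c := by rwa [colorWeight_comm]
  have hcomm := colorDist_comm S b u w
  have hb := hP.one_le_b
  have hqabs : ∀ a o d, |S.q a d + (S.y o d - 1)| ≤ 2 * b * (S.deg a + 1) := fun a o d => by
    linarith [abs_add_le (S.q a d) (S.y o d - 1), hS.q_abs a d, hS.abs_centered_le hb o d]
  constructor
  all_goals
    intro a
    have ha : a = u ∨ a = w ∨ a ≠ u ∧ a ≠ w := by tauto
    rcases ha with hau | haw | ⟨hau, haw⟩
    on_goal 1 => subst hau; simp only [next, true_or, if_true]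
    on_goal 2 => subst haw; simp only [next, hne.symm, or_true, if_true, if_false]
    on_goal 3 => simp only [next, hau, haw, or_self, if_false]
  · exact reweight_colorDist_nonneg hS hP htot c
  · rw [hcomm]; exact reweight_colorDist_nonneg hS hP htot' c
  · exact hS.y_nonneg a
  · exact reweight_colorDist_le hS hP htot c
  · rw [hcomm]; exact reweight_colorDist_le hS hP htot' c
  · exact hS.y_le a
  · exact reweight_colorDist_mul_le hS hP htot c
  · rw [hcomm]; exact reweight_colorDist_mul_le hS hP htot' c
  · exact hS.y_mul_le a
  · exact hqabs _ _
  · exact hqabs _ _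
  · exact hS.q_abs a
  · exact sum_q_add_sq_le hS hP huw
  · exact sum_q_add_sq_le hS hP hwu
  · exact hS.q_sq a
  · linarith [hS.deg_nonneg a]
  · linarith [hS.deg_nonneg a]
  · exact hS.deg_nonneg a
  · exact hu
  · exact hw
  · exact hS.deg_le a

theorem exists_color [Fintype V] (hS : S.Sound b N D κ)
    (hP : Admissible b N D κ B δ η lam L (Fintype.card Γ))
    (hE : S.energy B δ D lam ≤ Real.exp L) (hne : u ≠ w)
    (huw : ¬ S.adj u w) (hwu : ¬ S.adj w u) (hu : S.deg u + 1 ≤ D) (hw : S.deg w + 1 ≤ D) :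
    ∃ (p : Γ → ℝ) (c : Γ), S.y u c ≠ 0 ∧ S.y w c ≠ 0 ∧ (S.next u w p c).Sound b N D κ ∧
      (S.next u w p c).energy B δ D lam ≤ Real.exp L := by
  have hb := hP.one_le_b
  have hB0 : 0 ≤ B := le_trans (by positivity) hP.b_le_B
  have htot := le_sum_colorWeight hS hP hE hne
  have hp0 := colorDist_nonneg (u := u) (w := w) hS
  have hp := colorDist_le_half hS hb hP.N_pos hP.half htot
  have hsum := sum_colorDist hP.N_pos htot
  have hnbr := abs_nbrCorr_le hS hP.lam_pos hB0 hP.δ_nonneg hP.D_pos hE hP.potential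
  have hcorr := abs_corr_le hS hP.lam_pos hB0 hE hP.potential
  set p := S.colorDist b u w with hpdef
  have hlamB : |lam| * B ≤ 1 := by rw [abs_of_pos hP.lam_pos]; exact hP.lam_B
  have hdrift : ∑ c, p c * (S.next u w p c).energy B δ D lam ≤ S.energy B δ D lam := by
    simp only [energy, mul_add, Finset.sum_add_distrib]
    exact add_le_add
      (sum_mul_potential_next_le hS hb huw hwu hP.D_pos hp0 hp hsum hP.b_le_B hlamB hcorr)
      (sum_mul_potential_next_le hS hb huw hwu hP.D_pos hp0 hp hsum hP.b_le_B
        (by rwa [abs_neg]) hcorr)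
  obtain ⟨c, hc, hle⟩ : ∃ c, p c ≠ 0 ∧
      (S.next u w p c).energy B δ D lam ≤ S.energy B δ D lam := by
    by_contra! hcon
    obtain ⟨c, -, hc⟩ := Finset.exists_ne_zero_of_sum_ne_zero (hsum.trans_ne one_ne_zero)
    have hlt : ∑ c, p c * S.energy B δ D lam <
        ∑ c, p c * (S.next u w p c).energy B δ D lam := by
      refine Finset.sum_lt_sum (fun d _ => ?_) ⟨c, Finset.mem_univ c, ?_⟩
      · by_cases hd : p d = 0
        · simp [hd]
        · exact mul_le_mul_of_nonneg_left (hcon d hd).le (hp0 d)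
      · exact mul_lt_mul_of_pos_left (hcon c hc) (lt_of_le_of_ne (hp0 c) hc.symm)
    rw [← Finset.sum_mul, hsum, one_mul] at hlt
    exact absurd hdrift (not_le.2 hlt)
  refine ⟨p, c, ?_, ?_, hS.next_colorDist hP hne htot (hnbr u w hne huw) (hnbr w u hne.symm hwu)
    hu hw c, hle.trans hE⟩
  · intro h
    apply hc
    simp [hpdef, colorDist, colorWeight, trunc, h]
  · intro h
    apply hc
    simp [hpdef, colorDist, colorWeight, trunc, h]

end Coloring

section Initial

/-- The board before any edge has been presented. -/
def initial (V Γ : Type*) : Board V Γ where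
  y _ _ := 1
  q _ _ := 0
  deg _ := 0
  adj _ _ := False

theorem sound_initial {b N D κ : ℝ} (hb : 1 ≤ b) (hD : 0 ≤ D) : (initial V Γ).Sound b N D κ := by
  constructor <;> intros <;> simp [initial] <;> linarith

theorem energy_initial_le [Fintype V] (B δ D lam : ℝ) :
    (initial V Γ).energy B δ D lam ≤ 6 * (Fintype.card V : ℝ) ^ 2 := by
  have h : ∀ l, (initial V Γ).potential B δ D l ≤ 3 * (Fintype.card V : ℝ) ^ 2 := by
    intro l
    rcases isEmpty_or_nonempty V with hV | hV
    · simp [potential]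
    have hc : ∀ a a', (initial V Γ).corrTerm B l a a' ≤ 1 := fun a a' => by
      unfold corrTerm
      split_ifs <;> simp_all [initial, corr]
    have hn : ∀ a a', (initial V Γ).nbrTerm B δ D l a a' ≤ 1 := fun a a' => by
      unfold nbrTerm
      split_ifs <;> simp [initial, nbrCorr]
    have hm : ∀ a, (initial V Γ).massTerm B l a ≤ 1 := fun a => by
      simp [massTerm, initial, massDev]
    have h1 : (1 : ℝ) ≤ Fintype.card V := by exact_mod_cast Fintype.card_pos
    calc _ ≤ ∑ _a : V, (1 + ∑ _a' : V, ((1 : ℝ) + 1)) :=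
          Finset.sum_le_sum fun a _ => add_le_add (hm a)
            (Finset.sum_le_sum fun a' _ => add_le_add (hc a a') (hn a a'))
      _ ≤ _ := by
          simp
          nlinarith
  unfold energy
  linarith [h lam, h (-lam)]

end Initial

end Board

theorem eventually_admissible (ε : ℝ) (hε0 : 0 < ε) (hε1 : ε < 1) (M : ℝ) (hM : 1 < M) :
    ∃ b N' κ B δ η lam : ℝ, ∀ᶠ D : ℝ in Filter.atTop, ∀ K : ℝ, (1 + ε) * D ≤ K → K ≤ 3 * D →
      Board.Admissible b (N' * D) D κ B δ η lam (Real.log (6 * (M * D) ^ 2)) K := by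
  set b := 8 / ε with hb
  set B := 12 * b ^ 2 with hB
  set δ := ε ^ 5 / 100000 with hδ
  set lam := δ / (6 * B ^ 2) with hlam
  have hb1 : 1 ≤ b := by rw [hb, le_div_iff₀ hε0]; linarith
  have hB1 : 1 ≤ B := by nlinarith
  have hδ0 : 0 < δ := by positivity
  have hδ1 : δ ≤ 1 := by
    have : ε ^ 5 ≤ 1 := pow_le_one₀ hε0.le hε1.le
    rw [hδ]; linarith
  have hlam0 : 0 < lam := by positivity
  have hlamB : 6 * lam * B ^ 2 = δ := by rw [hlam]; field_simp
  refine ⟨b, 1 + ε / 2, 5 * δ, B, δ, ε / 4, lam, ?_⟩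
  set r := lam * δ / 6 with hr
  have hr0 : 0 < r := by positivity
  have hlog := Real.isLittleO_log_id_atTop.bound hr0
  filter_upwards [hlog, Filter.eventually_ge_atTop 1,
    Filter.eventually_ge_atTop ((Real.log (6 * M ^ 2) + 3 * lam * B) / r),
    Filter.eventually_ge_atTop (2 * b ^ 2), Filter.eventually_ge_atTop (12 * b ^ 2 / δ)]
    with D hlogD hD1 hDr hDb hDδ K hK1 hK3
  have hD : 0 < D := by linarith
  rw [div_le_iff₀ hr0] at hDr
  rw [div_le_iff₀ hδ0] at hDδ
  constructor
  · exact hb1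
  · positivity
  · exact hD
  · positivity
  · exact hδ0.le
  · exact hlam0
  · exact le_rfl
  · nlinarith
  · have h1 : Real.log (6 * (M * D) ^ 2) = Real.log (6 * M ^ 2) + 2 * Real.log D := by
      rw [mul_pow, ← mul_assoc, Real.log_mul (by positivity) (by positivity), Real.log_pow]
      norm_num
    have h2 : Real.log D ≤ r * D := by
      have := (le_abs_self _).trans hlogD
      rwa [id, Real.norm_eq_abs, abs_of_pos hD] at this
    have h3 : 2 * lam ^ 2 * B ^ 2 * D = 2 * r * D := by
      rw [hr, ← hlamB]; ring
    have h4 : lam * (δ * D) = 6 * r * D := by rw [hr]; ring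
    rw [h1, h3, h4]
    linarith [mul_pos hr0 hD]
  · have : b * ((1 + ε / 2) * D - (ε / 4 + 1) * D) = 2 * D := by
      rw [hb]; field_simp; ring
    rw [this]
    nlinarith
  · have h1 : 8 * b ^ 2 * (5 * δ) * D / (ε / 4) ^ 2 = 40960 / 100000 * (ε * D) := by
      rw [hb, hδ]; field_simp; norm_num
    have h2 : δ ≤ ε / 100000 := by
      have : ε ^ 5 ≤ ε ^ 1 := pow_le_pow_of_le_one hε0.le hε1.le (by norm_num)
      rw [hδ]; linarith
    rw [h1]
    nlinarith [mul_le_mul_of_nonneg_right h2 hD.le, mul_pos hε0 hD]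
  · nlinarith
  · nlinarith [mul_le_mul_of_nonneg_left hK3 (show 0 ≤ 4 * b ^ 2 by positivity)]

section Game

variable {n K : ℕ}

theorem Proper.append_singleton {s : State n K} (hs : Proper n K s)
    (x : Option (Sym2 (Fin n)) × Option (Fin K))
    (hx : ∀ p ∈ s, ∀ e₁ e₂, p.1 = some e₁ → x.1 = some e₂ → (∃ v, v ∈ e₁ ∧ v ∈ e₂) →
      ∀ c, p.2 = some c → x.2 ≠ some c) : Proper n K (s ++ [x]) := by
  rintro ⟨i, hi⟩ ⟨j, hj⟩ hij e₁ e₂ h₁ h₂ hne hv c hc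
  simp only [List.get_eq_getElem] at h₁ h₂ hc ⊢
  have hij : i ≠ j := fun h => hij (Fin.ext h)
  simp only [List.length_append, List.length_singleton] at hi hj
  rcases Nat.lt_succ_iff_lt_or_eq.1 hi with hi' | rfl <;>
    rcases Nat.lt_succ_iff_lt_or_eq.1 hj with hj' | rfl
  · rw [List.getElem_append_left hi'] at h₁ hc
    rw [List.getElem_append_left hj'] at h₂ ⊢
    exact hs ⟨i, hi'⟩ ⟨j, hj'⟩ (fun h => hij (Fin.ext_iff.1 h)) e₁ e₂ h₁ h₂ hne hv c hc
  · rw [List.getElem_append_left hi'] at h₁ hc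
    rw [List.getElem_concat_length rfl] at h₂ ⊢
    exact hx _ (List.getElem_mem hi') e₁ e₂ h₁ h₂ hv c hc
  · rw [List.getElem_concat_length rfl] at h₁ hc
    rw [List.getElem_append_left hj'] at h₂ ⊢
    obtain ⟨v, hv₁, hv₂⟩ := hv
    exact fun h => hx _ (List.getElem_mem hj') e₂ e₁ h₂ h₁ ⟨v, hv₂, hv₁⟩ c h hc
  · exact absurd rfl hij

theorem degreeIn_append_none (s : State n K) (v : Fin n) :
    degreeIn n K (s ++ [(none, none)]) v = degreeIn n K s v := by
  simp [degreeIn, List.filter_append]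

theorem degreeIn_append_some (s : State n K) (e : Sym2 (Fin n)) (c : Option (Fin K)) (v : Fin n) :
    degreeIn n K (s ++ [(some e, c)]) v = degreeIn n K s v + if v ∈ e then 1 else 0 := by
  by_cases h : v ∈ e <;> simp [degreeIn, List.filter_append, h]

/-- The board `S` certifies that the game can be continued from `s`. -/
structure Certifies (S : Board (Fin n) (Fin K)) (s : State n K) (b N D κ B δ lam L : ℝ) :
    Prop where
  sound : S.Sound b N D κ
  energy : S.energy B δ D lam ≤ Real.exp L
  deg : ∀ a, S.deg a = degreeIn n K s a
  adj : ∀ a a', S.adj a a' → ∃ p ∈ s, p.1 = some s(a, a')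
  used : ∀ p ∈ s, ∀ e c, p.1 = some e → p.2 = some c → ∀ v ∈ e, S.y v c = 0
  success : Success n K s
  proper : Proper n K s

variable {S : Board (Fin n) (Fin K)} {s : State n K} {b N κ B δ η lam L : ℝ} {Δ : ℕ}

theorem Certifies.append_none {D : ℝ} (h : Certifies S s b N D κ B δ lam L) :
    Certifies S (s ++ [(none, none)]) b N D κ B δ lam L where
  sound := h.sound
  energy := h.energy
  deg a := by rw [degreeIn_append_none, h.deg]
  adj a a' haa := by
    obtain ⟨p, hp, hpe⟩ := h.adj a a' haa
    exact ⟨p, List.mem_append_left _ hp, hpe⟩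
  used p hp e c he hc := by
    rcases List.mem_append.1 hp with hp | hp
    · exact h.used p hp e c he hc
    · simp_all
  success p hp := by
    rcases List.mem_append.1 hp with hp | hp
    · exact h.success p hp
    · simp_all
  proper := h.proper.append_singleton _ (by simp)

theorem Certifies.exists_append_some (h : Certifies S s b N (Δ : ℝ) κ B δ lam L)
    (hP : Board.Admissible b N Δ κ B δ η lam L K) {e : Sym2 (Fin n)}
    (he : LegalMove n K Δ s e) :
    ∃ c, ∃ S', Certifies S' (s ++ [(some e, some c)]) b N (Δ : ℝ) κ B δ lam L := by
  induction e using Sym2.ind with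
  | _ u w =>
  obtain ⟨hdiag, hnew, hdeg⟩ := he
  have hne : u ≠ w := fun huw => hdiag (by simpa using huw)
  have hnadj : ¬ S.adj u w := fun hadj => by
    obtain ⟨p, hp, hpe⟩ := h.adj u w hadj
    exact hnew p hp hpe
  have hnadj' : ¬ S.adj w u := fun hadj => by
    obtain ⟨p, hp, hpe⟩ := h.adj w u hadj
    exact hnew p hp (by rw [hpe, Sym2.eq_swap])
  have hd : ∀ v ∈ s(u, w), S.deg v + 1 ≤ Δ := fun v hv => by
    rw [h.deg]
    exact_mod_cast hdeg v hv
  obtain ⟨p, c, hu, hw, hsound, henergy⟩ := Board.exists_color h.sound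
    (by rwa [Fintype.card_fin]) h.energy hne hnadj hnadj'
    (hd u (Sym2.mem_mk_left u w)) (hd w (Sym2.mem_mk_right u w))
  refine ⟨c, S.next u w p c, hsound, henergy, fun a => ?_, fun a a' haa => ?_,
    fun x hx e' c' hxe hxc v hv => ?_, fun x hx => ?_, h.proper.append_singleton _ ?_⟩
  · rw [degreeIn_append_some]
    simp only [Board.next, Sym2.mem_iff]
    split_ifs <;> simp [h.deg]
  · rcases haa with haa | ⟨hne', ha, ha'⟩
    · obtain ⟨p, hp, hpe⟩ := h.adj a a' haa
      exact ⟨p, List.mem_append_left _ hp, hpe⟩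
    · refine ⟨_, List.mem_append_right _ (List.mem_singleton_self _), ?_⟩
      rcases ha with rfl | rfl <;> rcases ha' with rfl | rfl <;>
        first | exact absurd rfl hne' | rfl | rw [Sym2.eq_swap]
  · rcases List.mem_append.1 hx with hx | hx
    · have := h.used x hx e' c' hxe hxc v hv
      simp only [Board.next]
      split_ifs <;> simp [reweight, this]
    · obtain rfl := List.mem_singleton.1 hx
      cases hxe
      cases hxc
      simp [Board.next, Sym2.mem_iff.1 hv, reweight]
  · rcases List.mem_append.1 hx with hx | hx
    · exact h.success x hx
    · simp_all
  · rintro x hx e₁ e₂ hx₁ hx₂ ⟨v, hv₁, hv₂⟩ c' hc' hcc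
    cases hx₂
    cases hcc
    have := h.used x hx e₁ c hx₁ hc' v hv₁
    rcases Sym2.mem_iff.1 hv₂ with rfl | rfl
    · exact hu this
    · exact hw this

theorem certifies_initial {D : ℝ} (hb : 1 ≤ b) (hD : 0 ≤ D) (hL : 6 * (n : ℝ) ^ 2 ≤ Real.exp L) :
    Certifies (Board.initial (Fin n) (Fin K)) [] b N D κ B δ lam L where
  sound := Board.sound_initial hb hD
  energy := (Board.energy_initial_le B δ D lam).trans (by rwa [Fintype.card_fin])
  deg a := by simp [Board.initial, degreeIn]
  adj _ _ h := h.elim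
  used p hp := by simp at hp
  success p hp := by simp at hp
  proper i := i.elim0

theorem legalMove_of_enforce_eq_some {B : State n K → Option (Sym2 (Fin n))} {s : State n K}
    {e : Sym2 (Fin n)} (h : enforce n K Δ B s = some e) : LegalMove n K Δ s e := by
  unfold enforce at h
  split at h
  · cases h
  · split_ifs at h with hl
    cases h
    exact hl

/-- A property of states which Colorer can maintain forever yields a strategy. -/
theorem exists_strategy (P : State n K → Prop) (h0 : P [])
    (hnone : ∀ s, P s → P (s ++ [(none, none)]))
    (hsome : ∀ s, P s → ∀ e, LegalMove n K Δ s e → ∃ c, P (s ++ [(some e, some c)])) :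
    ∃ Col : State n K → Sym2 (Fin n) → Option (Fin K),
      ∀ B m, P (runDet n K Δ B Col m) := by
  refine ⟨fun s e => if h : ∃ c, P (s ++ [(some e, some c)]) then some h.choose else none,
    fun B m => ?_⟩
  induction m with
  | zero => exact h0
  | succ m ih =>
    simp only [runDet]
    split
    · exact hnone _ ih
    · rename_i e he
      have hex := hsome _ ih e (legalMove_of_enforce_eq_some he)
      rw [dif_pos hex]
      exact hex.choose_spec

end Game

/-- **Deterministic algorithm for dense graphs.** For every `ε ∈ (0,1)` and
`M > 1`, for all sufficiently large `Δ` and every `n ≤ M·Δ`, there is a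
deterministic Colorer strategy for the game `Φ(n,Δ,ε)` (with `⌈(1+ε)Δ⌉`
colors and `⌊nΔ/2⌋` steps) that, against every (possibly adaptive) Builder
strategy, colors every presented edge, producing a proper edge coloring. -/
theorem deterministic_dense (ε : ℝ) (hε0 : 0 < ε) (hε1 : ε < 1)
    (M : ℝ) (hM : 1 < M) :
    ∃ Δ₀ : ℕ, ∀ Δ : ℕ, Δ₀ ≤ Δ → ∀ n : ℕ, (n : ℝ) ≤ M * (Δ : ℝ) →
      ∃ Col : State n ⌈(1 + ε) * (Δ : ℝ)⌉₊ → Sym2 (Fin n) →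
          Option (Fin ⌈(1 + ε) * (Δ : ℝ)⌉₊),
        ∀ B : State n ⌈(1 + ε) * (Δ : ℝ)⌉₊ → Option (Sym2 (Fin n)),
          Success n ⌈(1 + ε) * (Δ : ℝ)⌉₊
              (runDet n ⌈(1 + ε) * (Δ : ℝ)⌉₊ Δ B Col (n * Δ / 2)) ∧
            Proper n ⌈(1 + ε) * (Δ : ℝ)⌉₊
              (runDet n ⌈(1 + ε) * (Δ : ℝ)⌉₊ Δ B Col (n * Δ / 2)) := by
  obtain ⟨b, N', κ, B, δ, η, lam, h⟩ := eventually_admissible ε hε0 hε1 M hM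
  obtain ⟨D₀, hD₀⟩ := Filter.eventually_atTop.1 h
  refine ⟨max ⌈D₀⌉₊ 1, fun Δ hΔ n hn => ?_⟩
  set K := ⌈(1 + ε) * (Δ : ℝ)⌉₊
  have hΔ1 : (1 : ℝ) ≤ Δ := by exact_mod_cast (le_max_right _ _).trans hΔ
  have hK1 : (1 + ε) * (Δ : ℝ) ≤ K := Nat.le_ceil _
  have hK3 : (K : ℝ) ≤ 3 * Δ := by
    have := Nat.ceil_lt_add_one (show 0 ≤ (1 + ε) * (Δ : ℝ) by positivity)
    nlinarith
  have hP := hD₀ Δ ((Nat.le_ceil _).trans (by exact_mod_cast (le_max_left _ _).trans hΔ)) K hK1 hK3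
  have hL : 6 * (n : ℝ) ^ 2 ≤ Real.exp (Real.log (6 * (M * Δ) ^ 2)) := by
    rw [Real.exp_log (by positivity)]
    gcongr
  obtain ⟨Col, hCol⟩ := exists_strategy (n := n) (K := K) (Δ := Δ)
    (fun s => ∃ S, Certifies S s b (N' * Δ) Δ κ B δ lam (Real.log (6 * (M * Δ) ^ 2)))
    ⟨_, certifies_initial hP.one_le_b hP.D_pos.le hL⟩
    (fun s ⟨S, hS⟩ => ⟨S, hS.append_none⟩)
    (fun s ⟨S, hS⟩ e he => hS.exists_append_some hP he)
  refine ⟨Col, fun B => ?_⟩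
  obtain ⟨S, hS⟩ := hCol B (n * Δ / 2)
  exact ⟨hS.success, hS.proper⟩

end RandomGreedyEC
end

section
/- There is an absolute constant c > 0 such that for all sufficiently large n the following holds. Let G be a tree on n vertices with maximum degree at most Δ, where Δ ≥ c·log n, and let the color set Γ have size ⌈Δ + 2√(Δ·log n)⌉. Then for any fixed order in which the edges of G are presented, the randomized greedy algorithm 𝒜 properly colors every edge of G with probability at least 1 − 1/n. -/
open scoped Classical ENNReal

namespace RandomGreedyEC

/-- Every edge of `G` has been presented and colored. -/
def ColorsAll (n K : ℕ) (G : SimpleGraph (Fin n)) (s : State n K) : Prop :=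
  ∀ e ∈ G.edgeSet, ∃ p ∈ s, p.1 = some e ∧ p.2 ≠ none

section Counting

variable {α : Type*} [Fintype α] [DecidableEq α]

lemma card_perm_mapsTo_insert (B D : Finset α) {x : α} (hx : x ∉ D) :
    ((Finset.univ.filter fun σ : Equiv.Perm α => ∀ y ∈ insert x D, σ y ∈ B).card : ℝ) *
        Fintype.card α ≤
      B.card * (Finset.univ.filter fun σ : Equiv.Perm α => ∀ y ∈ D, σ y ∈ B).card := by
  set N₁ := Finset.univ.filter fun σ : Equiv.Perm α => ∀ y ∈ insert x D, σ y ∈ B with hN₁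
  set N := Finset.univ.filter fun σ : Equiv.Perm α => ∀ y ∈ D, σ y ∈ B with hN
  have hsub : ∀ σ ∈ N, D ⊆ B.map σ.symm.toEmbedding := by
    intro σ hσ y hy
    simp only [hN, Finset.mem_filter, Finset.mem_univ, true_and] at hσ
    simp only [Finset.mem_map]
    exact ⟨σ y, hσ y hy, by simp⟩
  have hcount : N₁.card * (Dᶜ).card ≤
      ∑ σ ∈ N, (B.map σ.symm.toEmbedding \ D).card := by
    rw [← Finset.card_product, ← Finset.card_sigma]
    refine Finset.card_le_card_of_injOn (fun p => ⟨p.1 * Equiv.swap x p.2, p.2⟩) ?_ ?_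
    · rintro ⟨σ, y⟩ h
      simp only [hN₁, Finset.coe_product, Set.mem_prod, Finset.mem_coe, Finset.mem_filter,
        Finset.mem_univ, true_and, Finset.mem_compl] at h
      simp only [Finset.mem_coe, Finset.mem_sigma, hN, Finset.mem_filter, Finset.mem_univ,
        true_and, Finset.mem_sdiff, Finset.mem_map]
      refine ⟨fun z hz => ?_, ⟨σ x, h.1 x (Finset.mem_insert_self _ _), ?_⟩, h.2⟩
      · have h1 : z ≠ x := fun e => hx (e ▸ hz)
        have h2 : z ≠ y := fun e => h.2 (e ▸ hz)
        rw [Equiv.Perm.mul_apply, Equiv.swap_apply_of_ne_of_ne h1 h2]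
        exact h.1 z (Finset.mem_insert_of_mem hz)
      · simp [Equiv.symm_apply_eq]
    · rintro ⟨σ, y⟩ - ⟨σ', y'⟩ - h
      simp only [Sigma.mk.injEq, heq_eq_eq] at h
      obtain ⟨h1, rfl⟩ := h
      simpa using h1
  have hcard : (Dᶜ.card : ℝ) = Fintype.card α - D.card := by
    rw [Finset.card_compl, Nat.cast_sub (Finset.card_le_univ _)]
  have hterm : ∀ σ ∈ N, ((B.map σ.symm.toEmbedding \ D).card : ℝ) = B.card - D.card := by
    intro σ hσ
    rw [Finset.cast_card_sdiff (hsub σ hσ), Finset.card_map]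
  have hcount' : (N₁.card : ℝ) * (Fintype.card α - D.card) ≤ N.card * (B.card - D.card) := by
    have := (Nat.cast_le (α := ℝ)).2 hcount
    rw [Nat.cast_mul, hcard, Nat.cast_sum, Finset.sum_congr rfl hterm, Finset.sum_const,
      nsmul_eq_mul] at this
    exact this
  have hBα : (B.card : ℝ) ≤ Fintype.card α := by exact_mod_cast Finset.card_le_univ B
  have hDα : (D.card : ℝ) < Fintype.card α := by
    exact_mod_cast Finset.card_lt_univ_of_notMem hx
  have hmul : (N₁.card : ℝ) * Fintype.card α * (Fintype.card α - D.card) ≤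
      B.card * N.card * (Fintype.card α - D.card) := by
    have h1 := mul_le_mul_of_nonneg_right hcount' (Nat.cast_nonneg (α := ℝ) (Fintype.card α))
    have h2 : 0 ≤ (N.card : ℝ) * D.card * (Fintype.card α - B.card) :=
      mul_nonneg (by positivity) (by linarith)
    nlinarith
  exact le_of_mul_le_mul_right hmul (by linarith)

lemma card_perm_mapsTo_le (B D : Finset α) :
    ((Finset.univ.filter fun σ : Equiv.Perm α => ∀ y ∈ D, σ y ∈ B).card : ℝ) *
        (Fintype.card α : ℝ) ^ D.card ≤
      (B.card : ℝ) ^ D.card * Fintype.card (Equiv.Perm α) := by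
  induction D using Finset.induction_on with
  | empty => simp
  | insert x D hx ih =>
    rw [Finset.card_insert_of_notMem hx, pow_succ', pow_succ']
    have h := card_perm_mapsTo_insert B D hx
    calc _ = _ * (Fintype.card α : ℝ) * (Fintype.card α : ℝ) ^ D.card := by ring
      _ ≤ _ := mul_le_mul_of_nonneg_right h (by positivity)
      _ = B.card * (_ * (Fintype.card α : ℝ) ^ D.card) := by ring
      _ ≤ _ := mul_le_mul_of_nonneg_left ih (by positivity)
      _ = _ := by ring

end Counting

/-- If a distribution is invariant under each map of a finite family, then an event that is
hit, from every starting point, by at most an `ε` fraction of the maps has mass at most `ε`. -/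
lemma toOuterMeasure_le_of_invariant {α ι : Type*} [Fintype ι] [Nonempty ι] (μ : PMF α)
    (f : ι → α → α) (hf : ∀ i, μ.map (f i) = μ) (E : Set α) (ε : ℝ≥0∞)
    (h : ∀ a ∈ μ.support,
      ((Finset.univ.filter fun i => f i a ∈ E).card : ℝ≥0∞) ≤ Fintype.card ι * ε) :
    μ.toOuterMeasure E ≤ ε := by
  have hsum : (Fintype.card ι : ℝ≥0∞) * μ.toOuterMeasure E =
      ∑' a, μ a * ((Finset.univ.filter fun i => f i a ∈ E).card : ℝ≥0∞) := by
    calc (Fintype.card ι : ℝ≥0∞) * μ.toOuterMeasure E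
        = ∑ i : ι, (μ.map (f i)).toOuterMeasure E := by simp [hf]
      _ = ∑ i : ι, ∑' a, μ a * (if f i a ∈ E then 1 else 0) := by
        refine Finset.sum_congr rfl fun i _ => ?_
        rw [PMF.toOuterMeasure_map_apply, PMF.toOuterMeasure_apply]
        refine tsum_congr fun a => ?_
        by_cases ha : f i a ∈ E <;> simp [Set.indicator, ha]
      _ = _ := by
        rw [← Summable.tsum_finsetSum fun _ _ => ENNReal.summable]
        refine tsum_congr fun a => ?_
        rw [← Finset.mul_sum, Finset.sum_boole]
  have hle : (Fintype.card ι : ℝ≥0∞) * μ.toOuterMeasure E ≤ Fintype.card ι * ε := by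
    rw [hsum]
    calc _ ≤ ∑' a, μ a * (Fintype.card ι * ε) := by
          refine ENNReal.tsum_le_tsum fun a => ?_
          by_cases ha : a ∈ μ.support
          · gcongr
            exact h a ha
          · simp [(PMF.apply_eq_zero_iff μ a).2 ha]
      _ = _ := by rw [ENNReal.tsum_mul_right, μ.tsum_coe, one_mul]
  exact (ENNReal.mul_le_mul_iff_right (by simp) (by simp)).1 hle

lemma map_uniformOfFinset_equiv {α : Type*} (σ : Equiv.Perm α) (S T : Finset α)
    (hS : S.Nonempty) (hT : T.Nonempty) (h : ∀ c, σ c ∈ T ↔ c ∈ S) :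
    (PMF.uniformOfFinset S hS).map σ = PMF.uniformOfFinset T hT := by
  have hST : T = S.map σ.toEmbedding := by
    ext c
    simp only [Finset.mem_map, Equiv.coe_toEmbedding]
    constructor
    · intro hc
      exact ⟨σ.symm c, (h _).1 (by simpa using hc), by simp⟩
    · rintro ⟨d, hd, rfl⟩
      exact (h d).2 hd
  have hcard : T.card = S.card := by rw [hST, Finset.card_map]
  ext c
  obtain ⟨d, rfl⟩ := σ.surjective c
  rw [PMF.map_apply, tsum_eq_single d]
  · simp [PMF.uniformOfFinset_apply, h, hcard]
  · intro d' hd'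
    simp [hd'.symm]

variable {n K : ℕ}

/-- The colors used at the vertex `v` in the state `s`. -/
noncomputable def usedColors (s : State n K) (v : Fin n) : Finset (Fin K) :=
  Finset.univ.filter fun c => ∃ p ∈ s, (∃ e', p.1 = some e' ∧ v ∈ e') ∧ p.2 = some c

lemma mem_usedColors {s : State n K} {v : Fin n} {c : Fin K} :
    c ∈ usedColors s v ↔ ∃ p ∈ s, (∃ e', p.1 = some e' ∧ v ∈ e') ∧ p.2 = some c := by
  simp [usedColors]

lemma mem_freeEdge {s : State n K} {e : Sym2 (Fin n)} {c : Fin K} :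
    c ∈ freeEdge n K s e ↔ ∀ v ∈ e, c ∉ usedColors s v := by
  simp only [freeEdge, Finset.mem_filter, Finset.mem_univ, true_and, mem_usedColors]
  push Not
  rfl

/-- Recolor every edge of a state by a color permutation depending on the edge. -/
def recolor (τ : Option (Sym2 (Fin n)) → Equiv.Perm (Fin K)) (s : State n K) : State n K :=
  s.map fun p => (p.1, p.2.map (τ p.1))

lemma length_recolor (τ : Option (Sym2 (Fin n)) → Equiv.Perm (Fin K)) (s : State n K) :
    (recolor τ s).length = s.length := by
  simp [recolor]

lemma mem_usedColors_recolor {τ : Option (Sym2 (Fin n)) → Equiv.Perm (Fin K)}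
    {s : State n K} {v : Fin n} {σ : Equiv.Perm (Fin K)}
    (h : ∀ p ∈ s, ∀ e, p.1 = some e → v ∈ e → τ p.1 = σ) {c : Fin K} :
    σ c ∈ usedColors (recolor τ s) v ↔ c ∈ usedColors s v := by
  simp only [mem_usedColors, recolor, List.mem_map]
  constructor
  · rintro ⟨_, ⟨p, hp, rfl⟩, ⟨e, he, hv⟩, hc⟩
    refine ⟨p, hp, ⟨e, he, hv⟩, ?_⟩
    rw [h p hp e he hv, Option.map_eq_some_iff] at hc
    obtain ⟨d, hd, hdc⟩ := hc
    rw [hd, σ.injective hdc]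
  · rintro ⟨p, hp, ⟨e, he, hv⟩, hc⟩
    exact ⟨_, ⟨p, hp, rfl⟩, ⟨e, he, hv⟩, by simp [hc, h p hp e he hv]⟩

lemma greedyStep_recolor {τ : Option (Sym2 (Fin n)) → Equiv.Perm (Fin K)}
    {s : State n K} {e : Sym2 (Fin n)}
    (h : ∀ p ∈ s, ∀ e', p.1 = some e' → ∀ v ∈ e, v ∈ e' → τ p.1 = τ (some e)) :
    greedyStep n K (recolor τ s) (some e) =
      (greedyStep n K s (some e)).map (Option.map (τ (some e))) := by
  have hfree : ∀ c, τ (some e) c ∈ freeEdge n K (recolor τ s) e ↔ c ∈ freeEdge n K s e := by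
    intro c
    simp only [mem_freeEdge]
    refine forall₂_congr fun v hv => not_congr ?_
    exact mem_usedColors_recolor fun p hp e' he' hv' => h p hp e' he' v hv hv'
  have hne : (freeEdge n K (recolor τ s) e).Nonempty ↔ (freeEdge n K s e).Nonempty := by
    constructor
    · rintro ⟨c, hc⟩
      exact ⟨(τ (some e)).symm c, (hfree _).1 (by simpa using hc)⟩
    · rintro ⟨c, hc⟩
      exact ⟨_, (hfree c).2 hc⟩
  by_cases hs : (freeEdge n K s e).Nonempty
  · have hs' := hne.2 hs
    simp only [greedyStep, dif_pos hs, dif_pos hs']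
    rw [← map_uniformOfFinset_equiv (τ (some e)) _ _ hs hs' hfree, PMF.map_comp, PMF.map_comp]
    rfl
  · simp only [greedyStep, dif_neg hs, dif_neg (mt hne.1 hs), PMF.pure_map, Option.map_none]

/-- The Builder strategy presenting the edges of `l` in order. -/
abbrev listStrategy (K : ℕ) (l : List (Sym2 (Fin n))) (s : State n K) :
    Option (Sym2 (Fin n)) :=
  l[s.length]?

lemma map_fst_of_mem_support_run (l : List (Sym2 (Fin n))) {k : ℕ} (hk : k ≤ l.length)
    {s : State n K} (hs : s ∈ (run n K (listStrategy K l) k).support) :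
    s.map Prod.fst = (l.take k).map some := by
  induction k generalizing s with
  | zero =>
    simp only [run, PMF.support_pure, Set.mem_singleton_iff] at hs
    simp [hs]
  | succ k ih =>
    simp only [run, PMF.mem_support_bind_iff, PMF.support_map, Set.mem_image] at hs
    obtain ⟨s', hs', c, -, rfl⟩ := hs
    have h := ih (by omega) hs'
    have hlen : s'.length = k := by
      have := congrArg List.length h
      simpa [Nat.min_eq_left (show k ≤ l.length by omega)] using this
    have hlt : k < l.length := by omega
    rw [List.map_append, h, List.take_succ_eq_append_getElem hlt]
    rw [List.map_append]
    simp only [listStrategy, hlen, List.getElem?_eq_getElem hlt, List.map_cons, List.map_nil]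

lemma length_of_mem_support_run (l : List (Sym2 (Fin n))) {k : ℕ} (hk : k ≤ l.length)
    {s : State n K} (hs : s ∈ (run n K (listStrategy K l) k).support) : s.length = k := by
  have := congrArg List.length (map_fst_of_mem_support_run l hk hs)
  simpa [Nat.min_eq_left hk] using this

lemma mem_take_of_mem_support_run (l : List (Sym2 (Fin n))) {k : ℕ} (hk : k ≤ l.length)
    {s : State n K} (hs : s ∈ (run n K (listStrategy K l) k).support)
    {p : Option (Sym2 (Fin n)) × Option (Fin K)} (hp : p ∈ s) {e : Sym2 (Fin n)}
    (he : p.1 = some e) : e ∈ l.take k := by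
  have h1 : p.1 ∈ s.map Prod.fst := List.mem_map_of_mem hp
  rw [map_fst_of_mem_support_run l hk hs, he] at h1
  obtain ⟨e', he', hee⟩ := List.mem_map.1 h1
  exact Option.some_injective _ hee ▸ he'

lemma pmf_bind_congr {α β : Type*} {μ : PMF α} {f g : α → PMF β}
    (h : ∀ a ∈ μ.support, f a = g a) : μ.bind f = μ.bind g := by
  ext b
  rw [PMF.bind_apply, PMF.bind_apply]
  refine tsum_congr fun a => ?_
  by_cases ha : a ∈ μ.support
  · rw [h a ha]
  · simp [(PMF.apply_eq_zero_iff μ a).2 ha]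

/-- The law of the coloring is invariant under recolorings that agree on incident edges. -/
lemma map_recolor_run (l : List (Sym2 (Fin n)))
    (τ : Option (Sym2 (Fin n)) → Equiv.Perm (Fin K)) {k : ℕ} (hk : k ≤ l.length)
    (h : ∀ e ∈ l.take k, ∀ e' ∈ l.take k, ∀ v ∈ e, v ∈ e' → τ (some e') = τ (some e)) :
    (run n K (listStrategy K l) k).map (recolor τ) = run n K (listStrategy K l) k := by
  induction k with
  | zero => simp [run, recolor, PMF.pure_map]
  | succ k ih =>
    have hsub : ∀ e ∈ l.take k, e ∈ l.take (k + 1) := fun e he =>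
      (List.take_subset_take_left l (Nat.le_succ k)) he
    have ih' := ih (by omega) fun e he e' he' => h e (hsub e he) e' (hsub e' he')
    have hlt : k < l.length := by omega
    simp only [run]
    rw [PMF.map_bind]
    conv_rhs => rw [← ih', PMF.bind_map]
    refine pmf_bind_congr fun s hs => ?_
    have hlen := length_of_mem_support_run l (by omega) hs
    have hB : listStrategy K l s = some l[k] := by simp [listStrategy, hlen, hlt]
    have hB' : listStrategy K l (recolor τ s) = some l[k] := by
      simp [listStrategy, length_recolor, hlen, hlt]
    have hmem : l[k] ∈ l.take (k + 1) := by
      rw [List.take_succ_eq_append_getElem hlt]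
      exact List.mem_append_right _ (List.mem_singleton_self _)
    simp only [Function.comp_apply, hB, hB']
    rw [greedyStep_recolor, PMF.map_comp, PMF.map_comp]
    · congr 1
      funext c
      simp [recolor]
    · intro p hp e' he' v hv hv'
      rw [he']
      exact h _ hmem e' (hsub _ (mem_take_of_mem_support_run l (by omega) hs hp he')) v hv hv'

lemma card_usedColors_le {s : State n K} {L : List (Sym2 (Fin n))} (hL : L.Nodup)
    (hs : s.map Prod.fst = L.map some) (G : SimpleGraph (Fin n))
    (hG : ∀ e ∈ L, e ∈ G.edgeSet) (v : Fin n) :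
    (usedColors s v).card ≤ (G.neighborSet v).ncard := by
  have hsub : (usedColors s v) ⊆
      ((s.filter fun p => decide (∃ e', p.1 = some e' ∧ v ∈ e')).filterMap Prod.snd).toFinset := by
    intro c hc
    obtain ⟨p, hp, hv, hpc⟩ := mem_usedColors.1 hc
    simp only [List.mem_toFinset, List.mem_filterMap, List.mem_filter, decide_eq_true_eq]
    exact ⟨p, ⟨hp, hv⟩, hpc⟩
  have hlen : (s.filter fun p => decide (∃ e', p.1 = some e' ∧ v ∈ e')).length =
      (L.filter fun e => decide (v ∈ e)).length := by
    have h1 : (s.filter fun p => decide (∃ e', p.1 = some e' ∧ v ∈ e')).length =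
        ((s.map Prod.fst).filter fun q => decide (∃ e', q = some e' ∧ v ∈ e')).length := by
      rw [List.filter_map, List.length_map]
      rfl
    rw [h1, hs, List.filter_map, List.length_map]
    congr 2
    funext e
    simp
  calc (usedColors s v).card
      ≤ (s.filter fun p => decide (∃ e', p.1 = some e' ∧ v ∈ e')).length :=
        (Finset.card_le_card hsub).trans
          ((List.toFinset_card_le _).trans (List.length_filterMap_le _ _))
    _ = (L.filter fun e => decide (v ∈ e)).toFinset.card := by
        rw [hlen, List.toFinset_card_of_nodup (hL.filter _)]
    _ ≤ (G.incidenceFinset v).card := by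
        refine Finset.card_le_card fun e he => ?_
        simp only [List.mem_toFinset, List.mem_filter, decide_eq_true_eq] at he
        rw [SimpleGraph.mem_incidenceFinset]
        exact ⟨hG e he.1, he.2⟩
    _ = (G.neighborSet v).ncard := by
        rw [SimpleGraph.card_incidenceFinset_eq_degree, Set.ncard_eq_toFinset_card',
          ← SimpleGraph.card_neighborFinset_eq_degree]
        rfl

/-- When an edge of a forest arrives, the colors used at its two endpoints come from different
components, so the edge is stuck only with small probability. -/
lemma freeEdge_empty_le (G : SimpleGraph (Fin n)) (hG : G.IsAcyclic) {l : List (Sym2 (Fin n))}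
    (hl : l.Nodup) (hlG : ∀ e ∈ l, e ∈ G.edgeSet) {k : ℕ} (hk : k < l.length) (ε : ℝ≥0∞) (Δ : ℕ)
    (hΔ : ∀ v, (G.neighborSet v).ncard ≤ Δ)
    (hε : ∀ A B : Finset (Fin K), A.card ≤ Δ → B.card ≤ Δ →
      ((Finset.univ.filter fun σ : Equiv.Perm (Fin K) => ∀ c ∈ Aᶜ, σ c ∈ B).card : ℝ≥0∞) ≤
        Fintype.card (Equiv.Perm (Fin K)) * ε) :
    (run n K (listStrategy K l) k).toOuterMeasure {s | ¬ (freeEdge n K s l[k]).Nonempty} ≤ ε := by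
  obtain ⟨⟨u, v⟩, huv⟩ : ∃ q : Fin n × Fin n, s(q.1, q.2) = l[k] :=
    ⟨_, Quot.out_eq l[k]⟩
  simp only at huv
  set H : SimpleGraph (Fin n) := SimpleGraph.fromEdgeSet {e | e ∈ l.take k} with hH
  have hadj : G.Adj u v := by
    rw [← SimpleGraph.mem_edgeSet, huv]
    exact hlG _ (List.getElem_mem hk)
  have hnot : l[k] ∉ l.take k := by
    intro hmem
    obtain ⟨i, hi, hik⟩ := List.mem_take_iff_getElem.1 hmem
    have := (List.Nodup.getElem_inj_iff hl).1 hik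
    omega
  have hHG : H ≤ G \ SimpleGraph.fromEdgeSet {s(u, v)} := by
    intro a b hab
    rw [hH, SimpleGraph.fromEdgeSet_adj] at hab
    have hmem : s(a, b) ∈ l.take k := hab.1
    rw [SimpleGraph.sdiff_adj, SimpleGraph.fromEdgeSet_adj]
    refine ⟨hlG _ (List.mem_of_mem_take hmem), fun hab' => hnot ?_⟩
    rw [← huv, ← Set.mem_singleton_iff.1 hab'.1]
    exact hmem
  have hunreach : ¬ H.Reachable v u := by
    intro hr
    have hb := SimpleGraph.isAcyclic_iff_forall_adj_isBridge.1 hG hadj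
    exact (SimpleGraph.isBridge_iff.1 hb) (hr.symm.mono hHG)
  have hreach : ∀ e ∈ l.take k, ∀ x ∈ e, ∀ y ∈ e, H.Reachable v x → H.Reachable v y := by
    intro e he x hx y hy hr
    by_cases hxy : x = y
    · exact hxy ▸ hr
    · refine hr.trans (SimpleGraph.Adj.reachable ?_)
      rw [hH, SimpleGraph.fromEdgeSet_adj]
      refine ⟨?_, hxy⟩
      rwa [Set.mem_ofPred_eq, ← (Sym2.mem_and_mem_iff hxy).1 ⟨hx, hy⟩]
  let τ : Equiv.Perm (Fin K) → Option (Sym2 (Fin n)) → Equiv.Perm (Fin K) :=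
    fun σ q => if ∃ e, q = some e ∧ ∃ x ∈ e, H.Reachable v x then σ.symm else 1
  have hτ : ∀ σ, ∀ e ∈ l.take k, ∀ x ∈ e,
      τ σ (some e) = if H.Reachable v x then σ.symm else 1 := by
    intro σ e he x hx
    have : (∃ e', some e = some e' ∧ ∃ x ∈ e', H.Reachable v x) ↔ H.Reachable v x := by
      constructor
      · rintro ⟨e', hee, y, hy, hr⟩
        obtain rfl := Option.some_injective _ hee
        exact hreach e he y hy x hx hr
      · intro hr
        exact ⟨e, rfl, x, hx, hr⟩
    simp only [τ, this]
  refine toOuterMeasure_le_of_invariant _ (fun σ => recolor (τ σ))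
    (fun σ => map_recolor_run l _ hk.le ?_) _ ε ?_
  · intro e he e' he' x hx hx'
    rw [hτ σ e he x hx, hτ σ e' he' x hx']
  · intro s hs
    have hfst := map_fst_of_mem_support_run l hk.le hs
    have hcard : ∀ w, (usedColors s w).card ≤ Δ := fun w =>
      (card_usedColors_le (hl.sublist (List.take_sublist _ _)) hfst G
        (fun e he => hlG e (List.mem_of_mem_take he)) w).trans (hΔ w)
    refine le_trans ?_ (hε (usedColors s u) (usedColors s v) (hcard u) (hcard v))
    refine Nat.cast_le.2 (Finset.card_le_card fun σ hσ => ?_)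
    simp only [Finset.mem_filter, Finset.mem_univ, true_and, Set.mem_ofPred_eq,
      Finset.not_nonempty_iff_eq_empty, Finset.eq_empty_iff_forall_notMem, mem_freeEdge,
      ← huv, Sym2.mem_iff, forall_eq_or_imp, forall_eq, Finset.mem_compl] at hσ ⊢
    intro c hc
    have hu : c ∈ usedColors (recolor (τ σ) s) u ↔ c ∈ usedColors s u := by
      refine mem_usedColors_recolor (σ := 1) fun p hp e he hue => ?_
      rw [he, hτ σ e (mem_take_of_mem_support_run l hk.le hs hp he) u hue, if_neg hunreach]
    have hv : c ∈ usedColors (recolor (τ σ) s) v ↔ σ c ∈ usedColors s v := by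
      conv_lhs => rw [← σ.symm_apply_apply c]
      refine mem_usedColors_recolor (σ := σ.symm) fun p hp e he hve => ?_
      rw [he, hτ σ e (mem_take_of_mem_support_run l hk.le hs hp he) v hve,
        if_pos (SimpleGraph.Reachable.refl _)]
    have := hσ c
    rw [hu, hv] at this
    tauto

/-- The probability that some edge stays uncolored grows in one step by at most the probability
that the new edge has no free color. -/
lemma uncolored_run_succ_le (l : List (Sym2 (Fin n))) {k : ℕ} (hk : k < l.length) :
    (run n K (listStrategy K l) (k + 1)).toOuterMeasure {s | ∃ p ∈ s, p.2 = none} ≤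
      (run n K (listStrategy K l) k).toOuterMeasure {s | ∃ p ∈ s, p.2 = none} +
      (run n K (listStrategy K l) k).toOuterMeasure
        {s | ¬ (freeEdge n K s l[k]).Nonempty} := by
  simp only [run]
  rw [PMF.toOuterMeasure_bind_apply, PMF.toOuterMeasure_apply, PMF.toOuterMeasure_apply,
    ← ENNReal.tsum_add]
  refine ENNReal.tsum_le_tsum fun s => ?_
  by_cases hs : s ∈ (run n K (listStrategy K l) k).support
  swap
  · simp [(PMF.apply_eq_zero_iff _ s).2 hs]
  have hone : ∀ (μ : PMF (State n K)) (E : Set (State n K)), μ.toOuterMeasure E ≤ 1 := by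
    intro μ E
    calc μ.toOuterMeasure E ≤ μ.toOuterMeasure Set.univ :=
          μ.toOuterMeasure.mono (Set.subset_univ _)
      _ = 1 := (PMF.toOuterMeasure_apply_eq_one_iff _ _).2 (Set.subset_univ _)
  by_cases h1 : ∃ p ∈ s, p.2 = none
  · rw [Set.indicator_of_mem (by exact h1)]
    exact le_add_right (mul_le_of_le_one_right' (hone _ _))
  by_cases h2 : (freeEdge n K s l[k]).Nonempty
  swap
  · rw [Set.indicator_of_mem (s := {s | ¬ (freeEdge n K s l[k]).Nonempty}) (by exact h2)]
    exact le_add_left (mul_le_of_le_one_right' (hone _ _))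
  have hlen := length_of_mem_support_run l hk.le hs
  have hB : listStrategy K l s = some l[k] := by simp [listStrategy, hlen, hk]
  have hzero : ((greedyStep n K s (listStrategy K l s)).map
      fun c => s ++ [(listStrategy K l s, c)]).toOuterMeasure {s | ∃ p ∈ s, p.2 = none} = 0 := by
    rw [PMF.toOuterMeasure_apply_eq_zero_iff, Set.disjoint_left, hB]
    intro t ht hbad
    simp only [greedyStep, dif_pos h2, PMF.support_map, Set.mem_image] at ht
    obtain ⟨_, ⟨c, -, rfl⟩, rfl⟩ := ht
    obtain ⟨p, hp, hpn⟩ := hbad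
    rcases List.mem_append.1 hp with hp | hp
    · exact h1 ⟨p, hp, hpn⟩
    · rw [List.mem_singleton.1 hp] at hpn
      simp at hpn
  rw [hzero]
  simp

lemma uncolored_run_le (l : List (Sym2 (Fin n))) (ε : ℝ≥0∞)
    (h : ∀ k (hk : k < l.length), (run n K (listStrategy K l) k).toOuterMeasure
      {s | ¬ (freeEdge n K s l[k]).Nonempty} ≤ ε) {k : ℕ} (hk : k ≤ l.length) :
    (run n K (listStrategy K l) k).toOuterMeasure {s | ∃ p ∈ s, p.2 = none} ≤ k * ε := by
  induction k with
  | zero =>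
    simp [run, PMF.toOuterMeasure_pure_apply]
  | succ k ih =>
    refine (uncolored_run_succ_le l hk).trans ?_
    push_cast
    rw [add_mul, one_mul]
    exact add_le_add (ih (by omega)) (h k hk)

lemma one_le_colorsAll_add_uncolored (G : SimpleGraph (Fin n)) {l : List (Sym2 (Fin n))}
    (hl : ∀ e ∈ G.edgeSet, e ∈ l) :
    1 ≤ (run n K (listStrategy K l) l.length).toOuterMeasure {s | ColorsAll n K G s} +
      (run n K (listStrategy K l) l.length).toOuterMeasure {s | ∃ p ∈ s, p.2 = none} := by
  refine le_trans ?_ (MeasureTheory.measure_union_le _ _)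
  refine ((PMF.toOuterMeasure_apply_eq_one_iff _ _).2 fun s hs => ?_).ge
  by_cases h : ∃ p ∈ s, p.2 = none
  · exact Or.inr h
  · refine Or.inl fun e he => ?_
    have hmem : some e ∈ s.map Prod.fst := by
      rw [map_fst_of_mem_support_run l le_rfl hs]
      simpa using hl e he
    obtain ⟨p, hp, hpe⟩ := List.mem_map.1 hmem
    exact ⟨p, hp, hpe, fun hn => h ⟨p, hp, hn⟩⟩

lemma pow_ratio_mul_sq_le_one {n Δ K b d : ℕ} (hn : 2 ≤ n) (hΔ : 4 * Real.log n ≤ Δ)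
    (hK : (Δ : ℝ) + 2 * Real.sqrt (Δ * Real.log n) ≤ K) (hb : b ≤ Δ) (hd : K ≤ d + Δ) :
    ((b : ℝ) / K) ^ d * (n : ℝ) ^ 2 ≤ 1 := by
  have hn0 : (0 : ℝ) < n := by positivity
  have hlog : 0 < Real.log n := Real.log_pos (by exact_mod_cast hn)
  have hΔ0 : (0 : ℝ) < Δ := by linarith
  set r := 2 * Real.sqrt (Δ * Real.log n) with hr
  have hr0 : 0 ≤ r := by positivity
  have hrsq : r ^ 2 = 4 * Real.log n * Δ := by
    rw [hr, mul_pow, Real.sq_sqrt (by positivity)]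
    ring
  have hrΔ : r ≤ Δ := by nlinarith
  have hK0 : (0 : ℝ) < K := by linarith
  have hbK : (b : ℝ) / K ≤ Real.exp (-(r / (Δ + r))) := by
    have h1 : (b : ℝ) / K ≤ Δ / (Δ + r) := by
      have : (b : ℝ) ≤ Δ := by exact_mod_cast hb
      gcongr
    have h2 : (Δ : ℝ) / (Δ + r) = -(r / (Δ + r)) + 1 := by
      field_simp
      ring
    exact (h1.trans h2.le).trans (Real.add_one_le_exp _)
  have hdr : r ≤ d := by
    have : (K : ℝ) ≤ d + Δ := by exact_mod_cast hd
    linarith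
  have hexp : 2 * Real.log n ≤ d * (r / (Δ + r)) := by
    rw [← mul_div_assoc, le_div_iff₀ (by positivity)]
    nlinarith
  have hsq : (n : ℝ) ^ 2 = Real.exp (2 * Real.log n) := by
    rw [two_mul, Real.exp_add, Real.exp_log hn0, sq]
  calc ((b : ℝ) / K) ^ d * (n : ℝ) ^ 2
      ≤ Real.exp (-(r / (Δ + r))) ^ d * Real.exp (2 * Real.log n) := by
        rw [hsq]
        gcongr
    _ = Real.exp (2 * Real.log n - d * (r / (Δ + r))) := by
        rw [← Real.exp_nat_mul, ← Real.exp_add]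
        congr 1
        ring
    _ ≤ 1 := Real.exp_le_one_iff.2 (by linarith)

lemma card_perm_cover_le {n Δ K : ℕ} (hn : 2 ≤ n) (hΔ : 4 * Real.log n ≤ Δ)
    (hK : (Δ : ℝ) + 2 * Real.sqrt (Δ * Real.log n) ≤ K) (A B : Finset (Fin K))
    (hA : A.card ≤ Δ) (hB : B.card ≤ Δ) :
    ((Finset.univ.filter fun σ : Equiv.Perm (Fin K) => ∀ c ∈ Aᶜ, σ c ∈ B).card : ℝ≥0∞) ≤
      Fintype.card (Equiv.Perm (Fin K)) * ((n : ℝ≥0∞) ^ 2)⁻¹ := by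
  have hcount :
      ((Finset.univ.filter fun σ : Equiv.Perm (Fin K) => ∀ c ∈ Aᶜ, σ c ∈ B).card : ℝ) *
        (K : ℝ) ^ Aᶜ.card ≤ (B.card : ℝ) ^ Aᶜ.card * Fintype.card (Equiv.Perm (Fin K)) := by
    convert card_perm_mapsTo_le B Aᶜ
    exact (Fintype.card_fin K).symm
  have hK0 : (0 : ℝ) < K := by
    have hlog : 0 < Real.log n := Real.log_pos (by exact_mod_cast hn)
    have := Real.sqrt_nonneg (Δ * Real.log n)
    linarith
  have hratio := pow_ratio_mul_sq_le_one (b := B.card) (d := Aᶜ.card) hn hΔ hK hB (by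
    rw [Finset.card_compl, Fintype.card_fin]
    omega)
  set N := (Finset.univ.filter fun σ : Equiv.Perm (Fin K) => ∀ c ∈ Aᶜ, σ c ∈ B).card
  set M := Fintype.card (Equiv.Perm (Fin K))
  have hNM : N * n ^ 2 ≤ M := by
    have h1 : (N : ℝ) ≤ ((B.card : ℝ) / K) ^ Aᶜ.card * M := by
      rw [div_pow, div_mul_eq_mul_div, le_div_iff₀ (by positivity)]
      exact hcount
    have h2 : (N : ℝ) * (n : ℝ) ^ 2 ≤ M :=
      calc (N : ℝ) * (n : ℝ) ^ 2 ≤ ((B.card : ℝ) / K) ^ Aᶜ.card * M * (n : ℝ) ^ 2 := by gcongr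
        _ = ((B.card : ℝ) / K) ^ Aᶜ.card * (n : ℝ) ^ 2 * M := by ring
        _ ≤ 1 * M := by gcongr
        _ = M := one_mul _
    exact_mod_cast h2
  have hn0 : (n : ℝ≥0∞) ≠ 0 := by
    simp only [ne_eq, Nat.cast_eq_zero]
    omega
  rw [← div_eq_mul_inv, ENNReal.le_div_iff_mul_le (by simp [hn0]) (by simp)]
  exact_mod_cast hNM

/-- **Trees.** There is an absolute constant `c > 0` such that for all
sufficiently large `n`: if `G` is a tree on `n` vertices with maximum degree
at most `Δ`, where `Δ ≥ c·log n`, the color set has size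
`⌈Δ + 2√(Δ·log n)⌉`, and the edges of `G` are presented in any fixed order
(given by a list `l` enumerating the edges of `G`), then the randomized
greedy algorithm properly colors every edge of `G` with probability at least
`1 − 1/n`. -/
theorem tree_case :
    ∃ c : ℝ, 0 < c ∧ ∃ n₀ : ℕ, ∀ n : ℕ, n₀ ≤ n →
      ∀ Δ : ℕ, c * Real.log n ≤ (Δ : ℝ) →
      ∀ G : SimpleGraph (Fin n), G.IsTree → (∀ v, (G.neighborSet v).ncard ≤ Δ) →
      ∀ l : List (Sym2 (Fin n)), l.Nodup → (∀ e, e ∈ l ↔ e ∈ G.edgeSet) →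
        1 - ((n : ℝ≥0∞))⁻¹ ≤
          (run n ⌈(Δ : ℝ) + 2 * Real.sqrt ((Δ : ℝ) * Real.log n)⌉₊
              (fun s => l[s.length]?) l.length).toOuterMeasure
            {s | ColorsAll n ⌈(Δ : ℝ) + 2 * Real.sqrt ((Δ : ℝ) * Real.log n)⌉₊ G s} := by
  refine ⟨4, by norm_num, 2, fun n hn Δ hΔ G hG hdeg l hl hlG => ?_⟩
  set K := ⌈(Δ : ℝ) + 2 * Real.sqrt ((Δ : ℝ) * Real.log n)⌉₊
  have hK : (Δ : ℝ) + 2 * Real.sqrt ((Δ : ℝ) * Real.log n) ≤ K := Nat.le_ceil _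
  have hlen : l.length ≤ n := by
    have h1 : l.toFinset ⊆ G.edgeFinset := fun e he => by
      simpa [hlG] using he
    have h2 := Finset.card_le_card h1
    have h3 := hG.card_edgeFinset
    rw [Fintype.card_fin] at h3
    rw [List.toFinset_card_of_nodup hl] at h2
    omega
  have hbad := uncolored_run_le (K := K) l ((n : ℝ≥0∞) ^ 2)⁻¹ (fun k hk =>
    freeEdge_empty_le G hG.isAcyclic hl (fun e he => (hlG e).1 he) hk _ Δ hdeg
      (card_perm_cover_le hn hΔ hK)) le_rfl
  have hn0 : (n : ℝ≥0∞) ≠ 0 := by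
    simp only [ne_eq, Nat.cast_eq_zero]
    omega
  have hsum : (l.length : ℝ≥0∞) * ((n : ℝ≥0∞) ^ 2)⁻¹ ≤ (n : ℝ≥0∞)⁻¹ := by
    calc (l.length : ℝ≥0∞) * ((n : ℝ≥0∞) ^ 2)⁻¹ ≤ n * ((n : ℝ≥0∞) ^ 2)⁻¹ := by gcongr
      _ = (n : ℝ≥0∞)⁻¹ := by
        rw [sq, ENNReal.mul_inv (Or.inl hn0) (Or.inl (by simp)), ← mul_assoc,
          ENNReal.mul_inv_cancel hn0 (by simp), one_mul]
  rw [tsub_le_iff_right]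
  exact (one_le_colorsAll_add_uncolored G fun e he => (hlG e).2 he).trans
    (add_le_add le_rfl (hbad.trans hsum))

end RandomGreedyEC
end
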